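/- arXiv:1512.07138 — 2 statements merged into one kernel-verified Lean document; each statement's English description precedes it below -/
import Mathlib

section
/- Let g satisfy (g*), (g₀), (g∞) and let a be a locally integrable periodic function of minimal period T > 0 satisfying (a*). For every ρ > 0 there exist λ* > 0 and, for each λ > λ*, constants 0 < r < ρ < R and μ*(λ) > 0 such that for every μ > μ*(λ) the following holds. Let Y₀ ⊆ C(ℝ,ℝ²) be the set of pairs (x, x') with x a globally defined solution of u'' + (λa⁺ − μa⁻)g(u) = 0 satisfying 0 ≤ x(t) ≤ R for all t, equipped with the topology of uniform convergence on compacta, and let ψ be the T-shift (ψz)(t) = z(t+T). Then: (i) for every (x,y) ∈ Y₀, every i ∈ {1,…,m} and ℓ ∈ ℤ, exactly one of the alternatives max_{I⁺_{i,ℓ}} x < r, r < max_{I⁺_{i,ℓ}} x < ρ, ρ < max_{I⁺_{i,ℓ}} x < R holds (I⁺_{i,ℓ} := I⁺_i + ℓT), so the coding map π : Y₀ → ({0,1,2}^m)^ℤ assigning to (x,y) the sequence (T_ℓ)_{ℓ∈ℤ} with T_ℓ^i = 0, 1, 2 according to the respective alternative is well defined; (ii) π is continuous and surjective; (iii) π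 ∘ ψ = σ ∘ π, where σ is the shift σ((T_ℓ)_ℓ) = (T_{ℓ+1})_ℓ on ({0,1,2}^m)^ℤ; (iv) for every integer k ≥ 1, every k-periodic sequence in ({0,1,2}^m)^ℤ has a π-preimage (u,u') ∈ Y₀ with u a kT-periodic solution. -/
open MeasureTheory Set Filter Topology

/-- The maximum (`sSup` of the image) of the first component of `z` over the
interval `I⁺_{i,ℓ} = [σ i + ℓT, τ i + ℓT]`. -/
noncomputable def codeSup (σ τ : ℕ → ℝ) (T : ℝ) (z : C(ℝ, ℝ × ℝ)) (i : ℕ) (ℓ : ℤ) : ℝ :=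
  sSup ((fun t => (z t).1) '' Set.Icc (σ i + ℓ * T) (τ i + ℓ * T))

/-- The integer part of a continuous function avoiding the integers is constant. -/
lemma floor_eq_of_ne_int {φ : ℝ → ℝ} {a b : ℝ} (hab : a ≤ b) (hφ : ContinuousOn φ (Icc a b))
    (h : ∀ t ∈ Icc a b, ∀ n : ℤ, φ t ≠ n) : ⌊φ a⌋ = ⌊φ b⌋ := by
  rcases lt_trichotomy ⌊φ a⌋ ⌊φ b⌋ with hlt | heq | hlt
  · exfalso
    have h1 : φ a ≤ (⌊φ b⌋ : ℝ) := (Int.floor_lt.1 hlt).le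
    obtain ⟨t, ht, hte⟩ := intermediate_value_Icc hab hφ ⟨h1, Int.floor_le _⟩
    exact h t ht _ hte
  · exact heq
  · exfalso
    have h1 : φ b ≤ (⌊φ a⌋ : ℝ) := (Int.floor_lt.1 hlt).le
    obtain ⟨t, ht, hte⟩ := intermediate_value_Icc' hab hφ ⟨h1, Int.floor_le _⟩
    exact h t ht _ hte

lemma floor_add_half_of_pos {x : ℝ}
    (h : 0 < Real.cos (Real.pi * x) * Real.sin (Real.pi * x)) : ⌊x + 1 / 2⌋ = ⌊x⌋ := by
  have h2 : 0 < Real.sin (2 * Real.pi * Int.fract x) := by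
    have : Real.sin (2 * Real.pi * Int.fract x) = Real.sin (2 * (Real.pi * x)) := by
      rw [Int.fract, ← Real.sin_sub_int_mul_two_pi (2 * (Real.pi * x)) ⌊x⌋]
      congr 1; ring
    rw [this, Real.sin_two_mul]; linarith
  have h3 : Int.fract x < 1 / 2 := by
    by_contra hc
    push Not at hc
    have : Real.sin (2 * Real.pi * Int.fract x) ≤ 0 := by
      rw [← Real.sin_sub_two_pi]
      apply Real.sin_nonpos_of_nonpos_of_neg_pi_le
      · nlinarith [Real.pi_pos, (Int.fract_lt_one x).le]
      · nlinarith [Real.pi_pos]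
    linarith
  rw [Int.floor_eq_iff]
  have := Int.floor_add_fract x
  have := Int.fract_nonneg x
  constructor <;> linarith

lemma floor_add_half_of_neg {x : ℝ}
    (h : Real.cos (Real.pi * x) * Real.sin (Real.pi * x) < 0) : ⌊x + 1 / 2⌋ = ⌊x⌋ + 1 := by
  have h1 : Real.pi * (x + 1 / 2) = Real.pi * x + Real.pi / 2 := by ring
  have := floor_add_half_of_pos (x := x + 1 / 2)
    (by rw [h1, Real.cos_add_pi_div_two, Real.sin_add_pi_div_two]; linarith)
  rw [← this, add_assoc]; norm_num

/-- A planar Poincaré–Miranda theorem on a rectangle. -/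
theorem exists_zero_of_rectangle {F₁ F₂ : ℝ × ℝ → ℝ} {a b c d : ℝ} (hab : a ≤ b) (hcd : c ≤ d)
    (h₁ : ContinuousOn F₁ (Icc a b ×ˢ Icc c d)) (h₂ : ContinuousOn F₂ (Icc a b ×ˢ Icc c d))
    (hl : ∀ w ∈ Icc c d, F₁ (a, w) < 0) (hr : ∀ w ∈ Icc c d, 0 < F₁ (b, w))
    (hd : ∀ s ∈ Icc a b, F₂ (s, c) < 0) (hu : ∀ s ∈ Icc a b, 0 < F₂ (s, d)) :
    ∃ p ∈ Icc a b ×ˢ Icc c d, F₁ p = 0 ∧ F₂ p = 0 := by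
  by_contra hne
  push Not at hne
  let P : ℝ × ℝ → ℝ × ℝ := fun p => (projIcc a b hab p.1, projIcc c d hcd p.2)
  have hPmem : ∀ p, P p ∈ Icc a b ×ˢ Icc c d := fun p =>
    ⟨(projIcc a b hab p.1).2, (projIcc c d hcd p.2).2⟩
  have hP : Continuous P := by fun_prop
  have hPid : ∀ p ∈ Icc a b ×ˢ Icc c d, P p = p := fun p hp => by
    simp only [P, projIcc_of_mem hab hp.1, projIcc_of_mem hcd hp.2]
  let f : C(ℝ × ℝ, ℂ) := ⟨fun p => ⟨F₁ (P p), F₂ (P p)⟩, by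
    have e : (fun p => (⟨F₁ (P p), F₂ (P p)⟩ : ℂ)) =
        fun p => (F₁ (P p) : ℂ) + (F₂ (P p) : ℂ) * Complex.I := by
      ext p; exact (Complex.re_add_im ⟨F₁ (P p), F₂ (P p)⟩).symm
    rw [e]
    have c1 : Continuous fun p => F₁ (P p) := h₁.comp_continuous hP hPmem
    have c2 : Continuous fun p => F₂ (P p) := h₂.comp_continuous hP hPmem
    exact (Complex.continuous_ofReal.comp c1).add
      ((Complex.continuous_ofReal.comp c2).mul continuous_const)⟩
  have hf : ∀ p, f p ∈ ({0}ᶜ : Set ℂ) := fun p hp => by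
    have hp' : f p = 0 := hp
    exact hne (P p) (hPmem p) (congrArg Complex.re hp') (congrArg Complex.im hp')
  obtain ⟨H, ⟨-, hH⟩, -⟩ := Complex.isCoveringMapOn_exp.existsUnique_continuousMap_lifts f
    (a₀ := (a, c)) (e₀ := Complex.log (f (a, c))) (Complex.exp_log (hf _)) hf
  let θ : ℝ × ℝ → ℝ := fun p => (H p).im / Real.pi
  have hθ : Continuous θ := by fun_prop
  have hre : ∀ p ∈ Icc a b ×ˢ Icc c d,
      F₁ p = Real.exp (H p).re * Real.cos (Real.pi * θ p) := fun p hp => by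
    have := congrArg Complex.re (congrFun hH p)
    rw [Function.comp_apply, Complex.exp_re] at this
    simp only [θ, mul_div_cancel₀ _ Real.pi_ne_zero, this]
    simp [f, hPid p hp]
  have him : ∀ p ∈ Icc a b ×ˢ Icc c d,
      F₂ p = Real.exp (H p).re * Real.sin (Real.pi * θ p) := fun p hp => by
    have := congrArg Complex.im (congrFun hH p)
    rw [Function.comp_apply, Complex.exp_im] at this
    simp only [θ, mul_div_cancel₀ _ Real.pi_ne_zero, this]
    simp [f, hPid p hp]
  have hprod : ∀ p ∈ Icc a b ×ˢ Icc c d, F₁ p * F₂ p = Real.exp (H p).re ^ 2 *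
      (Real.cos (Real.pi * θ p) * Real.sin (Real.pi * θ p)) := fun p hp => by
    rw [hre p hp, him p hp]; ring
  have hsin : ∀ p ∈ Icc a b ×ˢ Icc c d, F₂ p ≠ 0 → ∀ n : ℤ, θ p ≠ n := fun p hp h0 n hn => by
    apply h0; rw [him p hp, hn, mul_comm Real.pi, Real.sin_int_mul_pi, mul_zero]
  have hcos : ∀ p ∈ Icc a b ×ˢ Icc c d, F₁ p ≠ 0 → ∀ n : ℤ, θ p + 1 / 2 ≠ n :=
      fun p hp h0 n hn => by
    apply h0
    have : Real.pi * θ p = n * Real.pi - Real.pi / 2 := by rw [← hn]; ring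
    rw [hre p hp, this, Real.cos_sub_pi_div_two, Real.sin_int_mul_pi, mul_zero]
  have ha : a ∈ Icc a b := left_mem_Icc.2 hab
  have hb : b ∈ Icc a b := right_mem_Icc.2 hab
  have hc : c ∈ Icc c d := left_mem_Icc.2 hcd
  have hd' : d ∈ Icc c d := right_mem_Icc.2 hcd
  have R := floor_eq_of_ne_int (φ := fun w => θ (b, w) + 1 / 2) hcd (by fun_prop)
    fun w hw => hcos _ ⟨hb, hw⟩ (hr w hw).ne'
  have Lf := floor_eq_of_ne_int (φ := fun w => θ (a, w) + 1 / 2) hcd (by fun_prop)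
    fun w hw => hcos _ ⟨ha, hw⟩ (hl w hw).ne
  have U := floor_eq_of_ne_int (φ := fun s => θ (s, d)) hab (by fun_prop)
    fun s hs => hsin _ ⟨hs, hd'⟩ (hu s hs).ne'
  have B := floor_eq_of_ne_int (φ := fun s => θ (s, c)) hab (by fun_prop)
    fun s hs => hsin _ ⟨hs, hc⟩ (hd s hs).ne
  have pos : ∀ p ∈ Icc a b ×ˢ Icc c d, 0 < F₁ p * F₂ p → ⌊θ p + 1 / 2⌋ = ⌊θ p⌋ := fun p hp h => by
    rw [hprod p hp] at h
    exact floor_add_half_of_pos (pos_of_mul_pos_right h (by positivity))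
  have neg : ∀ p ∈ Icc a b ×ˢ Icc c d, F₁ p * F₂ p < 0 → ⌊θ p + 1 / 2⌋ = ⌊θ p⌋ + 1 :=
      fun p hp h => by
    rw [hprod p hp] at h
    exact floor_add_half_of_neg (neg_of_mul_neg_right h (by positivity))
  have q1 := pos (b, d) ⟨hb, hd'⟩ (mul_pos (hr d hd') (hu b hb))
  have q2 := neg (a, d) ⟨ha, hd'⟩ (mul_neg_of_neg_of_pos (hl d hd') (hu a ha))
  have q3 := pos (a, c) ⟨ha, hc⟩ (mul_pos_of_neg_of_neg (hl c hc) (hd a ha))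
  have q4 := neg (b, c) ⟨hb, hc⟩ (mul_neg_of_pos_of_neg (hr c hc) (hd b hb))
  omega

section Gluing

variable {Z : Type*} [TopologicalSpace Z]

lemma continuousOn_ite_le {A : Set Z} {M e : Z → ℝ} {h v : ℝ} (hM : Continuous M)
    (he : ContinuousOn e (A ∩ {z | M z ≤ h})) (hv : ∀ z ∈ A, M z = h → e z = v) :
    ContinuousOn (fun z => if M z ≤ h then e z else v) A := by
  refine ContinuousOn.if (fun z hz => hv z hz.1 ?_) ?_ continuousOn_const
  · exact frontier_le_subset_eq hM continuous_const hz.2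
  · rwa [(isClosed_le hM continuous_const).closure_eq]

lemma continuousOn_ite_ge {A : Set Z} {M e : Z → ℝ} {h v : ℝ} (hM : Continuous M)
    (he : ContinuousOn e (A ∩ {z | h ≤ M z})) (hv : ∀ z ∈ A, M z = h → e z = v) :
    ContinuousOn (fun z => if h ≤ M z then e z else v) A := by
  have := continuousOn_ite_le (A := A) (M := fun z => - M z) (e := e) (h := -h) (v := v) hM.neg
    (by simpa using he) (fun z hz hz' => hv z hz (neg_injective hz'))
  simpa using this

/-- The closed band of amplitudes attached to a symbol. -/
def InBand (r ρ R : ℝ) (c : Fin 3) (x : ℝ) : Prop :=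
  (c = 0 → x ≤ r) ∧ (c = 1 → r ≤ x ∧ x ≤ ρ) ∧ (c = 2 → ρ ≤ x ∧ x ≤ R)

lemma InBand.le {r ρ R : ℝ} (h1 : r ≤ ρ) (h2 : ρ ≤ R) {c : Fin 3} {x : ℝ}
    (h : InBand r ρ R c x) : x ≤ R := by
  obtain ⟨h0, h1', h2'⟩ := h
  fin_cases c
  · exact (h0 rfl).trans (h1.trans h2)
  · exact (h1' rfl).2.trans h2
  · exact (h2' rfl).2

lemma InBand.ge {r ρ R : ℝ} (h1 : r ≤ ρ) {c : Fin 3} (hc : c ≠ 0) {x : ℝ}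
    (h : InBand r ρ R c x) : r ≤ x := by
  obtain ⟨h0, h1', h2'⟩ := h
  fin_cases c
  · exact absurd rfl hc
  · exact (h1' rfl).1
  · exact h1.trans (h2' rfl).1

/-- A function of the initial datum which takes values in `(-1, 1/2)` only at data following the
prescribed itinerary, and which otherwise is constant on data failing on a given side. -/
theorem exists_itinerary_function {r ρ R : ℝ} (hr : 0 < r) (hrρ : r < ρ) (hρR : ρ < R)
    {N : ℕ} (c : ℕ → Fin 3) (hc : c N ≠ 0) (M : ℕ → Z → ℝ)
    (hM : ∀ j, Continuous (M j)) (S : Z → ℝ) (hS : Continuous S) (D : Set Z)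
    (Dn Up : ℕ → Z → Prop) (A : ℕ → Set Z)
    (hA1 : A 1 = D)
    (hA : ∀ j, 1 ≤ j → j ≤ N → A (j + 1) = A j ∩ {z | InBand r ρ R (c j) (M j z)})
    (hUr : ∀ j, 1 ≤ j → j ≤ N → ∀ z ∈ A j, M j z = r → Up (j + 1) z)
    (hUR : ∀ j, 1 ≤ j → j ≤ N → ∀ z ∈ A j, M j z = R → Up (j + 1) z)
    (hDρ : ∀ j, 1 ≤ j → j ≤ N → ∀ z ∈ A j, M j z = ρ → Dn (j + 1) z)
    (hDM : ∀ j, 1 ≤ j → j ≤ N → ∀ z ∈ A j, Dn j z → M j z ≤ 0)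
    (hDD : ∀ j, 1 ≤ j → j < N → ∀ z ∈ A j, Dn j z → Dn (j + 1) z)
    (hUM : ∀ j, 1 ≤ j → j ≤ N → ∀ z ∈ A j, Up j z → R ≤ M j z)
    (hDS : ∀ z ∈ A (N + 1), Dn (N + 1) z → S z ≤ -1)
    (hUS : ∀ z ∈ A (N + 1), Up (N + 1) z → 1 / 2 ≤ S z) :
    ∃ (e : Z → ℝ) (dn up : ℝ), (dn = -1 ∧ up = 1 / 2 ∨ dn = 1 / 2 ∧ up = -1) ∧
      ContinuousOn e D ∧ (∀ z ∈ D, Dn 1 z → e z = dn) ∧ (∀ z ∈ D, Up 1 z → e z = up) ∧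
      ∀ z ∈ D, e z ∈ Ioo (-1 : ℝ) (1 / 2) → z ∈ A (N + 1) ∧ S z = e z := by
  rw [← hA1]
  have key : ∀ d j, j + d = N + 1 → 1 ≤ j →
      ∃ (e : Z → ℝ) (dn up : ℝ), (dn = -1 ∧ up = 1 / 2 ∨ dn = 1 / 2 ∧ up = -1) ∧
      ContinuousOn e (A j) ∧ (∀ z ∈ A j, Dn j z → e z = dn) ∧ (∀ z ∈ A j, Up j z → e z = up) ∧
      ∀ z ∈ A j, e z ∈ Ioo (-1 : ℝ) (1 / 2) → z ∈ A (N + 1) ∧ S z = e z := by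
    intro d
    induction d with
    | zero =>
      intro j hj _
      obtain rfl : j = N + 1 := by omega
      refine ⟨fun z => max (-1) (min (1 / 2) (S z)), -1, 1 / 2, Or.inl ⟨rfl, rfl⟩,
        by fun_prop, fun z hz h => ?_, fun z hz h => ?_, fun z hz h => ⟨hz, ?_⟩⟩
      · have := hDS z hz h
        beta_reduce
        rw [min_eq_right (by linarith), max_eq_left this]
      · have := hUS z hz h
        beta_reduce
        rw [min_eq_left this]; norm_num
      · beta_reduce at h ⊢
        obtain ⟨ha, hb⟩ := h
        rcases lt_max_iff.1 ha with h' | h'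
        · exact absurd h' (lt_irrefl _)
        · simp only [max_eq_right h'.le] at hb ⊢
          rcases min_lt_iff.1 hb with h'' | h''
          · exact absurd h'' (lt_irrefl _)
          · exact (min_eq_right h''.le).symm
    | succ d ih =>
      intro j hj hj1
      have hjN : j ≤ N := by omega
      obtain ⟨e, dn, up, hor, hcont, hdn, hup, hst⟩ := ih (j + 1) (by omega) (by omega)
      have hdn' : dn ∉ Ioo (-1 : ℝ) (1 / 2) := by
        rcases hor with ⟨rfl, rfl⟩ | ⟨rfl, rfl⟩ <;> simp
      have hup' : up ∉ Ioo (-1 : ℝ) (1 / 2) := by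
        rcases hor with ⟨rfl, rfl⟩ | ⟨rfl, rfl⟩ <;> simp
      have hAj := hA j hj1 hjN
      have hmem : ∀ z ∈ A j, InBand r ρ R (c j) (M j z) → z ∈ A (j + 1) := fun z hz h => by
        rw [hAj]; exact ⟨hz, h⟩
      obtain hcj | hcj | hcj : c j = 0 ∨ c j = 1 ∨ c j = 2 := by
        generalize c j = x; fin_cases x <;> simp
      · have hjN' : j < N := lt_of_le_of_ne hjN (by rintro rfl; exact hc hcj)
        have hb : ∀ z ∈ A j, M j z ≤ r → z ∈ A (j + 1) := fun z hz h =>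
          hmem z hz (by simp [InBand, hcj, h])
        refine ⟨fun z => if M j z ≤ r then e z else up, dn, up, hor, ?_, ?_, ?_, ?_⟩
        · refine continuousOn_ite_le (hM j) (hcont.mono fun z hz => hb z hz.1 hz.2) ?_
          exact fun z hz h => hup z (hb z hz h.le) (hUr j hj1 hjN z hz h)
        · intro z hz h
          have hle := (hDM j hj1 hjN z hz h).trans hr.le
          beta_reduce
          rw [if_pos hle]
          exact hdn z (hb z hz hle) (hDD j hj1 hjN' z hz h)
        · intro z hz h
          have := hUM j hj1 hjN z hz h
          beta_reduce
          rw [if_neg (by linarith)]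
        · intro z hz h
          beta_reduce at h ⊢
          split_ifs at h ⊢ with hle
          · exact hst z (hb z hz hle) h
          · exact absurd h hup'
      · have hb : ∀ z ∈ A j, M j z ≤ ρ → r ≤ M j z → z ∈ A (j + 1) := fun z hz h h' =>
          hmem z hz (by simp [InBand, hcj, h, h'])
        refine ⟨fun z => if M j z ≤ ρ then (if r ≤ M j z then e z else up) else dn, up, dn,
          hor.symm.imp And.symm And.symm, ?_, ?_, ?_, ?_⟩
        · refine continuousOn_ite_le (hM j) (continuousOn_ite_ge (hM j)
            (hcont.mono fun z hz => hb z hz.1.1 hz.1.2 hz.2) ?_) ?_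
          · exact fun z hz h => hup z (hb z hz.1 hz.2 h.ge) (hUr j hj1 hjN z hz.1 h)
          · intro z hz h
            rw [if_pos (by linarith)]
            exact hdn z (hb z hz h.le (by linarith)) (hDρ j hj1 hjN z hz h)
        · intro z hz h
          have hle := hDM j hj1 hjN z hz h
          beta_reduce
          rw [if_pos (by linarith), if_neg (by linarith)]
        · intro z hz h
          have := hUM j hj1 hjN z hz h
          beta_reduce
          rw [if_neg (by linarith)]
        · intro z hz h
          beta_reduce at h ⊢
          split_ifs at h ⊢ with hle hle'
          · exact hst z (hb z hz hle hle') h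
          · exact absurd h hup'
          · exact absurd h hdn'
      · have hb : ∀ z ∈ A j, M j z ≤ R → ρ ≤ M j z → z ∈ A (j + 1) := fun z hz h h' =>
          hmem z hz (by simp [InBand, hcj, h, h'])
        refine ⟨fun z => if M j z ≤ R then (if ρ ≤ M j z then e z else dn) else up, dn, up,
          hor, ?_, ?_, ?_, ?_⟩
        · refine continuousOn_ite_le (hM j) (continuousOn_ite_ge (hM j)
            (hcont.mono fun z hz => hb z hz.1.1 hz.1.2 hz.2) ?_) ?_
          · exact fun z hz h => hdn z (hb z hz.1 hz.2 h.ge) (hDρ j hj1 hjN z hz.1 h)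
          · intro z hz h
            rw [if_pos (by linarith)]
            exact hup z (hb z hz h.le (by linarith)) (hUR j hj1 hjN z hz h)
        · intro z hz h
          have hle := hDM j hj1 hjN z hz h
          beta_reduce
          rw [if_pos (by linarith), if_neg (by linarith)]
        · intro z hz h
          have hge := hUM j hj1 hjN z hz h
          rcases hge.eq_or_lt with heq | hlt
          · beta_reduce
            rw [if_pos heq.ge, if_pos (by linarith)]
            exact hup z (hb z hz heq.ge (by linarith)) (hUR j hj1 hjN z hz heq.symm)
          · beta_reduce
            rw [if_neg (by linarith)]
        · intro z hz h
          beta_reduce at h ⊢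
          split_ifs at h ⊢ with hle hle'
          · exact hst z (hb z hz hle hle') h
          · exact absurd h hdn'
          · exact absurd h hup'
  exact key N 1 (by omega) le_rfl

end Gluing

section Trajectories

/-- `u` has derivative `y`, and `y` is a primitive of `-q f`. -/
structure Traj (q f u y : ℝ → ℝ) : Prop where
  deriv : ∀ t, HasDerivAt u (y t) t
  integrable : ∀ s t, IntervalIntegrable (fun x => q x * f x) volume s t
  eq : ∀ s t, y t = y s - ∫ x in s..t, q x * f x

/-- On `[b, b')` the function `f` is `g ∘ u` evaluated with a delay at most `h`, never looking
further back than `b`. -/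
def Delay (g u f : ℝ → ℝ) (h b b' : ℝ) : Prop :=
  ∀ s ∈ Ico b b', ∃ s' ∈ Icc b s, s - h ≤ s' ∧ f s = g (u s')

lemma le_add_of_deriv_le {u y : ℝ → ℝ} (hu : ∀ t, HasDerivAt u (y t) t) {a b C : ℝ} (hab : a ≤ b)
    (hy : ∀ t ∈ Icc a b, y t ≤ C) : u b ≤ u a + C * (b - a) := by
  have := Convex.image_sub_le_mul_sub_of_deriv_le (convex_Icc a b)
    (f := u) (fun t _ => (hu t).continuousAt.continuousWithinAt)
    (fun t _ => (hu t).differentiableAt.differentiableWithinAt) (C := C)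
    (fun t ht => by rw [(hu t).deriv]; exact hy t (interior_subset ht))
    a (left_mem_Icc.2 hab) b (right_mem_Icc.2 hab) hab
  linarith

lemma add_le_of_le_deriv {u y : ℝ → ℝ} (hu : ∀ t, HasDerivAt u (y t) t) {a b C : ℝ} (hab : a ≤ b)
    (hy : ∀ t ∈ Icc a b, C ≤ y t) : u a + C * (b - a) ≤ u b := by
  have := le_add_of_deriv_le (u := fun t => - u t) (y := fun t => - y t) (fun t => (hu t).neg) hab
    (C := -C) (fun t ht => neg_le_neg (hy t ht))
  linarith

/-- At a point where `u` attains its maximum over points to the left, the derivative is `≥ 0`. -/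
lemma deriv_nonneg_of_left_max {u : ℝ → ℝ} {y' a b : ℝ} (hu : HasDerivAt u y' b) (hab : a < b)
    (hmax : ∀ t ∈ Icc a b, u t ≤ u b) : 0 ≤ y' := by
  by_contra! hneg
  have h1 := (hasDerivAt_iff_tendsto_slope.1 hu).eventually (gt_mem_nhds hneg)
  have h2 : ∀ᶠ t in 𝓝[<] b, slope u b t < 0 :=
    h1.filter_mono (nhdsWithin_mono _ fun x (hx : x < b) => hx.ne)
  have h3 : ∀ᶠ t in 𝓝[<] b, t ∈ Ioo a b := Ioo_mem_nhdsLT hab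
  obtain ⟨t, ht, ht'⟩ := (h2.and h3).exists
  rw [slope_def_field, div_neg_iff] at ht
  have := hmax t ⟨ht'.1.le, ht'.2.le⟩
  rcases ht with h | h
  · linarith [h.1]
  · linarith [h.2, ht'.2]

namespace Traj

variable {q f u y : ℝ → ℝ} (h : Traj q f u y)
include h

lemma continuous : Continuous u := continuous_iff_continuousAt.2 fun t => (h.deriv t).continuousAt

lemma continuous_y : Continuous y := by
  have : y = fun t => y 0 - ∫ x in (0 : ℝ)..t, q x * f x := funext fun t => h.eq 0 t
  rw [this]
  exact continuous_const.sub (intervalIntegral.continuous_primitive h.integrable 0)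

lemma neg : Traj (fun t => - q t) f (fun t => - u t) (fun t => - y t) where
  deriv t := (h.deriv t).neg
  integrable s t := by
    have := (h.integrable s t).neg
    refine this.congr fun x _ => ?_
    simp
  eq s t := by
    rw [h.eq s t]
    simp only [neg_mul, intervalIntegral.integral_neg]
    ring

lemma antitoneOn {a b : ℝ} (hq : ∀ᵐ t, t ∈ Icc a b → 0 ≤ q t) (hf : ∀ t, 0 ≤ f t) :
    AntitoneOn y (Icc a b) := by
  intro s hs t ht hst
  rw [h.eq s t]
  have : 0 ≤ ∫ x in s..t, q x * f x :=
    intervalIntegral.integral_nonneg_of_ae_restrict hst <| by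
      refine (ae_restrict_iff' measurableSet_Icc).2 ?_
      filter_upwards [hq] with x hx hx'
      exact mul_nonneg (hx ⟨hs.1.trans hx'.1, hx'.2.trans ht.2⟩) (hf x)
  linarith

lemma monotoneOn {a b : ℝ} (hq : ∀ᵐ t, t ∈ Icc a b → q t ≤ 0) (hf : ∀ t, 0 ≤ f t) :
    MonotoneOn y (Icc a b) := by
  have := h.neg.antitoneOn (a := a) (b := b) (by simpa using hq) hf
  intro s hs t ht hst
  have := this hs ht hst
  simpa using this

/-- Upper bound for the drop of `y` where `q ≥ 0`. -/
lemma drop_le {a b K : ℝ} (hab : a ≤ b) (hqi : IntervalIntegrable q volume a b)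
    (hq : ∀ᵐ t, t ∈ Icc a b → 0 ≤ q t) (hf : ∀ t ∈ Ico a b, f t ≤ K) :
    y a - y b ≤ K * ∫ x in a..b, q x := by
  rw [h.eq a b, sub_sub_cancel, ← intervalIntegral.integral_const_mul]
  refine intervalIntegral.integral_mono_ae_restrict hab (h.integrable a b) (hqi.const_mul K) ?_
  refine (ae_restrict_iff' measurableSet_Icc).2 ?_
  have : ∀ᵐ t : ℝ, t ≠ b := by simp [ae_iff, measure_singleton]
  filter_upwards [hq, this] with x hx hxb hxI
  have := hf x ⟨hxI.1, lt_of_le_of_ne hxI.2 hxb⟩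
  nlinarith [hx hxI]

/-- Lower bound for the drop of `y` where `q ≥ 0`. -/
lemma le_drop {a b K : ℝ} (hab : a ≤ b) (hqi : IntervalIntegrable q volume a b)
    (hq : ∀ᵐ t, t ∈ Icc a b → 0 ≤ q t) (hf : ∀ t ∈ Ico a b, K ≤ f t) :
    K * ∫ x in a..b, q x ≤ y a - y b := by
  rw [h.eq a b, sub_sub_cancel, ← intervalIntegral.integral_const_mul]
  refine intervalIntegral.integral_mono_ae_restrict hab (hqi.const_mul K) (h.integrable a b) ?_
  refine (ae_restrict_iff' measurableSet_Icc).2 ?_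
  have : ∀ᵐ t : ℝ, t ≠ b := by simp [ae_iff, measure_singleton]
  filter_upwards [hq, this] with x hx hxb hxI
  have := hf x ⟨hxI.1, lt_of_le_of_ne hxI.2 hxb⟩
  nlinarith [hx hxI]

/-- Lower bound for the growth of `y` where `q ≤ 0`. -/
lemma le_growth {a b K : ℝ} (hab : a ≤ b) (hqi : IntervalIntegrable q volume a b)
    (hq : ∀ᵐ t, t ∈ Icc a b → q t ≤ 0) (hf : ∀ t ∈ Ico a b, K ≤ f t) :
    K * ∫ x in a..b, - q x ≤ y b - y a := by
  have := h.neg.le_drop hab hqi.neg (by simpa using hq) hf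
  linarith

lemma concaveOn {a b : ℝ} (hq : ∀ᵐ t, t ∈ Icc a b → 0 ≤ q t) (hf : ∀ t, 0 ≤ f t) :
    ConcaveOn ℝ (Icc a b) u := by
  have hd : _root_.deriv u = y := funext fun t => (h.deriv t).deriv
  refine AntitoneOn.concaveOn_of_deriv (convex_Icc a b) h.continuous.continuousOn
    (fun t _ => (h.deriv t).differentiableAt.differentiableWithinAt) ?_
  rw [hd]
  exact (h.antitoneOn hq hf).mono interior_subset

lemma convexOn {a b : ℝ} (hq : ∀ᵐ t, t ∈ Icc a b → q t ≤ 0) (hf : ∀ t, 0 ≤ f t) :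
    ConvexOn ℝ (Icc a b) u := by
  have hd : _root_.deriv u = y := funext fun t => (h.deriv t).deriv
  refine MonotoneOn.convexOn_of_deriv (convex_Icc a b) h.continuous.continuousOn
    (fun t _ => (h.deriv t).differentiableAt.differentiableWithinAt) ?_
  rw [hd]
  exact (h.monotoneOn hq hf).mono interior_subset

end Traj
end Trajectories

section Blocks

/-- The equation `u'' + q(t) g(u) = 0` together with the positivity intervals `[σ n, τ n]` and
negativity intervals `[τ (n - 1), σ n]` of `q` and the quantitative assumptions on `q` and `g`. -/
structure Setup where
  g : ℝ → ℝ
  q : ℝ → ℝ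
  σ : ℤ → ℝ
  τ : ℤ → ℝ
  m : ℕ
  T : ℝ
  d : ℝ
  r : ℝ
  ρ : ℝ
  R : ℝ
  C : ℝ
  η : ℝ
  γ₀ : ℝ
  γ : ℝ
  g_cont : Continuous g
  g_nonneg : ∀ s, 0 ≤ g s
  g_neg : ∀ s ≤ 0, g s = 0
  g_le : ∀ s, 0 ≤ s → g s ≤ C * s
  q_int : ∀ s t, IntervalIntegrable q volume s t
  q_per : ∀ t, q (t + T) = q t
  m_pos : 0 < m
  T_pos : 0 < T
  d_pos : 0 < d
  r_pos : 0 < r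
  r_lt : r < ρ
  ρ_lt : ρ < R
  η_nonneg : 0 ≤ η
  σ_per : ∀ n, σ (n + m) = σ n + T
  τ_per : ∀ n, τ (n + m) = τ n + T
  σ_lt : ∀ n, σ n < τ n
  τ_lt : ∀ n, τ (n - 1) < σ n
  len_pos : ∀ n, τ n - σ n ≤ T
  len_neg : ∀ n, σ n - τ (n - 1) ≤ T
  d_le : ∀ n, d ≤ τ n - σ n
  q_nonneg : ∀ n, ∀ᵐ t, t ∈ Icc (σ n) (τ n) → 0 ≤ q t
  q_nonpos : ∀ n, ∀ᵐ t, t ∈ Icc (τ (n - 1)) (σ n) → q t ≤ 0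
  small_r : ∀ s ≤ r, g s ≤ η * r
  small_R : ∀ s ≤ R, g s ≤ η * R
  η_le : ∀ n, η * (∫ t in (σ n)..(τ n), q t) ≤ 1 / (8 * T)
  γ₀_le : ∀ s ∈ Icc (ρ * (d / 2) / T) ρ, γ₀ ≤ g s
  core : ∀ n, ∃ α β, σ n + d ≤ α ∧ α ≤ β ∧ β ≤ τ n - d ∧ 2 * ρ / d < γ₀ * ∫ t in α..β, q t
  γ_le : ∀ s ∈ Icc (r / 4) (R + T * (R / d + R / (8 * T)) + 1 + ((R + 1) / d + R / (8 * T)) * T),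
    γ ≤ g s
  γ_big : ∀ n, (R + 1) / d + R / (8 * T) + (R + T * (R / d + R / (8 * T)) + 1) / T
    ≤ γ * ∫ t in (τ (n - 1))..(σ n), - q t

namespace Setup

variable (E : Setup)

/-- Bound for `|u'|` at the end of a positivity interval on which `0 ≤ u ≤ R`. -/
noncomputable def Y₀ : ℝ := E.R / E.d + E.R / (8 * E.T)

/-- Bound for the initial position. -/
noncomputable def X : ℝ := E.R + E.T * E.Y₀ + 1

/-- Bound for the initial velocity. -/
noncomputable def Y : ℝ := E.X / E.T

/-- Velocity forcing the next maximum above `R`. -/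
noncomputable def D : ℝ := (E.R + 1) / E.d + E.R / (8 * E.T)

lemma ρ_pos : 0 < E.ρ := E.r_pos.trans E.r_lt
lemma R_pos : 0 < E.R := E.ρ_pos.trans E.ρ_lt

lemma Y₀_pos : 0 < E.Y₀ := by
  have := E.T_pos; have := E.d_pos; have := E.R_pos
  unfold Y₀; positivity

lemma R_lt_X : E.R + 1 < E.X := by
  have := mul_pos E.T_pos E.Y₀_pos
  unfold X; linarith

lemma X_pos : 0 < E.X := by linarith [E.R_lt_X, E.R_pos]

lemma D_pos : 0 < E.D := by
  have := E.T_pos; have := E.d_pos; have := E.R_pos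
  unfold D; positivity

lemma Y_mul : E.Y * E.T = E.X := div_mul_cancel₀ _ E.T_pos.ne'

lemma Y₀_le_Y : E.Y₀ ≤ E.Y := by
  rw [Y, le_div_iff₀ E.T_pos]
  have := E.R_pos
  unfold X; nlinarith

lemma div_le_Y {c : ℝ} (hc : c ≤ E.R) (hc' : 0 ≤ c) : c / (8 * E.T) ≤ E.Y := by
  have h1 := E.R_lt_X
  have h2 := E.T_pos
  rw [Y, div_le_div_iff₀ (by positivity) (by positivity)]
  nlinarith

/-- `u` is an (approximate) solution with delay at most `h` on the blocks indexed by `P`. -/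
structure Orbit (h : ℝ) (P : Set ℤ) (f u y : ℝ → ℝ) : Prop where
  traj : Traj E.q f u y
  f_nonneg : ∀ t, 0 ≤ f t
  h_le : h ≤ E.d / 2
  delay_pos : ∀ n ∈ P, Delay E.g u f h (E.σ n) (E.τ n)
  delay_neg : ∀ n ∈ P, Delay E.g u f h (E.τ (n - 1)) (E.σ n)

namespace Orbit

variable {E} {h : ℝ} {P : Set ℤ} {f u y : ℝ → ℝ} (O : E.Orbit h P f u y) {n : ℤ} (hn : n ∈ P)
include O

lemma anti (n : ℤ) : AntitoneOn y (Icc (E.σ n) (E.τ n)) :=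
  O.traj.antitoneOn (E.q_nonneg n) O.f_nonneg

lemma mono (n : ℤ) : MonotoneOn y (Icc (E.τ (n - 1)) (E.σ n)) :=
  O.traj.monotoneOn (E.q_nonpos n) O.f_nonneg

include hn

/-- A trajectory staying away from zero on a negativity interval leaves it with large velocity. -/
lemma velocity_large (hu : ∀ t ∈ Icc (E.τ (n - 1)) (E.σ n), E.r / 4 ≤ u t)
    (hy : -E.Y ≤ y (E.τ (n - 1))) (hX : u (E.τ (n - 1)) ≤ E.X) : E.D ≤ y (E.σ n) := by
  by_contra! hlt
  have hle := (E.τ_lt n).le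
  have hup : ∀ t ∈ Icc (E.τ (n - 1)) (E.σ n), u t ≤ E.X + E.D * E.T := by
    intro t ht
    have h1 := le_add_of_deriv_le O.traj.deriv (C := E.D) ht.1 fun s hs =>
      (O.mono n ⟨hs.1, hs.2.trans ht.2⟩ (right_mem_Icc.2 hle) (hs.2.trans ht.2)).trans hlt.le
    have h2 : E.D * (t - E.τ (n - 1)) ≤ E.D * E.T :=
      mul_le_mul_of_nonneg_left (by linarith [E.len_neg n, ht.2]) E.D_pos.le
    linarith
  have := O.traj.le_growth hle (E.q_int _ _) (E.q_nonpos n) (K := E.γ) fun t ht => by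
    obtain ⟨s, hs, -, hfs⟩ := O.delay_neg n hn t ht
    rw [hfs]
    have hs' : s ∈ Icc (E.τ (n - 1)) (E.σ n) := ⟨hs.1, hs.2.trans ht.2.le⟩
    exact E.γ_le _ ⟨hu s hs', hup s hs'⟩
  have h3 := E.γ_big n
  have h4 : E.D + E.Y ≤ E.γ * ∫ t in (E.τ (n - 1))..(E.σ n), - E.q t := h3
  linarith

lemma drop_le_of_le {c : ℝ} (hc : c = E.r ∨ c = E.R) (hu : ∀ t ∈ Icc (E.σ n) (E.τ n), u t ≤ c)
    {s t : ℝ} (hs : E.σ n ≤ s) (hst : s ≤ t) (ht : t ≤ E.τ n) : y s - y t ≤ c / (8 * E.T) := by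
  have h1 := O.traj.drop_le (E.σ_lt n).le (E.q_int _ _) (E.q_nonneg n) (K := E.η * c) fun x hx => by
    obtain ⟨s, hs, -, hfs⟩ := O.delay_pos n hn x hx
    rw [hfs]
    have := hu s ⟨hs.1, hs.2.trans hx.2.le⟩
    rcases hc with rfl | rfl
    · exact E.small_r _ this
    · exact E.small_R _ this
  have hcpos : 0 < c := by
    rcases hc with rfl | rfl
    · exact E.r_pos
    · exact E.R_pos
  have h2 := mul_le_mul_of_nonneg_left (E.η_le n) hcpos.le
  have h3 := O.anti n (left_mem_Icc.2 (E.σ_lt n).le) ⟨hs, hst.trans ht⟩ hs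
  have h4 := O.anti n ⟨hs.trans hst, ht⟩ (right_mem_Icc.2 (E.σ_lt n).le) ht
  have h5 : c * (1 / (8 * E.T)) = c / (8 * E.T) := by ring
  nlinarith

/-- Entering a positivity interval with large velocity forces a maximum above `R`. -/
lemma exists_gt_of_velocity (h0 : 0 ≤ u (E.σ n)) (hy : E.D ≤ y (E.σ n)) :
    ∃ t ∈ Icc (E.σ n) (E.τ n), E.R < u t := by
  by_contra! hle
  have hlt := (E.σ_lt n).le
  have h1 := add_le_of_le_deriv O.traj.deriv (C := (E.R + 1) / E.d) hlt fun t ht => by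
    have := O.drop_le_of_le hn (Or.inr rfl) hle le_rfl ht.1 ht.2
    unfold D at hy
    linarith
  have h2 : E.R + 1 ≤ (E.R + 1) / E.d * (E.τ n - E.σ n) := by
    rw [div_mul_eq_mul_div, le_div_iff₀ E.d_pos]
    exact mul_le_mul_of_nonneg_left (E.d_le n) (by linarith [E.R_pos])
  have := hle _ (right_mem_Icc.2 hlt)
  linarith

/-- State at the end of a positivity interval on which the maximum equals `r` or `R`. -/
lemma level {c : ℝ} (hc : c = E.r ∨ c = E.R)
    (hy : -E.Y ≤ y (E.τ (n - 1))) (hX : u (E.τ (n - 1)) ≤ E.X)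
    (hle : ∀ t ∈ Icc (E.σ n) (E.τ n), u t ≤ c) {t₁ : ℝ} (ht₁ : t₁ ∈ Icc (E.σ n) (E.τ n))
    (hut₁ : u t₁ = c) :
    7 * c / 8 ≤ u (E.τ n) ∧ -(c / (8 * E.T)) ≤ y (E.τ n) := by
  have hcr : E.r ≤ c := by
    rcases hc with rfl | rfl
    · exact le_rfl
    · linarith [E.r_lt, E.ρ_lt]
  have hrpos := E.r_pos
  have hT := E.T_pos
  have hyt : 0 ≤ y t₁ := by
    rcases ht₁.1.eq_or_lt with heq | hlt
    · by_contra! hneg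
      rw [← heq] at hneg hut₁
      have hD : E.D ≤ y (E.σ n) := by
        refine O.velocity_large hn (fun t ht => ?_) hy hX
        have := le_add_of_deriv_le O.traj.deriv (C := 0) ht.2 fun s hs =>
          (O.mono n ⟨ht.1.trans hs.1, hs.2⟩ (right_mem_Icc.2 (E.τ_lt n).le) hs.2).trans hneg.le
        linarith
      linarith [E.D_pos]
    · exact deriv_nonneg_of_left_max (O.traj.deriv t₁) hlt fun t ht =>
        hut₁ ▸ hle t ⟨ht.1, ht.2.trans ht₁.2⟩
  have hlow : ∀ t ∈ Icc t₁ (E.τ n), -(c / (8 * E.T)) ≤ y t := fun t ht => by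
    have := O.drop_le_of_le hn hc hle ht₁.1 ht.1 ht.2
    linarith
  refine ⟨?_, hlow _ (right_mem_Icc.2 ht₁.2)⟩
  have h1 := add_le_of_le_deriv O.traj.deriv ht₁.2 hlow
  have h2 : c / (8 * E.T) * (E.τ n - t₁) ≤ c / (8 * E.T) * E.T :=
    mul_le_mul_of_nonneg_left (by linarith [E.len_pos n, ht₁.1])
      (div_nonneg (by linarith) (by positivity))
  have h3 : c / (8 * E.T) * E.T = c / 8 := by field_simp
  linarith

/-- A maximum exactly at the level `ρ` is impossible for a nonnegative trajectory. -/
lemma not_max_rho (h0 : ∀ t ∈ Icc (E.σ n) (E.τ n), 0 ≤ u t)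
    (hle : ∀ t ∈ Icc (E.σ n) (E.τ n), u t ≤ E.ρ) {t₁ : ℝ} (ht₁ : t₁ ∈ Icc (E.σ n) (E.τ n))
    (hut₁ : u t₁ = E.ρ) : False := by
  obtain ⟨α, β, hα, hαβ, hβ, hcore⟩ := E.core n
  have hd := E.d_pos
  have hρ := E.ρ_pos
  have hT := E.T_pos
  have hlow : ∀ t ∈ Icc (E.σ n + E.d / 2) (E.τ n - E.d / 2), E.ρ * (E.d / 2) / E.T ≤ u t := by
    intro t ht
    have hconc := O.traj.concaveOn (E.q_nonneg n) O.f_nonneg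
    have hlen := E.len_pos n
    rcases le_total t t₁ with htt | htt
    · have hpos : 0 < t₁ - E.σ n := by linarith [ht.1]
      have ha : 0 ≤ (t₁ - t) / (t₁ - E.σ n) := div_nonneg (by linarith) hpos.le
      have hb : 0 ≤ (t - E.σ n) / (t₁ - E.σ n) := div_nonneg (by linarith [ht.1]) hpos.le
      have := hconc.2 (left_mem_Icc.2 (E.σ_lt n).le) ht₁ ha hb (by field_simp; ring)
      have heq : ((t₁ - t) / (t₁ - E.σ n)) • E.σ n + ((t - E.σ n) / (t₁ - E.σ n)) • t₁ = t := by
        simp only [smul_eq_mul]; field_simp; ring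
      rw [heq, hut₁] at this
      simp only [smul_eq_mul] at this
      have h1 : 0 ≤ (t₁ - t) / (t₁ - E.σ n) * u (E.σ n) :=
        mul_nonneg (div_nonneg (by linarith) hpos.le) (h0 _ (left_mem_Icc.2 (E.σ_lt n).le))
      have h2 : E.ρ * (E.d / 2) / E.T ≤ (t - E.σ n) / (t₁ - E.σ n) * E.ρ := by
        rw [div_mul_eq_mul_div, mul_comm (t - E.σ n)]
        refine div_le_div₀ (mul_nonneg hρ.le (by linarith [ht.1]))
          (mul_le_mul_of_nonneg_left (by linarith [ht.1]) hρ.le) hpos (by linarith [ht₁.2])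
      linarith
    · have hpos : 0 < E.τ n - t₁ := by linarith [ht.2]
      have ha : 0 ≤ (E.τ n - t) / (E.τ n - t₁) := div_nonneg (by linarith [ht.2]) hpos.le
      have hb : 0 ≤ (t - t₁) / (E.τ n - t₁) := div_nonneg (by linarith) hpos.le
      have := hconc.2 ht₁ (right_mem_Icc.2 (E.σ_lt n).le) ha hb (by field_simp; ring)
      have heq : ((E.τ n - t) / (E.τ n - t₁)) • t₁ + ((t - t₁) / (E.τ n - t₁)) • E.τ n = t := by
        simp only [smul_eq_mul]; field_simp; ring
      rw [heq, hut₁] at this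
      simp only [smul_eq_mul] at this
      have h1 : 0 ≤ (t - t₁) / (E.τ n - t₁) * u (E.τ n) :=
        mul_nonneg (div_nonneg (by linarith) hpos.le) (h0 _ (right_mem_Icc.2 (E.σ_lt n).le))
      have h2 : E.ρ * (E.d / 2) / E.T ≤ (E.τ n - t) / (E.τ n - t₁) * E.ρ := by
        rw [div_mul_eq_mul_div, mul_comm (E.τ n - t)]
        refine div_le_div₀ (mul_nonneg hρ.le (by linarith [ht.2]))
          (mul_le_mul_of_nonneg_left (by linarith [ht.2]) hρ.le) hpos (by linarith [ht₁.1])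
      linarith
  have hαmem : α ∈ Icc (E.σ n) (E.τ n) := ⟨by linarith, by linarith⟩
  have hβmem : β ∈ Icc (E.σ n) (E.τ n) := ⟨by linarith, by linarith⟩
  have h1 := O.traj.le_drop hαβ (E.q_int _ _)
    ((E.q_nonneg n).mono fun t ht ht' => ht ⟨hαmem.1.trans ht'.1, ht'.2.trans hβmem.2⟩)
    (K := E.γ₀) fun t ht => by
      obtain ⟨s, hs, hs', hfs⟩ := O.delay_pos n hn t ⟨hαmem.1.trans ht.1, ht.2.trans_le hβmem.2⟩
      rw [hfs]
      have hh := O.h_le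
      refine E.γ₀_le _ ⟨hlow s ⟨by linarith [ht.1], by linarith [ht.2, hs.2]⟩, hle s ⟨hs.1, ?_⟩⟩
      linarith [ht.2, hs.2, hβmem.2]
  have h2 : y α ≤ E.ρ / E.d := by
    by_contra! hgt
    have h3 := add_le_of_le_deriv O.traj.deriv (C := y α) hαmem.1 fun s hs =>
      O.anti n ⟨hs.1, hs.2.trans hαmem.2⟩ hαmem hs.2
    have h4 := h0 _ (left_mem_Icc.2 (E.σ_lt n).le)
    have h5 := hle _ hαmem
    rw [div_lt_iff₀ hd] at hgt
    have h6 : 0 < y α := by by_contra! hh; nlinarith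
    nlinarith
  have h3 : -(E.ρ / E.d) ≤ y β := by
    by_contra! hgt
    have h3 := le_add_of_deriv_le O.traj.deriv (C := y β) hβmem.2 fun s hs =>
      O.anti n hβmem ⟨hβmem.1.trans hs.1, hs.2⟩ hs.1
    have h4 := h0 _ (right_mem_Icc.2 (E.σ_lt n).le)
    have h5 := hle _ hβmem
    have hgt' : E.ρ / E.d < - y β := by linarith
    rw [div_lt_iff₀ hd] at hgt'
    have h6 : 0 < - y β := by by_contra! hh; nlinarith
    nlinarith
  have h4 : 2 * E.ρ / E.d = E.ρ / E.d + E.ρ / E.d := by ring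
  linarith

/-- Lower velocity bound at the end of a positivity interval on which `u ≤ R`. -/
lemma velocity_ge (hτ : 0 ≤ u (E.τ n)) (hle : ∀ t ∈ Icc (E.σ n) (E.τ n), u t ≤ E.R) :
    -E.Y₀ ≤ y (E.τ n) := by
  by_contra! hlt
  have hσ := (E.σ_lt n).le
  have h1 := le_add_of_deriv_le O.traj.deriv (C := y (E.τ n) + E.R / (8 * E.T)) hσ fun t ht => by
    have := O.drop_le_of_le hn (Or.inr rfl) hle ht.1 ht.2 le_rfl
    linarith
  have h2 : y (E.τ n) + E.R / (8 * E.T) < -(E.R / E.d) := by unfold Y₀ at hlt; linarith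
  have h3 := hle _ (left_mem_Icc.2 hσ)
  have h4 := E.d_le n
  have h5 := E.d_pos
  have h6 : E.R / E.d * E.d = E.R := div_mul_cancel₀ _ h5.ne'
  have h7 : 0 < E.R / E.d := div_pos E.R_pos h5
  nlinarith

end Orbit

/-- After a maximum exactly equal to `r` or `R`, the next maximum exceeds `R`. -/
lemma Orbit.exists_gt_next {h : ℝ} {P : Set ℤ} {f u y : ℝ → ℝ} {E : Setup} (O : E.Orbit h P f u y)
    {n : ℤ} (hn : n ∈ P) {c : ℝ} (hc : c = E.r ∨ c = E.R)
    (h0 : 7 * c / 8 ≤ u (E.τ (n - 1))) (hy : -(c / (8 * E.T)) ≤ y (E.τ (n - 1)))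
    (hle : u (E.τ (n - 1)) ≤ c) :
    ∃ t ∈ Icc (E.σ n) (E.τ n), E.R < u t := by
  have hT := E.T_pos
  have hcr : E.r ≤ c ∧ c ≤ E.R := by
    rcases hc with rfl | rfl
    · exact ⟨le_rfl, by linarith [E.r_lt, E.ρ_lt]⟩
    · exact ⟨by linarith [E.r_lt, E.ρ_lt], le_rfl⟩
  have hr := E.r_pos
  have hlow : ∀ t ∈ Icc (E.τ (n - 1)) (E.σ n), E.r / 4 ≤ u t := by
    intro t ht
    have h1 := add_le_of_le_deriv O.traj.deriv (C := -(c / (8 * E.T))) ht.1 fun s hs =>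
      hy.trans (O.mono n (left_mem_Icc.2 (E.τ_lt n).le) ⟨hs.1, hs.2.trans ht.2⟩ hs.1)
    have h2 : c / (8 * E.T) * (t - E.τ (n - 1)) ≤ c / (8 * E.T) * E.T :=
      mul_le_mul_of_nonneg_left (by linarith [E.len_neg n, ht.2])
        (div_nonneg (by linarith) (by positivity))
    have h3 : c / (8 * E.T) * E.T = c / 8 := by field_simp
    linarith
  refine O.exists_gt_of_velocity hn ?_ (O.velocity_large hn hlow ?_ ?_)
  · linarith [hlow _ (right_mem_Icc.2 (E.τ_lt n).le)]
  · linarith [E.div_le_Y hcr.2 (by linarith)]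
  · linarith [E.R_lt_X]

end Setup
end Blocks

section Discretisation

/-- The forward Euler-type scheme for `u'' + q g(u) = 0`, with `g(u)` frozen at grid points. -/
theorem exists_scheme {g q : ℝ → ℝ} (hg : Continuous g) (hg0 : ∀ s, 0 ≤ g s)
    (hq : ∀ s t, IntervalIntegrable q volume s t) {t : ℕ → ℝ} (ht : Monotone t) (K : ℕ) :
    ∃ f u y : ℝ × ℝ → ℝ → ℝ, (∀ z, Traj q (f z) (u z) (y z)) ∧
      (∀ z, u z (t 0) = z.1 ∧ y z (t 0) = z.2) ∧
      Continuous (fun p : (ℝ × ℝ) × ℝ => u p.1 p.2) ∧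
      Continuous (fun p : (ℝ × ℝ) × ℝ => y p.1 p.2) ∧
      (∀ z s, 0 ≤ f z s) ∧
      (∀ z, ∀ k < K, ∀ s ∈ Ico (t k) (t (k + 1)), f z s = g (u z (t k))) ∧
      (∀ z s, s ∉ Ico (t 0) (t K) → f z s = 0) := by
  induction K with
  | zero =>
    refine ⟨fun _ _ => 0, fun z s => z.1 + z.2 * (s - t 0), fun z _ => z.2, fun z => ⟨fun s => ?_,
      fun s s' => by simp, fun s s' => by simp⟩, fun z => by simp, by fun_prop, by fun_prop,
      fun _ _ => le_rfl, fun z k hk => absurd hk (Nat.not_lt_zero k), fun _ _ _ => rfl⟩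
    simpa using (((hasDerivAt_id s).sub_const (t 0)).const_mul z.2).const_add z.1
  | succ K ih =>
    obtain ⟨f, u, y, htr, hini, hcu, hcy, hf0, hfk, hfs⟩ := ih
    set I : Set ℝ := Ico (t K) (t (K + 1)) with hI
    set Φ : ℝ → ℝ := fun s => ∫ x in (t 0)..s, I.indicator q x with hΦ
    have hqI : ∀ s s', IntervalIntegrable (I.indicator q) volume s s' := fun s s' =>
      ⟨(hq s s').1.indicator measurableSet_Ico, (hq s s').2.indicator measurableSet_Ico⟩
    have hΦc : Continuous Φ := intervalIntegral.continuous_primitive hqI (t 0)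
    set Ψ : ℝ → ℝ := fun s => ∫ x in (t 0)..s, Φ x with hΨ
    have hΨd : ∀ s, HasDerivAt Ψ (Φ s) s := fun s =>
      intervalIntegral.integral_hasDerivAt_right (hΦc.intervalIntegrable _ _)
        hΦc.stronglyMeasurable.stronglyMeasurableAtFilter hΦc.continuousAt
    have hΨc : Continuous Ψ := continuous_iff_continuousAt.2 fun s => (hΨd s).continuousAt
    have hΦ0 : ∀ s ∈ Icc (t 0) (t K), Φ s = 0 := fun s hs => by
      refine intervalIntegral.integral_zero_ae ?_
      have : ∀ᵐ x : ℝ, x ≠ t K := by simp [ae_iff, measure_singleton]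
      filter_upwards [this] with x hx hx'
      rw [uIoc_of_le hs.1] at hx'
      exact indicator_of_notMem (fun h => hx (le_antisymm (hx'.2.trans hs.2) h.1)) q
    have hΨ0 : ∀ s ∈ Icc (t 0) (t K), Ψ s = 0 := fun s hs => by
      refine intervalIntegral.integral_zero_ae (ae_of_all _ fun x hx => ?_)
      rw [uIoc_of_le hs.1] at hx
      exact hΦ0 x ⟨hx.1.le, hx.2.trans hs.2⟩
    have h0K : t 0 ≤ t K := ht (Nat.zero_le K)
    have hcK : Continuous fun z => g (u z (t K)) := hg.comp
      (hcu.comp (by fun_prop : Continuous fun z : ℝ × ℝ => (z, t K)))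
    have hcK' : Continuous fun p : (ℝ × ℝ) × ℝ => g (u p.1 (t K)) := hcK.comp continuous_fst
    refine ⟨fun z s => f z s + g (u z (t K)) * I.indicator 1 s,
      fun z s => u z s - g (u z (t K)) * Ψ s, fun z s => y z s - g (u z (t K)) * Φ s,
      fun z => ?_, fun z => ?_, hcu.sub (hcK'.mul (hΨc.comp continuous_snd)),
      hcy.sub (hcK'.mul (hΦc.comp continuous_snd)), fun z s => ?_, fun z k hk s hs => ?_,
      fun z s hs => ?_⟩
    · have hqf : (fun x => q x * (f z x + g (u z (t K)) * I.indicator 1 x)) =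
          fun x => q x * f z x + g (u z (t K)) * I.indicator q x := by
        funext x
        by_cases hx : x ∈ I <;> simp [hx]; ring
      refine ⟨fun s => ((htr z).deriv s).sub ((hΨd s).const_mul _), fun s s' => ?_, fun s s' => ?_⟩
      · rw [hqf]
        exact ((htr z).integrable s s').add ((hqI s s').const_mul _)
      · simp only [hqf]
        rw [intervalIntegral.integral_add ((htr z).integrable s s') ((hqI s s').const_mul _),
          intervalIntegral.integral_const_mul, (htr z).eq s s',
          ← intervalIntegral.integral_interval_sub_left (hqI (t 0) s') (hqI (t 0) s)]
        simp only [hΦ]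
        ring
    · simp [hini z, hΦ0 (t 0) ⟨le_rfl, h0K⟩, hΨ0 (t 0) ⟨le_rfl, h0K⟩]
    · have : 0 ≤ I.indicator (1 : ℝ → ℝ) s := indicator_nonneg (fun _ _ => zero_le_one) s
      have := hf0 z s
      have := hg0 (u z (t K))
      positivity
    · beta_reduce
      rcases Nat.lt_succ_iff_lt_or_eq.1 hk with hk' | rfl
      · have h1 : s ∉ I := fun h => by
          have := ht (Nat.succ_le_of_lt hk')
          exact absurd (hs.2.trans_le this) (not_lt.2 h.1)
        rw [hΨ0 (t k) ⟨ht (Nat.zero_le k), ht hk'.le⟩, hfk z k hk' s hs]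
        simp [h1]
      · rw [hΨ0 (t k) ⟨h0K, le_rfl⟩, hfs z s (fun h => absurd h.2 (not_lt.2 hs.1))]
        simp [hI, hs]
    · beta_reduce
      have h1 : s ∉ I := fun h => hs ⟨h0K.trans h.1, h.2⟩
      rw [hfs z s (fun h => hs ⟨h.1, h.2.trans_le (ht (Nat.le_succ K))⟩)]
      simp [h1]

lemma Traj.neg_on_step {g q f u y : ℝ → ℝ} (H : Traj q f u y) (hg : ∀ s ≤ 0, g s = 0)
    (hg0 : ∀ s, 0 ≤ g s) {C Q h a b : ℝ} (hgC : ∀ s, 0 ≤ s → g s ≤ C * s)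
    (hQ : ∀ s ∈ Icc a b, |∫ x in a..s, q x| ≤ Q) (hh : b - a ≤ h) (hQh : Q * C * h ≤ 1 / 2)
    (hC : 0 ≤ C)
    (hf : ∀ s ∈ Ico a b, f s = g (u a)) (ha : u a < 0 → y a < 0) {s : ℝ} (hs : s ∈ Icc a b)
    (hus : u s < 0) : ∀ s' ∈ Icc s b, u s' < 0 ∧ y s' < 0 := by
  have hy : ∀ p ∈ Icc a b, y p = y a - g (u a) * ∫ x in a..p, q x := fun p hp => by
    rw [H.eq a p, ← intervalIntegral.integral_const_mul]
    congr 1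
    refine intervalIntegral.integral_congr_ae ?_
    have : ∀ᵐ x : ℝ, x ≠ b := by simp [ae_iff, measure_singleton]
    filter_upwards [this] with x hx hx'
    rw [uIoc_of_le hp.1] at hx'
    rw [hf x ⟨hx'.1.le, lt_of_le_of_ne (hx'.2.trans hp.2) hx⟩, mul_comm]
  have hyneg : ∀ p ∈ Icc a b, y p < 0 := by
    rcases lt_or_ge (u a) 0 with hua | hua
    · intro p hp
      rw [hy p hp, hg _ hua.le]
      linarith [ha hua]
    · have hQ0 : 0 ≤ Q := (abs_nonneg _).trans (hQ a (left_mem_Icc.2 (hs.1.trans hs.2)))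
      have hG : g (u a) * Q ≤ Q * C * u a := by nlinarith [hgC _ hua]
      have hlow := add_le_of_le_deriv H.deriv (C := y a - Q * C * u a) hs.1 fun p hp => by
        have hp' : p ∈ Icc a b := ⟨hp.1, hp.2.trans hs.2⟩
        rw [hy p hp']
        have := (abs_le.1 (hQ p hp')).2
        have := mul_le_mul_of_nonneg_left this (hg0 (u a))
        linarith
      have hsa : 0 < s - a := by
        rcases hs.1.eq_or_lt with rfl | h'
        · exact absurd hus (not_lt.2 hua)
        · linarith
      have h1 : Q * C * (s - a) ≤ 1 / 2 :=
        (mul_le_mul_of_nonneg_left (by linarith [hs.2]) (mul_nonneg hQ0 hC)).trans hQh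
      have h2 : y a * (s - a) + Q * C * (s - a) * u a < 0 := by nlinarith
      have h3 : y a + Q * C * u a < 0 := by
        by_contra! h'
        nlinarith
      intro p hp
      rw [hy p hp]
      have := (abs_le.1 (hQ p hp)).1
      have := mul_le_mul_of_nonneg_left this (hg0 (u a))
      linarith
  intro s' hs'
  refine ⟨?_, hyneg s' ⟨hs.1.trans hs'.1, hs'.2⟩⟩
  have := le_add_of_deriv_le H.deriv (C := 0) hs'.1 fun p hp =>
    (hyneg p ⟨hs.1.trans hp.1, hp.2.trans hs'.2⟩).le
  linarith

/-- A discretised trajectory which becomes negative stays negative and decreases. -/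
lemma Traj.neg_forward {g q f u y : ℝ → ℝ} (H : Traj q f u y) (hg : ∀ s ≤ 0, g s = 0)
    (hg0 : ∀ s, 0 ≤ g s) {C Q h : ℝ} (hgC : ∀ s, 0 ≤ s → g s ≤ C * s) {t : ℕ → ℝ}
    (ht : Monotone t) (hC : 0 ≤ C) (hh : ∀ k, t (k + 1) - t k ≤ h) (hQh : Q * C * h ≤ 1 / 2) (K : ℕ)
    (hQ : ∀ s s', t 0 ≤ s → s ≤ s' → s' ≤ t K → |∫ x in s..s', q x| ≤ Q)
    (hf : ∀ k < K, ∀ s ∈ Ico (t k) (t (k + 1)), f s = g (u (t k))) (h0 : 0 ≤ u (t 0)) :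
    ∀ s ∈ Icc (t 0) (t K), u s < 0 → ∀ s' ∈ Icc s (t K), u s' < 0 ∧ y s' < 0 := by
  have key : ∀ k ≤ K, ∀ s ∈ Icc (t 0) (t k), u s < 0 → ∀ s' ∈ Icc s (t k), u s' < 0 ∧ y s' < 0 := by
    intro k
    induction k with
    | zero =>
      intro _ s hs hus
      obtain rfl : s = t 0 := le_antisymm hs.2 hs.1
      exact absurd hus (not_lt.2 h0)
    | succ k ih =>
      intro hk s hs hus s' hs'
      have ih := ih (by omega)
      have hstep : ∀ {s : ℝ}, s ∈ Icc (t k) (t (k + 1)) → u s < 0 →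
          ∀ s' ∈ Icc s (t (k + 1)), u s' < 0 ∧ y s' < 0 := fun hs hus =>
        H.neg_on_step hg hg0 hgC (fun p hp => hQ _ _ (ht (Nat.zero_le k)) hp.1
          (hp.2.trans (ht hk))) (hh k) hQh hC (hf k hk)
          (fun h' => (ih (t k) ⟨ht (Nat.zero_le k), le_rfl⟩ h' (t k) ⟨le_rfl, le_rfl⟩).2) hs hus
      rcases le_total (t k) s with hks | hks
      · exact hstep ⟨hks, hs.2⟩ hus s' hs'
      · rcases le_total s' (t k) with hs'k | hs'k
        · exact ih s ⟨hs.1, hks⟩ hus s' ⟨hs'.1, hs'k⟩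
        · exact hstep ⟨le_rfl, ht (Nat.le_succ k)⟩ (ih s ⟨hs.1, hks⟩ hus (t k) ⟨hks, le_rfl⟩).1 s'
            ⟨hs'k, hs'.2⟩
  exact key K le_rfl

/-- Refinement of a sequence of breakpoints to a grid of small mesh. -/
lemma exists_refinement {b : ℕ → ℝ} (hb : Monotone b) {L : ℝ} (hL : ∀ j, b (j + 1) - b j ≤ L)
    {h : ℝ} (hh : 0 < h) :
    ∃ (t : ℕ → ℝ) (n : ℕ), Monotone t ∧ (∀ k, t (k + 1) - t k ≤ h) ∧ ∀ j, t (n * j) = b j := by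
  obtain ⟨n, hn⟩ := exists_nat_gt (L / h)
  have hL0 : 0 ≤ L := (sub_nonneg.2 (hb (Nat.le_succ 0))).trans (hL 0)
  have hn0 : (0 : ℝ) < n := lt_of_le_of_lt (by positivity) hn
  have hnpos' : 0 < n := by exact_mod_cast hn0
  set t : ℕ → ℝ := fun k => b (k / n) + (k % n : ℕ) / n * (b (k / n + 1) - b (k / n)) with ht
  have hgap : ∀ k, t (k + 1) - t k = (b (k / n + 1) - b (k / n)) / n := by
    intro k
    have hlt := Nat.mod_lt k hnpos'
    have hdm := Nat.div_add_mod k n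
    rcases Nat.lt_or_ge (k % n + 1) n with h1 | h1
    · have h2 : (k + 1) / n = k / n := by
        rw [Nat.div_eq_iff hnpos']
        have : n * (k / n) = (k / n) * n := mul_comm _ _
        constructor <;> omega
      have h3 : (k + 1) % n = k % n + 1 := by
        have := Nat.div_add_mod (k + 1) n
        rw [h2] at this; omega
      simp only [ht, h2, h3]
      push_cast
      ring
    · have h4 : k % n + 1 = n := by omega
      have h2 : (k + 1) / n = k / n + 1 := by
        have : k + 1 = n * (k / n + 1) := by rw [mul_add]; omega
        rw [this, Nat.mul_div_cancel_left _ hnpos']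
      have h3 : (k + 1) % n = 0 := by
        have := Nat.div_add_mod (k + 1) n
        rw [h2, mul_add] at this; omega
      have h5 : ((k % n : ℕ) : ℝ) = n - 1 := by
        rw [eq_sub_iff_add_eq]; exact_mod_cast h4
      simp only [ht, h2, h3, h5]
      field_simp
      push_cast
      ring
  refine ⟨t, n, monotone_nat_of_le_succ fun k => ?_, fun k => ?_, fun j => ?_⟩
  · have := hgap k
    have h1 : 0 ≤ (b (k / n + 1) - b (k / n)) / n :=
      div_nonneg (sub_nonneg.2 (hb (Nat.le_succ _))) hn0.le
    linarith
  · rw [hgap k, div_le_iff₀ hn0]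
    rw [div_lt_iff₀ hh] at hn
    linarith [hL (k / n)]
  · simp [ht, Nat.mul_div_cancel_left _ hnpos']

/-- Locating a point between two grid points. -/
lemma exists_grid_cell {t : ℕ → ℝ} {k₁ k₂ : ℕ} (hk : k₁ ≤ k₂) {s : ℝ}
    (hs : s ∈ Ico (t k₁) (t k₂)) : ∃ k, k₁ ≤ k ∧ k < k₂ ∧ s ∈ Ico (t k) (t (k + 1)) := by
  classical
  set k := Nat.findGreatest (fun k => t k ≤ s) k₂ with hkdef
  have h1 : t k ≤ s := Nat.findGreatest_spec (P := fun k => t k ≤ s) hk hs.1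
  have h2 : k ≤ k₂ := Nat.findGreatest_le k₂
  have h3 : k₁ ≤ k := Nat.le_findGreatest hk hs.1
  have h4 : k < k₂ := lt_of_le_of_ne h2 fun h => absurd hs.2 (not_lt.2 (h ▸ h1))
  exact ⟨k, h3, h4, h1, not_le.1 (Nat.findGreatest_is_greatest (Nat.lt_succ_self k) h4)⟩

namespace Setup

variable (E : Setup)

lemma τ_mono : Monotone E.τ :=
  monotone_int_of_le_succ fun n => by
    have h1 := E.τ_lt (n + 1)
    have h2 := E.σ_lt (n + 1)
    rw [add_sub_cancel_right] at h1
    linarith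

lemma C_nonneg : 0 ≤ E.C := by
  have := E.g_le 1 zero_le_one
  linarith [E.g_nonneg 1]

/-- A discretised flow over the first `N` blocks. -/
theorem exists_discretisation (N : ℕ) : ∃ h₀ > 0, ∀ h, 0 < h → h ≤ h₀ →
    ∃ f u y : ℝ × ℝ → ℝ → ℝ, (∀ z, E.Orbit h (Icc 1 N) (f z) (u z) (y z)) ∧
      (∀ z, u z (E.τ 0) = z.1 ∧ y z (E.τ 0) = z.2) ∧
      Continuous (fun p : (ℝ × ℝ) × ℝ => u p.1 p.2) ∧
      Continuous (fun p : (ℝ × ℝ) × ℝ => y p.1 p.2) ∧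
      (∀ z, 0 ≤ z.1 → ∀ s ∈ Icc (E.τ 0) (E.τ N), u z s < 0 →
        ∀ s' ∈ Icc s (E.τ N), u z s' < 0 ∧ y z s' < 0) ∧
      (∀ z s, s ∉ Ico (E.τ 0) (E.τ N) → f z s = 0) ∧
      ∀ z, Delay E.g (u z) (f z) h (E.τ 0) (E.τ N) := by
  set Q := ∫ x in (E.τ 0)..(E.τ N), |E.q x| with hQdef
  have hQ : ∀ s s', E.τ 0 ≤ s → s ≤ s' → s' ≤ E.τ N → |∫ x in s..s', E.q x| ≤ Q := by
    intro s s' h1 h2 h3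
    refine (intervalIntegral.abs_integral_le_integral_abs h2).trans ?_
    exact intervalIntegral.integral_mono_interval h1 h2 h3 (ae_of_all _ fun x => abs_nonneg _)
      (E.q_int _ _).abs
  have hQ0 : 0 ≤ Q := intervalIntegral.integral_nonneg (E.τ_mono (by positivity))
    fun x _ => abs_nonneg _
  have hd := E.d_pos
  have hC := E.C_nonneg
  refine ⟨min (E.d / 2) (1 / (2 * (Q * E.C + 1))), by positivity, fun h hh hle => ?_⟩
  have hQh : Q * E.C * h ≤ 1 / 2 := by
    have h1 := hle.trans (min_le_right _ _)
    have h2 : 0 ≤ Q * E.C := mul_nonneg hQ0 hC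
    rw [le_div_iff₀ (by positivity)] at h1
    nlinarith
  set b : ℕ → ℝ := fun j => if Even j then E.τ (j / 2 : ℕ) else E.σ ((j / 2 : ℕ) + 1) with hbdef
  have hb2 : ∀ j : ℕ, b (2 * j) = E.τ j := fun j => by simp [hbdef]
  have hb1 : ∀ j : ℕ, b (2 * j + 1) = E.σ (j + 1) := fun j => by
    have h1 : (2 * j + 1) / 2 = j := by omega
    have h2 : ¬ Even (2 * j + 1) := by simp
    simp only [hbdef, h1, h2, if_false]
  have hbstep : ∀ j, b j ≤ b (j + 1) ∧ b (j + 1) - b j ≤ E.T := by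
    intro j
    rcases Nat.even_or_odd' j with ⟨i, rfl | rfl⟩
    · rw [hb2, hb1]
      have h1 := E.τ_lt (i + 1)
      have h2 := E.len_neg (i + 1)
      rw [add_sub_cancel_right] at h1 h2
      exact ⟨h1.le, h2⟩
    · rw [hb1, show 2 * i + 1 + 1 = 2 * (i + 1) by ring, hb2]
      have h1 := E.σ_lt (i + 1)
      have h2 := E.len_pos (i + 1)
      push_cast
      exact ⟨h1.le, h2⟩
  obtain ⟨t, n, ht, hmesh, htb⟩ := exists_refinement (monotone_nat_of_le_succ fun j => (hbstep j).1)
    (fun j => (hbstep j).2) hh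
  have ht0 : t 0 = E.τ 0 := by simpa using (htb (2 * 0)).trans (hb2 0)
  have htN : t (n * (2 * N)) = E.τ N := (htb _).trans (hb2 N)
  obtain ⟨f, u, y, htr, hini, hcu, hcy, hf0, hfk, hfs⟩ :=
    exists_scheme E.g_cont E.g_nonneg E.q_int ht (n * (2 * N))
  have hdelay : ∀ z, ∀ j₁ j₂, j₁ ≤ j₂ → j₂ ≤ 2 * N → Delay E.g (u z) (f z) h (b j₁) (b j₂) := by
    intro z j₁ j₂ h12 h2 s hs
    rw [← htb, ← htb] at hs
    obtain ⟨k, hk1, hk2, hk⟩ := exists_grid_cell (Nat.mul_le_mul_left n h12) hs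
    refine ⟨t k, ⟨?_, hk.1⟩, ?_, hfk z k (hk2.trans_le (Nat.mul_le_mul_left n h2)) s hk⟩
    · rw [← htb]; exact ht hk1
    · linarith [hmesh k, hk.2]
  refine ⟨f, u, y, fun z => ⟨htr z, hf0 z, hle.trans (min_le_left _ _), ?_, ?_⟩, ?_, hcu, hcy,
    ?_, ?_, ?_⟩
  · intro j hj
    obtain ⟨i, rfl⟩ : ∃ i : ℕ, j = i + 1 := ⟨(j - 1).toNat, by have := hj.1; omega⟩
    have := hdelay z (2 * i + 1) (2 * (i + 1)) (by omega) (by have := hj.2; omega)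
    rw [hb1, hb2] at this
    exact_mod_cast this
  · intro j hj
    obtain ⟨i, rfl⟩ : ∃ i : ℕ, j = i + 1 := ⟨(j - 1).toNat, by have := hj.1; omega⟩
    have := hdelay z (2 * i) (2 * i + 1) (by omega) (by have := hj.2; omega)
    rw [hb1, hb2] at this
    rwa [add_sub_cancel_right]
  · rwa [← ht0]
  · intro z hz
    rw [← ht0, ← htN]
    refine (htr z).neg_forward E.g_neg E.g_nonneg E.g_le ht hC hmesh hQh _ ?_ (hfk z) ?_
    · rwa [ht0, htN]
    · rwa [(hini z).1]
  · rwa [← ht0, ← htN]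
  · intro z
    have := hdelay z (2 * 0) (2 * N) (by omega) le_rfl
    rw [hb2, hb2] at this
    exact_mod_cast this

end Setup
end Discretisation

section Shooting

lemma exists_eq_sSup_Icc {u : ℝ → ℝ} (hu : Continuous u) {a b : ℝ} (hab : a ≤ b) :
    ∃ t ∈ Icc a b, u t = sSup (u '' Icc a b) ∧ ∀ s ∈ Icc a b, u s ≤ sSup (u '' Icc a b) := by
  obtain ⟨t, ht, h1, h2⟩ := isCompact_Icc.exists_sSup_image_eq_and_ge (nonempty_Icc.2 hab)
    hu.continuousOn
  exact ⟨t, ht, h1.symm, fun s hs => h1 ▸ h2 s hs⟩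

namespace Setup

variable (E : Setup)

lemma σ_mono : Monotone E.σ :=
  monotone_int_of_le_succ fun n => by
    have h1 := E.τ_lt (n + 1)
    have h2 := E.σ_lt n
    rw [add_sub_cancel_right] at h1
    linarith

/-- Truncation to `[r, X - 1]`. -/
noncomputable def clamp (w : ℝ) : ℝ := max E.r (min (E.X - 1) w)

lemma r_le_clamp (w : ℝ) : E.r ≤ E.clamp w := le_max_left _ _

lemma clamp_pos (w : ℝ) : 0 < E.clamp w := E.r_pos.trans_le (E.r_le_clamp w)

lemma clamp_le_max (w : ℝ) : E.clamp w ≤ max E.r w := max_le_max_left _ (min_le_right _ _)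

lemma clamp_le (w : ℝ) : E.clamp w ≤ E.X - 1 :=
  max_le (by linarith [E.R_lt_X, E.r_lt, E.ρ_lt]) (min_le_left _ _)

lemma clamp_eq {w : ℝ} (h : E.r ≤ w) (h' : w ≤ E.X - 1) : E.clamp w = w := by
  rw [clamp, min_eq_right h', max_eq_right h]

lemma continuous_clamp : Continuous E.clamp := by unfold clamp; fun_prop

variable {E}

/-- Tangent line estimate at the end of a positivity interval. -/
lemma Orbit.le_sub {h : ℝ} {P : Set ℤ} {f u y : ℝ → ℝ} (O : E.Orbit h P f u y) (n : ℤ)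
    (hy : y (E.τ n) ≤ 0) {t : ℝ} (ht : t ∈ Icc (E.σ n) (E.τ n)) :
    u t ≤ u (E.τ n) - E.T * y (E.τ n) := by
  have h1 := add_le_of_le_deriv O.traj.deriv (C := y (E.τ n)) ht.2 fun s hs =>
    O.anti n ⟨ht.1.trans hs.1, hs.2⟩ (right_mem_Icc.2 (E.σ_lt n).le) hs.2
  have h2 := E.len_pos n
  have h3 : E.τ n - t ≤ E.T := by linarith [ht.1]
  nlinarith

/-- The closing quotient is at most `-1` when the final state lies in the negative quadrant. -/
lemma closing_le {x y : ℝ} (hx : x ≤ 0) (hr : E.r ≤ x - E.T * y) :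
    (x + E.T * y) / E.clamp (x - E.T * y) ≤ -1 := by
  rw [div_le_iff₀ (E.clamp_pos _)]
  have := E.clamp_le_max (x - E.T * y)
  rw [max_eq_right hr] at this
  linarith

/-- The closing quotient is at least `1/2` when the last maximum is at a level `r` or `R`. -/
lemma closing_ge {x y c : ℝ} (hc : E.r ≤ c) (hx : 7 * c / 8 ≤ x) (hy : -(c / (8 * E.T)) ≤ y) :
    1 / 2 ≤ (x + E.T * y) / E.clamp (x - E.T * y) := by
  rw [le_div_iff₀ (E.clamp_pos _)]
  have hT := E.T_pos
  have hr := E.r_pos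
  have h1 : -(c / 8) ≤ E.T * y := by
    have := mul_le_mul_of_nonneg_left hy hT.le
    have h2 : E.T * -(c / (8 * E.T)) = -(c / 8) := by field_simp
    linarith
  have h2 : E.clamp (x - E.T * y) ≤ 2 * (x + E.T * y) :=
    (E.clamp_le_max _).trans (max_le (by linarith) (by linarith))
  linarith

/-- Approximate solutions with prescribed closed itinerary, closing up to an error. -/
theorem exists_approx (E : Setup) {N : ℕ} (hN : 1 ≤ N) (c : ℕ → Fin 3) (hcN : c N ≠ 0) :
    ∃ h₀ > 0, ∀ h, 0 < h → h ≤ h₀ → ∀ δ, 0 < δ → δ < 1 → ∃ f u y : ℝ → ℝ,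
      E.Orbit h (Icc 1 N) f u y ∧ (∀ s, s ∉ Ico (E.τ 0) (E.τ N) → f s = 0) ∧
      Delay E.g u f h (E.τ 0) (E.τ N) ∧ (∀ s ∈ Icc (E.τ 0) (E.τ N), 0 ≤ u s) ∧
      u (E.τ 0) ≤ E.X ∧ |y (E.τ 0)| ≤ E.Y ∧
      (∀ j : ℕ, 1 ≤ j → j ≤ N →
        InBand E.r E.ρ E.R (c j) (sSup (u '' Icc (E.σ j) (E.τ j)))) ∧
      u (E.τ N) - E.T * y (E.τ N) = u (E.τ 0) - E.T * y (E.τ 0) ∧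
      |(u (E.τ N) + E.T * y (E.τ N)) - (u (E.τ 0) + E.T * y (E.τ 0))| ≤ δ * E.X := by
  obtain ⟨h₀, hh₀, H⟩ := E.exists_discretisation N
  refine ⟨h₀, hh₀, fun h hh hle δ hδ hδ1 => ?_⟩
  obtain ⟨f, u, y, hO, hini, hcu, hcy, hneg, hsupp, hdel⟩ := H h hh hle
  have hT := E.T_pos
  have hr := E.r_pos
  have hrρ := E.r_lt
  have hρR := E.ρ_lt
  have hRX := E.R_lt_X
  have hXp := E.X_pos
  set ini : ℝ × ℝ → ℝ × ℝ := fun p => (p.2 * (1 + p.1) / 2, -(p.2 * (1 - p.1) / (2 * E.T)))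
    with hini_def
  have hinic : Continuous ini := by fun_prop
  have hU : ∀ t, Continuous fun p => u (ini p) t := fun t =>
    hcu.comp (by fun_prop : Continuous fun p => (ini p, t))
  have hV : ∀ t, Continuous fun p => y (ini p) t := fun t =>
    hcy.comp (by fun_prop : Continuous fun p => (ini p, t))
  set M : ℕ → ℝ × ℝ → ℝ := fun j p => sSup (u (ini p) '' Icc (E.σ j) (E.τ j)) with hM_def
  have hM : ∀ j, Continuous (M j) := fun j =>
    isCompact_Icc.continuous_sSup
      (hcu.comp (by fun_prop : Continuous fun x : (ℝ × ℝ) × ℝ => (ini x.1, x.2)))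
  have hMs : ∀ (j : ℕ) (p : ℝ × ℝ), ∃ t ∈ Icc (E.σ j) (E.τ j), u (ini p) t = M j p ∧
      ∀ s ∈ Icc (E.σ j) (E.τ j), u (ini p) s ≤ M j p := fun j p =>
    exists_eq_sSup_Icc (hO (ini p)).traj.continuous (E.σ_lt j).le
  set wN : ℝ × ℝ → ℝ := fun p => E.clamp (u (ini p) (E.τ N) - E.T * y (ini p) (E.τ N)) with hwN
  have hwNc : Continuous wN := E.continuous_clamp.comp ((hU _).sub (continuous_const.mul (hV _)))
  set S : ℝ × ℝ → ℝ := fun p => (u (ini p) (E.τ N) + E.T * y (ini p) (E.τ N)) / wN p with hS_def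
  have hS : Continuous S := ((hU _).add (continuous_const.mul (hV _))).div₀ hwNc
    fun p => (E.clamp_pos _).ne'
  set D : Set (ℝ × ℝ) := Icc (-1) (1 / 2) ×ˢ Icc (E.r / 2) E.X with hD_def
  have hD0 : ∀ p ∈ D, 0 ≤ (ini p).1 ∧ (ini p).1 ≤ E.X ∧ |(ini p).2| ≤ E.Y := by
    rintro ⟨s, w⟩ ⟨⟨hs1, hs2⟩, hw1, hw2⟩
    simp only at hs1 hs2 hw1 hw2
    refine ⟨?_, ?_, ?_⟩ <;> simp only [hini_def]
    · have : 0 ≤ w * (1 + s) := mul_nonneg (by linarith) (by linarith)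
      linarith
    · nlinarith
    · rw [abs_neg, abs_of_nonneg (div_nonneg (mul_nonneg (by linarith) (by linarith))
        (by linarith)), div_le_iff₀ (by linarith)]
      have := E.Y_mul
      nlinarith
  set Dn : ℕ → ℝ × ℝ → Prop := fun j p =>
    ∃ s ∈ Icc (E.τ 0) (E.τ N), s ≤ E.σ j ∧ u (ini p) s < 0 with hDn
  set Up : ℕ → ℝ × ℝ → Prop := fun j p =>
    (j ≤ N → E.R < M j p) ∧ (j = N + 1 → 1 / 2 ≤ S p) with hUp
  set A : ℕ → Set (ℝ × ℝ) := fun j =>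
    D ∩ {p | ∀ i, 1 ≤ i → i < j → InBand E.r E.ρ E.R (c i) (M i p)} with hA_def
  have hmemP : ∀ j : ℕ, 1 ≤ j → j ≤ N → (j : ℤ) ∈ Icc (1 : ℤ) N := fun j h1 h2 =>
    ⟨by exact_mod_cast h1, by exact_mod_cast h2⟩
  have hτN : ∀ j : ℕ, j ≤ N → E.τ j ≤ E.τ N := fun j hj => E.τ_mono (by exact_mod_cast hj)
  have hσ0 : ∀ j : ℕ, 1 ≤ j → E.τ 0 ≤ E.σ j := fun j hj =>
    (E.τ_mono (by have : (1 : ℤ) ≤ j := by exact_mod_cast hj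
                  omega : (0 : ℤ) ≤ j - 1)).trans (E.τ_lt j).le
  -- negativity before `σ j` forces a negative maximum
  have hDnM : ∀ j, 1 ≤ j → j ≤ N → ∀ p ∈ D, Dn j p → M j p < 0 := by
    rintro j hj1 hjN p hp ⟨s, hs, hsj, hus⟩
    obtain ⟨t, ht, hteq, -⟩ := hMs j p
    rw [← hteq]
    exact (hneg _ (hD0 p hp).1 s hs hus t ⟨hsj.trans ht.1, ht.2.trans (hτN j hjN)⟩).1
  have hentry : ∀ j, 1 ≤ j → j ≤ N → ∀ p ∈ A j, 0 < M j p →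
      -E.Y ≤ y (ini p) (E.τ (j - 1)) ∧ u (ini p) (E.τ (j - 1)) ≤ E.X := by
    intro j hj1 hjN p hp hMpos
    rcases hj1.eq_or_lt with rfl | hj2
    · have h1 := hD0 p hp.1
      have h2 := hini (ini p)
      simp only [Nat.cast_one, sub_self]
      rw [h2.1, h2.2]
      exact ⟨(abs_le.1 h1.2.2).1, h1.2.1⟩
    · obtain ⟨i, rfl⟩ : ∃ i, j = i + 1 := ⟨j - 1, by omega⟩
      have hcast : ((i + 1 : ℕ) : ℤ) - 1 = i := by push_cast; ring
      rw [hcast]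
      have hband := (hp.2 i (by omega) (by omega)).le hrρ.le hρR.le
      obtain ⟨-, -, -, hle⟩ := hMs i p
      have hle' : ∀ s ∈ Icc (E.σ i) (E.τ i), u (ini p) s ≤ E.R := fun s hs => (hle s hs).trans hband
      have h0 : 0 ≤ u (ini p) (E.τ i) := by
        by_contra! hlt
        refine absurd (hDnM (i + 1) hj1 hjN p hp.1 ⟨E.τ i, ⟨E.τ_mono (by positivity),
          hτN i (by omega)⟩, ?_, hlt⟩) (not_lt.2 hMpos.le)
        have := E.τ_lt (i + 1 : ℕ)
        rw [hcast] at this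
        exact this.le
      have h1 := (hO (ini p)).velocity_ge (hmemP i (by omega) (by omega)) h0 hle'
      exact ⟨by linarith [E.Y₀_le_Y],
        (hle' _ (right_mem_Icc.2 (E.σ_lt i).le)).trans (by linarith)⟩
  have hlevel : ∀ a, a = E.r ∨ a = E.R → ∀ j, 1 ≤ j → j ≤ N → ∀ p ∈ A j, M j p = a →
      Up (j + 1) p := by
    intro a ha j hj1 hjN p hp hMa
    have hra : E.r ≤ a := by rcases ha with rfl | rfl <;> linarith
    obtain ⟨hy, hx⟩ := hentry j hj1 hjN p hp (by linarith)
    obtain ⟨t, ht, hteq, hle⟩ := hMs j p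
    rw [hMa] at hteq hle
    have hst := (hO (ini p)).level (hmemP j hj1 hjN) ha hy hx hle ht hteq
    refine ⟨fun hj => ?_, fun hj => ?_⟩
    · have hcast : ((j + 1 : ℕ) : ℤ) - 1 = j := by push_cast; ring
      obtain ⟨t', ht', hgt⟩ := (hO (ini p)).exists_gt_next (n := (j + 1 : ℕ))
        (hmemP (j + 1) (by omega) hj) ha (by rw [hcast]; exact hst.1) (by rw [hcast]; exact hst.2)
        (by rw [hcast]; exact hle _ (right_mem_Icc.2 (E.σ_lt j).le))
      obtain ⟨-, -, -, hle'⟩ := hMs (j + 1) p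
      exact hgt.trans_le (hle' t' ht')
    · obtain rfl : j = N := by omega
      exact closing_ge hra hst.1 hst.2
  have hDS : ∀ p ∈ A (N + 1), Dn (N + 1) p → S p ≤ -1 := by
    rintro p hp ⟨s, hs, -, hus⟩
    have h1 := hneg _ (hD0 p hp.1).1 s hs hus (E.τ N) ⟨hs.2, le_rfl⟩
    obtain ⟨t, ht, hteq, -⟩ := hMs N p
    have h2 := (hO (ini p)).le_sub N h1.2.le ht
    exact closing_le h1.1.le ((((hp.2 N hN (by omega)).ge hrρ.le hcN).trans hteq.ge).trans h2)
  obtain ⟨e, dn, up, hor, hec, hedn, heup, hest⟩ := exists_itinerary_function hr hrρ hρR c hcN M hM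
    S hS D Dn Up A (by ext p; simp only [hA_def]; constructor
                       · exact fun h => h.1
                       · exact fun h => ⟨h, fun i h1 h2 => by omega⟩)
    (fun j hj1 _ => by
      ext p
      constructor
      · exact fun h => ⟨⟨h.1, fun i h1 h2 => h.2 i h1 (by omega)⟩, h.2 j hj1 (by omega)⟩
      · rintro ⟨⟨h1, h2⟩, h3⟩
        refine ⟨h1, fun i hi1 hi2 => ?_⟩
        rcases Nat.lt_succ_iff_lt_or_eq.1 hi2 with h' | rfl
        · exact h2 i hi1 h'
        · exact h3)
    (hlevel _ (Or.inl rfl)) (hlevel _ (Or.inr rfl))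
    (fun j hj1 hjN p hp hMρ => by
      obtain ⟨t, ht, hteq, hle⟩ := hMs j p
      rw [hMρ] at hteq hle
      have : ∃ s ∈ Icc (E.σ j) (E.τ j), u (ini p) s < 0 := by
        by_contra! h0
        exact (hO (ini p)).not_max_rho (hmemP j hj1 hjN) h0 hle ht hteq
      obtain ⟨s, hs, hus⟩ := this
      refine ⟨s, ⟨(hσ0 j hj1).trans hs.1, hs.2.trans (hτN j hjN)⟩, hs.2.trans ?_, hus⟩
      have := E.τ_lt (j + 1 : ℕ)
      rw [show ((j + 1 : ℕ) : ℤ) - 1 = j by push_cast; ring] at this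
      exact this.le)
    (fun j hj1 hjN p hp h => (hDnM j hj1 hjN p hp.1 h).le)
    (fun j _ _ p _ ⟨s, hs, hsj, hus⟩ =>
      ⟨s, hs, hsj.trans (E.σ_mono (by exact_mod_cast Nat.le_succ j)), hus⟩)
    (fun j _ hjN p _ h => (h.1 hjN).le)
    hDS (fun p _ h => h.2 rfl)
  -- behaviour on the two vertical sides of the rectangle
  have hleft : ∀ w ∈ Icc (E.r / 2) E.X, e (-1, w) = dn := by
    intro w hw
    refine hedn _ ⟨⟨le_rfl, by norm_num⟩, hw⟩ ?_
    have hi : ini (-1, w) = (0, -(w / E.T)) := by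
      simp only [hini_def]; ext <;> simp
      field_simp; norm_num
    have hw0 : 0 < w := by linarith [hw.1]
    have h1 := hini (ini (-1, w))
    have hlt : y (ini (-1, w)) (E.τ 0) < 0 := by
      rw [h1.2, hi]; simpa using div_pos hw0 hT
    have h2 := (hasDerivAt_iff_tendsto_slope.1 ((hO (ini (-1, w))).traj.deriv (E.τ 0))).eventually
      (gt_mem_nhds hlt)
    have h3 : ∀ᶠ t in 𝓝[>] (E.τ 0), slope (u (ini (-1, w))) (E.τ 0) t < 0 :=
      h2.filter_mono (nhdsWithin_mono _ fun x (hx : E.τ 0 < x) => hx.ne')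
    have hτσ : E.τ 0 < E.σ 1 := by simpa using E.τ_lt 1
    obtain ⟨t, ht, ht'⟩ := (h3.and (Ioo_mem_nhdsGT hτσ)).exists
    have hu0 : u (ini (-1, w)) (E.τ 0) = 0 := by rw [h1.1, hi]
    rw [slope_def_field, hu0, sub_zero, div_neg_iff] at ht
    refine ⟨t, ⟨ht'.1.le, ht'.2.le.trans ((E.σ_lt 1).le.trans ?_)⟩, by simpa using ht'.2.le, ?_⟩
    · simpa using hτN 1 hN
    · rcases ht with h' | h'
      · linarith [h'.2, ht'.1]
      · exact h'.1
  have hright : ∀ w ∈ Icc (E.r / 2) E.X, e (1 / 2, w) = up := by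
    intro w hw
    have hpD : ((1 / 2 : ℝ), w) ∈ D := ⟨⟨by norm_num, le_rfl⟩, hw⟩
    refine heup _ hpD ⟨fun _ => ?_, fun h => by omega⟩
    set p : ℝ × ℝ := (1 / 2, w) with hp
    have hi1 : (ini p).1 = 3 * w / 4 := by simp only [hini_def, hp]; ring
    have hi2 : (ini p).2 = -(w / (4 * E.T)) := by simp only [hini_def, hp]; field_simp; ring
    have h1 := hini (ini p)
    have h10 : (1 : ℤ) - 1 = 0 := by norm_num
    have hlow : ∀ t ∈ Icc (E.τ (1 - 1)) (E.σ 1), E.r / 4 ≤ u (ini p) t := by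
      intro t ht
      have h2 := add_le_of_le_deriv (hO (ini p)).traj.deriv (C := -(w / (4 * E.T))) ht.1
        fun s hs => by
          have := (hO (ini p)).mono 1 (left_mem_Icc.2 (E.τ_lt 1).le) ⟨hs.1, hs.2.trans ht.2⟩ hs.1
          rw [h10, h1.2, hi2] at this
          exact this
      rw [h10] at h2
      rw [h1.1, hi1] at h2
      have h3 : w / (4 * E.T) * (t - E.τ 0) ≤ w / (4 * E.T) * E.T := by
        refine mul_le_mul_of_nonneg_left ?_ (div_nonneg (by linarith [hw.1]) (by linarith))
        have := E.len_neg 1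
        rw [h10] at this
        linarith [ht.2]
      have h4 : w / (4 * E.T) * E.T = w / 4 := by field_simp
      linarith [hw.1]
    have h1P : (1 : ℤ) ∈ Icc (1 : ℤ) N := by simpa using hmemP 1 le_rfl hN
    obtain ⟨t, ht, hgt⟩ := (hO (ini p)).exists_gt_of_velocity h1P
      (by linarith [hlow _ (right_mem_Icc.2 (E.τ_lt 1).le)])
      ((hO (ini p)).velocity_large h1P hlow
        (by rw [h10, h1.2]; exact (abs_le.1 (hD0 p hpD).2.2).1)
        (by rw [h10, h1.1]; exact (hD0 p hpD).2.1))
    obtain ⟨-, -, -, hle⟩ := hMs 1 p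
    exact hgt.trans_le (hle t (by simpa using ht))
  -- a zero of the closing equations
  have hzero : ∃ p ∈ D, e p = (1 - δ) * p.1 ∧ wN p = p.2 := by
    have hF2 : ContinuousOn (fun p : ℝ × ℝ => p.2 - wN p) D :=
      (continuous_snd.sub hwNc).continuousOn
    have hb : ∀ s ∈ Icc (-1 : ℝ) (1 / 2), E.r / 2 - wN (s, E.r / 2) < 0 := fun s _ => by
      linarith [E.r_le_clamp (u (ini (s, E.r / 2)) (E.τ N) - E.T * y (ini (s, E.r / 2)) (E.τ N))]
    have ht : ∀ s ∈ Icc (-1 : ℝ) (1 / 2), 0 < E.X - wN (s, E.X) := fun s _ => by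
      linarith [E.clamp_le (u (ini (s, E.X)) (E.τ N) - E.T * y (ini (s, E.X)) (E.τ N))]
    have hF1 : ContinuousOn (fun p : ℝ × ℝ => e p - (1 - δ) * p.1) D :=
      hec.sub (by fun_prop)
    rcases hor with ⟨h1, h2⟩ | ⟨h1, h2⟩
    · obtain ⟨p, hp, h3, h4⟩ := exists_zero_of_rectangle (by norm_num) (by linarith) hF1 hF2
        (fun w hw => by simp only [hleft w hw, h1]; linarith)
        (fun w hw => by simp only [hright w hw, h2]; linarith) hb ht
      exact ⟨p, hp, by linarith, by linarith⟩
    · obtain ⟨p, hp, h3, h4⟩ := exists_zero_of_rectangle (by norm_num) (by linarith) hF1.neg hF2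
        (fun w hw => by simp only [Pi.neg_apply, hleft w hw, h1]; linarith)
        (fun w hw => by simp only [Pi.neg_apply, hright w hw, h2]; linarith) hb ht
      simp only [Pi.neg_apply] at h3
      exact ⟨p, hp, by linarith, by linarith⟩
  obtain ⟨p, hpD, hpe, hpw⟩ := hzero
  have hs : (1 - δ) * p.1 ∈ Ioo (-1 : ℝ) (1 / 2) := by
    obtain ⟨⟨h1, h2⟩, -⟩ := hpD
    constructor <;> nlinarith
  obtain ⟨hpA, hpS⟩ := hest p hpD (hpe ▸ hs)
  rw [hpe] at hpS
  have hband : ∀ j, 1 ≤ j → j ≤ N → InBand E.r E.ρ E.R (c j) (M j p) := fun j h1 h2 =>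
    hpA.2 j h1 (by omega)
  have hw0 : 0 < p.2 := by linarith [hpD.2.1]
  obtain ⟨t, ht, hteq, htle⟩ := hMs N p
  have hMN : E.r ≤ M N p := (hband N hN le_rfl).ge hrρ.le hcN
  have hMR : M N p ≤ E.R := (hband N hN le_rfl).le hrρ.le hρR.le
  have hx0 : ∀ s ∈ Icc (E.τ 0) (E.τ N), 0 ≤ u (ini p) s := by
    intro s hs'
    by_contra! hlt
    have := hDS p hpA ⟨s, hs', ?_, hlt⟩
    · rw [hpS] at this; linarith [hs.1]
    · refine hs'.2.trans ?_
      have := E.τ_lt (N + 1 : ℕ)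
      rw [show ((N + 1 : ℕ) : ℤ) - 1 = N by push_cast; ring] at this
      exact this.le
  have hxN := hx0 (E.τ N) ⟨E.τ_mono (by positivity), le_rfl⟩
  have hyN : y (ini p) (E.τ N) ≤ 0 := by
    by_contra! hpos
    have h1 := add_le_of_le_deriv (hO (ini p)).traj.deriv (C := 0) ht.2 fun s hs' =>
      hpos.le.trans ((hO (ini p)).anti N ⟨ht.1.trans hs'.1, hs'.2⟩
        (right_mem_Icc.2 (E.σ_lt N).le) hs'.2)
    have h2 := mul_pos hT hpos
    have h3 : wN p ≤ u (ini p) (E.τ N) + E.T * y (ini p) (E.τ N) :=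
      (E.clamp_le_max _).trans (max_le (by linarith) (by linarith))
    have h4 : 1 ≤ S p := by
      rw [hS_def]; beta_reduce; rwa [one_le_div (E.clamp_pos _)]
    rw [hpS] at h4
    linarith [hs.2]
  have hyN' := (hO (ini p)).velocity_ge (hmemP N hN le_rfl) hxN fun s hs' =>
    (htle s hs').trans hMR
  have hwr : E.r ≤ u (ini p) (E.τ N) - E.T * y (ini p) (E.τ N) := by
    linarith [(hO (ini p)).le_sub N hyN ht]
  have hwR : u (ini p) (E.τ N) - E.T * y (ini p) (E.τ N) ≤ E.X - 1 := by
    have h1 := htle _ (right_mem_Icc.2 (E.σ_lt N).le)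
    unfold X
    nlinarith
  have hw : u (ini p) (E.τ N) - E.T * y (ini p) (E.τ N) = p.2 := by
    rw [← hpw, hwN]; exact (E.clamp_eq hwr hwR).symm
  have hv : u (ini p) (E.τ N) + E.T * y (ini p) (E.τ N) = (1 - δ) * p.1 * p.2 := by
    rw [← hpS, hS_def]
    beta_reduce
    rw [hpw, div_mul_cancel₀ _ hw0.ne']
  have hi := hini (ini p)
  have hwi : (ini p).1 - E.T * (ini p).2 = p.2 := by simp only [hini_def]; field_simp; ring
  have hvi : (ini p).1 + E.T * (ini p).2 = p.1 * p.2 := by simp only [hini_def]; field_simp; ring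
  refine ⟨f (ini p), u (ini p), y (ini p), hO _, hsupp _, hdel _, hx0, ?_, ?_, hband, ?_, ?_⟩
  · rw [hi.1]; exact (hD0 p hpD).2.1
  · rw [hi.2]; exact (hD0 p hpD).2.2
  · rw [hw, hi.1, hi.2, hwi]
  · rw [hv, hi.1, hi.2, hvi, show (1 - δ) * p.1 * p.2 - p.1 * p.2 = -(δ * (p.1 * p.2)) by ring,
      abs_neg, abs_mul, abs_of_pos hδ, abs_mul, abs_of_pos hw0]
    refine mul_le_mul_of_nonneg_left ?_ hδ.le
    have h1 : |p.1| ≤ 1 := abs_le.2 ⟨hpD.1.1, hpD.1.2.trans (by norm_num)⟩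
    have h2 : p.2 ≤ E.X := hpD.2.2
    nlinarith [abs_nonneg p.1]

end Setup
end Shooting

section Limits

lemma exists_subseq_of_lipschitz {u : ℕ → C(ℝ, ℝ)} {L B : ℝ} {t₀ : ℝ}
    (hL : ∀ n s t, |u n s - u n t| ≤ L * |s - t|) (hB : ∀ n, |u n t₀| ≤ B) :
    ∃ (v : C(ℝ, ℝ)) (φ : ℕ → ℕ), StrictMono φ ∧ Tendsto (fun n => u (φ n)) atTop (𝓝 v) := by
  set P : Set (ℝ → ℝ) := {F | (∀ s t, |F s - F t| ≤ L * |s - t|) ∧ |F t₀| ≤ B} with hP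
  set S : Set C(ℝ, ℝ) := {F | (F : ℝ → ℝ) ∈ P} with hS
  have hLip : ∀ F : ℝ → ℝ, (∀ s t, |F s - F t| ≤ L * |s - t|) → LipschitzWith L.toNNReal F :=
    fun F hF => LipschitzWith.of_dist_le_mul fun s t => by
      rw [Real.dist_eq, Real.dist_eq]
      exact (hF s t).trans (mul_le_mul_of_nonneg_right (Real.le_coe_toNNReal L) (abs_nonneg _))
  have himage : ContinuousMap.toFun '' S = P := by
    ext F
    constructor
    · rintro ⟨G, hG, rfl⟩; exact hG
    · exact fun hF => ⟨⟨F, (hLip F hF.1).continuous⟩, hF, rfl⟩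
  have hPclosed : IsClosed P := by
    have : P = (⋂ s, ⋂ t, {F : ℝ → ℝ | |F s - F t| ≤ L * |s - t|}) ∩ {F | |F t₀| ≤ B} := by
      ext F; simp [hP]
    rw [this]
    refine IsClosed.inter (isClosed_iInter fun s => isClosed_iInter fun t => ?_) ?_
    · exact isClosed_le (by fun_prop) continuous_const
    · exact isClosed_le (by fun_prop) continuous_const
  have hcomp : IsCompact S := by
    refine ArzelaAscoli.isCompact_of_equicontinuous S ?_ ?_
    · rw [himage]
      refine IsCompact.of_isClosed_subset (isCompact_univ_pi fun t : ℝ =>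
        isCompact_Icc (a := -(B + L * |t - t₀|)) (b := B + L * |t - t₀|)) hPclosed ?_
      intro F hF t _
      have h1 := hF.1 t t₀
      have h2 := hF.2
      refine mem_Icc.2 (abs_le.1 ?_)
      calc |F t| = |(F t - F t₀) + F t₀| := by ring_nf
        _ ≤ |F t - F t₀| + |F t₀| := abs_add_le _ _
        _ ≤ _ := by linarith
    · exact (LipschitzWith.uniformEquicontinuous (K := L.toNNReal) (fun F : S => (F.1 : ℝ → ℝ))
        fun F => hLip _ F.2.1).equicontinuous
  obtain ⟨v, -, φ, hφ, hv⟩ := hcomp.tendsto_subseq (x := u) fun n => ⟨hL n, hB n⟩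
  exact ⟨v, φ, hφ, hv⟩

lemma Traj.abs_sub_le {q f u y : ℝ → ℝ} (h : Traj q f u y)
    (hq : ∀ s t, IntervalIntegrable q volume s t) {B : ℝ} {s t : ℝ} (hst : s ≤ t)
    (hf : ∀ x, |f x| ≤ B) : |y t - y s| ≤ B * ∫ x in s..t, |q x| := by
  rw [h.eq s t, show y s - (∫ x in s..t, q x * f x) - y s = -∫ x in s..t, q x * f x by ring,
    abs_neg, ← intervalIntegral.integral_const_mul]
  refine (intervalIntegral.abs_integral_le_integral_abs hst).trans ?_
  refine intervalIntegral.integral_mono_on hst (h.integrable s t).abs ((hq s t).abs.const_mul B)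
    fun x _ => ?_
  rw [abs_mul, mul_comm]
  exact mul_le_mul_of_nonneg_right (hf x) (abs_nonneg _)

/-- Pointwise limits of trajectories are trajectories. -/
theorem Traj.limit {q f v : ℝ → ℝ} {F U W : ℕ → ℝ → ℝ} (h : ∀ n, Traj q (F n) (U n) (W n))
    (hq : ∀ s t, IntervalIntegrable q volume s t) {B t₀ y₀ : ℝ} (hB : ∀ n x, |F n x| ≤ B)
    (hU : ∀ t, Tendsto (fun n => U n t) atTop (𝓝 (v t)))
    (hF : ∀ t, Tendsto (fun n => F n t) atTop (𝓝 (f t)))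
    (hW : Tendsto (fun n => W n t₀) atTop (𝓝 y₀)) :
    ∃ y, Traj q f v y ∧ ∀ t, Tendsto (fun n => W n t) atTop (𝓝 (y t)) := by
  have hbound : ∀ s t, ∀ n, ∀ᵐ x, x ∈ uIoc s t → ‖q x * F n x‖ ≤ B * |q x| := fun s t n =>
    ae_of_all _ fun x _ => by
      rw [Real.norm_eq_abs, abs_mul, mul_comm]
      exact mul_le_mul_of_nonneg_right (hB n x) (abs_nonneg _)
  have hii : ∀ s t, IntervalIntegrable (fun x => q x * f x) volume s t := by
    intro s t
    rw [intervalIntegrable_iff]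
    refine Integrable.mono' (g := fun x => B * |q x|)
      (intervalIntegrable_iff.1 ((hq s t).abs.const_mul B)) ?_ (ae_of_all _ fun x => ?_)
    · refine aestronglyMeasurable_of_tendsto_ae atTop (f := fun n x => q x * F n x)
        (fun n => (intervalIntegrable_iff.1 ((h n).integrable s t)).aestronglyMeasurable)
        (ae_of_all _ fun x => (hF x).const_mul (q x))
    · rw [Real.norm_eq_abs, abs_mul, mul_comm]
      exact mul_le_mul_of_nonneg_right (le_of_tendsto (hF x).abs (Eventually.of_forall
        fun n => hB n x)) (abs_nonneg _)
  have hlim : ∀ s t, Tendsto (fun n => ∫ x in s..t, q x * F n x) atTop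
      (𝓝 (∫ x in s..t, q x * f x)) := by
    intro s t
    refine intervalIntegral.tendsto_integral_filter_of_dominated_convergence (fun x => B * |q x|)
      (Eventually.of_forall fun n =>
        (intervalIntegrable_iff.1 ((h n).integrable s t)).aestronglyMeasurable)
      (Eventually.of_forall (hbound s t)) ((hq s t).abs.const_mul B)
      (ae_of_all _ fun x _ => (hF x).const_mul (q x))
  set y : ℝ → ℝ := fun t => y₀ - ∫ x in t₀..t, q x * f x with hy
  have hyc : Continuous y := continuous_const.sub (intervalIntegral.continuous_primitive hii t₀)
  have hWlim : ∀ t, Tendsto (fun n => W n t) atTop (𝓝 (y t)) := fun t => by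
    have : (fun n => W n t) = fun n => W n t₀ - ∫ x in t₀..t, q x * F n x :=
      funext fun n => (h n).eq t₀ t
    rw [this]
    exact hW.sub (hlim t₀ t)
  refine ⟨y, ⟨?_, hii, fun s t => ?_⟩, hWlim⟩
  · obtain ⟨Cy, hCy⟩ := hW.abs.bddAbove_range
    have hCy' : ∀ n, |W n t₀| ≤ Cy := fun n => hCy ⟨n, rfl⟩
    have hv : ∀ t, v t = v t₀ + ∫ x in t₀..t, y x := by
      intro t
      have h1 : Tendsto (fun n => ∫ x in t₀..t, W n x) atTop (𝓝 (∫ x in t₀..t, y x)) := by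
        refine intervalIntegral.tendsto_integral_filter_of_dominated_convergence
          (fun _ => Cy + |(∫ x in t₀..t, B * |q x|)|)
          (Eventually.of_forall fun n => (h n).continuous_y.aestronglyMeasurable)
          (Eventually.of_forall fun n => ae_of_all _ fun x hx => ?_)
          intervalIntegrable_const (ae_of_all _ fun x _ => hWlim x)
        rw [(h n).eq t₀ x, Real.norm_eq_abs]
        have h2 : |∫ x in t₀..x, q x * F n x| ≤ |(∫ x in t₀..t, B * |q x|)| := by
          refine (intervalIntegral.norm_integral_le_abs_of_norm_le (g := fun x => B * |q x|)
            ((ae_restrict_iff' measurableSet_uIoc).2 (hbound t₀ x n))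
            ((hq _ _).abs.const_mul B)).trans ?_
          refine intervalIntegral.abs_integral_mono_interval
            (uIoc_subset_uIoc_of_uIcc_subset_uIcc
              (uIcc_subset_uIcc left_mem_uIcc (uIoc_subset_uIcc hx))) (ae_of_all _ fun z => ?_)
            ((hq _ _).abs.const_mul B)
          exact mul_nonneg ((abs_nonneg _).trans (hB 0 0)) (abs_nonneg _)
        exact (abs_sub _ _).trans (add_le_add (hCy' n) h2)
      have h2 : ∀ n, U n t = U n t₀ + ∫ x in t₀..t, W n x := fun n => by
        rw [intervalIntegral.integral_eq_sub_of_hasDerivAt (fun x _ => (h n).deriv x)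
          ((h n).continuous_y.intervalIntegrable _ _)]
        ring
      refine tendsto_nhds_unique (hU t) ?_
      simp only [h2]
      exact (hU t₀).add h1
    intro t
    have hd : HasDerivAt (fun t => v t₀ + ∫ x in t₀..t, y x) (y t) t :=
      (intervalIntegral.integral_hasDerivAt_right (hyc.intervalIntegrable _ _)
        hyc.stronglyMeasurable.stronglyMeasurableAtFilter hyc.continuousAt).const_add _
    rwa [← funext hv] at hd
  · simp only [hy]
    rw [← intervalIntegral.integral_interval_sub_left (hii t₀ t) (hii t₀ s)]
    ring

end Limits

section PeriodicExtension

lemma intervalIntegral_congr_Ioo {f₁ f₂ : ℝ → ℝ} {a b : ℝ} (hab : a ≤ b)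
    (h : EqOn f₁ f₂ (Ioo a b)) : ∫ x in a..b, f₁ x = ∫ x in a..b, f₂ x := by
  refine intervalIntegral.integral_congr_ae ?_
  filter_upwards [(countable_singleton b).ae_notMem volume] with x hx hx'
  rw [uIoc_of_le hab] at hx'
  exact h ⟨hx'.1, lt_of_le_of_ne hx'.2 hx⟩

lemma traj_of_primitive {q f : ℝ → ℝ}
    (hii : ∀ s t, IntervalIntegrable (fun x => q x * f x) volume s t)
    (t₀ u₀ y₀ : ℝ) : ∃ u y, Traj q f u y ∧ y t₀ = y₀ ∧ ∀ t, u t = u₀ + ∫ x in t₀..t, y x := by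
  set y : ℝ → ℝ := fun t => y₀ - ∫ x in t₀..t, q x * f x with hy
  have hyc : Continuous y := continuous_const.sub (intervalIntegral.continuous_primitive hii t₀)
  refine ⟨fun t => u₀ + ∫ x in t₀..t, y x, y, ⟨fun t => ?_, hii, fun s t => ?_⟩, by simp [hy],
    fun t => rfl⟩
  · exact (intervalIntegral.integral_hasDerivAt_right (hyc.intervalIntegrable _ _)
        hyc.stronglyMeasurable.stronglyMeasurableAtFilter hyc.continuousAt).const_add _
  · simp only [hy]
    rw [← intervalIntegral.integral_interval_sub_left (hii t₀ t) (hii t₀ s)]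
    ring

/-- A trajectory with equal end states on a period of `q` extends to a periodic solution. -/
theorem Traj.exists_periodic_extension {q f g u y : ℝ → ℝ} (h : Traj q f u y) {P t₀ : ℝ}
    (hP : 0 < P) (hq : ∀ t, q (t + P) = q t) (hf : ∀ s ∈ Ico t₀ (t₀ + P), f s = g (u s))
    (hu : u (t₀ + P) = u t₀) (hy : y (t₀ + P) = y t₀) :
    ∃ v w, Traj q (fun t => g (v t)) v w ∧ (∀ t, v (t + P) = v t) ∧
      ∀ t ∈ Icc t₀ (t₀ + P), v t = u t := by
  set F : ℝ → ℝ := fun t => f (toIcoMod hP t₀ t) with hF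
  have hFf : ∀ t ∈ Ico t₀ (t₀ + P), F t = f t := fun t ht => by
    simp only [hF, (toIcoMod_eq_self hP).2 ht]
  have hper : Function.Periodic (fun x => q x * F x) P := fun t => by
    simp only [hF, toIcoMod_add_right, hq]
  have hii : ∀ s t, IntervalIntegrable (fun x => q x * F x) volume s t := by
    refine hper.intervalIntegrable hP.ne' (t := t₀) ((h.integrable t₀ (t₀ + P)).congr_uIoo ?_)
    intro x hx
    rw [uIoo_of_le (by linarith)] at hx
    simp only [hFf x ⟨hx.1.le, hx.2⟩]
  obtain ⟨v, w, hvw, hw₀, hv⟩ := traj_of_primitive hii t₀ (u t₀) (y t₀)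
  have hwy : ∀ t ∈ Icc t₀ (t₀ + P), w t = y t := fun t ht => by
    rw [hvw.eq t₀ t, h.eq t₀ t, hw₀, intervalIntegral_congr_Ioo ht.1 fun x hx => ?_]
    simp only [hFf x ⟨hx.1.le, hx.2.trans_le ht.2⟩]
  have hvu : ∀ t ∈ Icc t₀ (t₀ + P), v t = u t := fun t ht => by
    have h1 : ∫ x in t₀..t, w x = ∫ x in t₀..t, y x := intervalIntegral_congr_Ioo ht.1
      fun x hx => hwy x ⟨hx.1.le, hx.2.le.trans ht.2⟩
    rw [hv t, h1, intervalIntegral.integral_eq_sub_of_hasDerivAt (fun x _ => h.deriv x)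
          (h.continuous_y.intervalIntegrable _ _)]
    ring
  have hmem : t₀ + P ∈ Icc t₀ (t₀ + P) := right_mem_Icc.2 (by linarith)
  have hwper : Function.Periodic w P := fun t => by
    have h1 := hvw.eq t (t + P)
    have h2 := hvw.eq t₀ (t₀ + P)
    rw [hper.intervalIntegral_add_eq t t₀] at h1
    rw [hwy _ hmem, hy, hw₀] at h2
    linarith
  have hvper : Function.Periodic v P := fun t => by
    have h1 : ∀ s, v (s + P) - v s = ∫ x in s..s + P, w x := fun s =>
      (intervalIntegral.integral_eq_sub_of_hasDerivAt (fun x _ => hvw.deriv x)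
          (hvw.continuous_y.intervalIntegrable _ _)).symm
    have h2 := h1 t
    have h3 := h1 t₀
    rw [hwper.intervalIntegral_add_eq t t₀, ← h3, hvu _ hmem,
      hvu t₀ (left_mem_Icc.2 (by linarith)), hu] at h2
    linarith
  have hFv : F = fun t => g (v t) := by
    funext t
    have h1 := toIcoMod_mem_Ico hP t₀ t
    have h2 : v t = v (toIcoMod hP t₀ t) := by
      conv_lhs => rw [← toIcoMod_add_toIcoDiv_zsmul hP t₀ t]
      exact (hvper.zsmul _) _
    rw [h2, hvu _ (Ico_subset_Icc_self h1), ← hf _ h1]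
  exact ⟨v, w, hFv ▸ hvw, hvper, hvu⟩

end PeriodicExtension

section Exact

lemma continuous_sSup_image_Icc (a b : ℝ) :
    Continuous fun v : C(ℝ, ℝ) => sSup (v '' Icc a b) :=
  isCompact_Icc.continuous_sSup (f := fun (v : C(ℝ, ℝ)) t => v t) (by fun_prop)

lemma InBand.isClosed (r ρ R : ℝ) (c : Fin 3) : IsClosed {x | InBand r ρ R c x} := by
  have h : ∀ (p : Prop) (s : Set ℝ), IsClosed s → IsClosed {x | p → x ∈ s} := fun p s hs => by
    by_cases hp : p <;> simp [hp, hs]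
  exact (h _ _ isClosed_Iic).inter ((h _ _ isClosed_Icc).inter (h _ _ isClosed_Icc))

lemma Delay.tendsto {g v : ℝ → ℝ} {F U : ℕ → ℝ → ℝ} {h : ℕ → ℝ} {b b' L : ℝ} (hg : Continuous g)
    (hd : ∀ n, Delay g (U n) (F n) (h n) b b') (hh : Tendsto h atTop (𝓝 0))
    (hL : ∀ n s t, |U n s - U n t| ≤ L * |s - t|) {t : ℝ} (ht : t ∈ Ico b b')
    (hU : Tendsto (fun n => U n t) atTop (𝓝 (v t))) :
    Tendsto (fun n => F n t) atTop (𝓝 (g (v t))) := by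
  choose s hs hle hF using fun n => hd n t ht
  have hL0 : 0 ≤ L := by
    have := (abs_nonneg _).trans (hL 0 1 0)
    simpa using this
  have h1 : Tendsto (fun n => U n (s n) - U n t) atTop (𝓝 0) := by
    refine squeeze_zero_norm (a := fun n => L * h n) (fun n => ?_) (by simpa using hh.const_mul L)
    refine (hL n _ _).trans (mul_le_mul_of_nonneg_left ?_ hL0)
    rw [abs_sub_comm, abs_of_nonneg (sub_nonneg.2 (hs n).2)]
    linarith [hle n]
  have h2 : Tendsto (fun n => U n (s n)) atTop (𝓝 (v t)) := by simpa using h1.add hU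
  simpa only [hF, Function.comp_def] using (hg.tendsto (v t)).comp h2

namespace Setup

variable (E : Setup)

lemma le_of_le_on_pos {f u y : ℝ → ℝ} (H : Traj E.q f u y) (hf : ∀ t, 0 ≤ f t) {N : ℕ} {M : ℝ}
    (h0 : u (E.τ 0) ≤ M) (hM : ∀ j : ℕ, 1 ≤ j → j ≤ N → ∀ t ∈ Icc (E.σ j) (E.τ j), u t ≤ M) :
    ∀ t ∈ Icc (E.τ 0) (E.τ N), u t ≤ M := by
  have hend : ∀ j : ℕ, j ≤ N → u (E.τ j) ≤ M := fun j hj => by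
    rcases Nat.eq_zero_or_pos j with rfl | h
    · simpa using h0
    · exact hM j h hj _ (right_mem_Icc.2 (E.σ_lt j).le)
  intro t ht
  rcases ht.2.eq_or_lt with rfl | hlt
  · exact hend N le_rfl
  obtain ⟨k, -, hk, hk'⟩ := exists_grid_cell (t := fun k : ℕ => E.τ k) (Nat.zero_le N)
    (s := t) ⟨by simpa using ht.1, hlt⟩
  rcases le_total (E.σ (k + 1 : ℕ)) t with h | h
  · exact hM (k + 1) (by omega) hk t ⟨h, hk'.2.le⟩
  · have hq := E.q_nonpos (k + 1 : ℕ)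
    have hk1 : ((k + 1 : ℕ) : ℤ) - 1 = k := by push_cast; ring
    rw [hk1] at hq
    have hle : E.τ k ≤ E.σ (k + 1 : ℕ) := hk'.1.trans h
    refine ((H.convexOn hq hf).le_max_of_mem_Icc (left_mem_Icc.2 hle) (right_mem_Icc.2 hle)
      ⟨hk'.1, h⟩).trans (max_le (hend k hk.le) ?_)
    exact hM (k + 1) (by omega) hk _ (left_mem_Icc.2 (E.σ_lt _).le)

/-- Trajectories forced only on `[a, b)` have bounded velocity. -/
lemma abs_velocity_le {f u y : ℝ → ℝ} (H : Traj E.q f u y) {a b B Y₁ : ℝ} (hab : a ≤ b)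
    (hB : ∀ x, |f x| ≤ B) (hf : ∀ s, s ∉ Ico a b → f s = 0) (hy : |y a| ≤ Y₁) (t : ℝ) :
    |y t| ≤ Y₁ + B * ∫ x in a..b, |E.q x| := by
  have hB0 : 0 ≤ B := (abs_nonneg _).trans (hB 0)
  have key : ∀ t ∈ Icc a b, |y t| ≤ Y₁ + B * ∫ x in a..b, |E.q x| := fun t ht => by
    have h1 := H.abs_sub_le E.q_int ht.1 hB
    have h2 : ∫ x in a..t, |E.q x| ≤ ∫ x in a..b, |E.q x| :=
      intervalIntegral.integral_mono_interval le_rfl ht.1 ht.2 (ae_of_all _ fun x => abs_nonneg _)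
        (E.q_int _ _).abs
    have h3 := mul_le_mul_of_nonneg_left h2 hB0
    have h4 := abs_sub_abs_le_abs_sub (y t) (y a)
    linarith
  rcases lt_or_ge t a with h | h
  · have h1 := H.eq t a
    rw [intervalIntegral_congr_Ioo h.le (f₂ := fun _ => 0) fun x hx => by
      simp [hf x fun hx' => absurd hx'.1 (not_le.2 hx.2)]] at h1
    simp only [intervalIntegral.integral_zero, sub_zero] at h1
    rw [← h1]
    exact key a (left_mem_Icc.2 hab)
  rcases le_or_gt t b with h' | h'
  · exact key t ⟨h, h'⟩
  · have h1 := H.eq b t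
    rw [intervalIntegral_congr_Ioo h'.le (f₂ := fun _ => 0) fun x hx => by
      simp [hf x fun hx' => absurd hx'.2 (not_lt.2 hx.1.le)]] at h1
    simp only [intervalIntegral.integral_zero, sub_zero] at h1
    rw [h1]
    exact key b (right_mem_Icc.2 hab)

lemma lipschitz_of_velocity {q f u y : ℝ → ℝ} (H : Traj q f u y) {L : ℝ} (hy : ∀ t, |y t| ≤ L)
    (s t : ℝ) : |u s - u t| ≤ L * |s - t| := by
  have := convex_univ.norm_image_sub_le_of_norm_hasDerivWithin_le (f := u) (f' := y) (C := L)
    (fun x _ => (H.deriv x).hasDerivWithinAt) (fun x _ => hy x) (mem_univ t) (mem_univ s)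
  simpa using this

/-- Solutions on a finite chain of blocks with prescribed closed itinerary and equal end states. -/
theorem exists_closed_chain {N : ℕ} (hN : 1 ≤ N) (c : ℕ → Fin 3) (hcN : c N ≠ 0) :
    ∃ f u y : ℝ → ℝ, Traj E.q f u y ∧ (∀ s ∈ Ico (E.τ 0) (E.τ N), f s = E.g (u s)) ∧
      (∀ s ∈ Icc (E.τ 0) (E.τ N), 0 ≤ u s ∧ u s ≤ E.R) ∧
      (∀ j : ℕ, 1 ≤ j → j ≤ N →
        InBand E.r E.ρ E.R (c j) (sSup (u '' Icc (E.σ j) (E.τ j)))) ∧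
      u (E.τ N) = u (E.τ 0) ∧ y (E.τ N) = y (E.τ 0) := by
  obtain ⟨h₀, hh₀, H⟩ := E.exists_approx hN c hcN
  have hδ : ∀ n : ℕ, (0 : ℝ) < 1 / ((n : ℝ) + 2) ∧ 1 / ((n : ℝ) + 2) < 1 := fun n =>
    ⟨by positivity, by rw [div_lt_one (by positivity)]; linarith [n.cast_nonneg (α := ℝ)]⟩
  have hδ0 : Tendsto (fun n : ℕ => 1 / ((n : ℝ) + 2)) atTop (𝓝 0) :=
    tendsto_const_nhds.div_atTop (tendsto_natCast_atTop_atTop.atTop_add tendsto_const_nhds)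
  have hstep : ∀ n : ℕ, 0 < h₀ * (1 / ((n : ℝ) + 2)) ∧ h₀ * (1 / ((n : ℝ) + 2)) ≤ h₀ := fun n =>
    ⟨mul_pos hh₀ (hδ n).1, mul_le_of_le_one_right hh₀.le (hδ n).2.le⟩
  choose F U W hO hsupp hdel hpos hX hY hband hclose hclose' using fun n : ℕ =>
    H _ (hstep n).1 (hstep n).2 _ (hδ n).1 (hδ n).2
  have hRX : E.R ≤ E.X := by linarith [E.R_lt_X]
  have h0N : E.τ 0 ≤ E.τ N := E.τ_mono (by positivity)
  have hR : ∀ u : ℝ → ℝ, Continuous u → (∀ j : ℕ, 1 ≤ j → j ≤ N →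
      InBand E.r E.ρ E.R (c j) (sSup (u '' Icc (E.σ j) (E.τ j)))) →
      ∀ j : ℕ, 1 ≤ j → j ≤ N → ∀ t ∈ Icc (E.σ j) (E.τ j), u t ≤ E.R :=
          fun u hu hb j h1 h2 t ht => by
    obtain ⟨-, -, -, hle⟩ := exists_eq_sSup_Icc hu (E.σ_lt j).le
    exact (hle t ht).trans ((hb j h1 h2).le E.r_lt.le E.ρ_lt.le)
  have hUX : ∀ n, ∀ t ∈ Icc (E.τ 0) (E.τ N), U n t ≤ E.X := fun n =>
    E.le_of_le_on_pos (hO n).traj (hO n).f_nonneg (hX n) fun j h1 h2 t ht =>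
      (hR _ (hO n).traj.continuous (hband n) j h1 h2 t ht).trans hRX
  have hFB : ∀ n x, |F n x| ≤ E.C * E.X := fun n x => by
    rw [abs_of_nonneg ((hO n).f_nonneg x)]
    by_cases hx : x ∈ Ico (E.τ 0) (E.τ N)
    · obtain ⟨s, hs, -, h1⟩ := hdel n x hx
      have hs' : s ∈ Icc (E.τ 0) (E.τ N) := ⟨hs.1, hs.2.trans hx.2.le⟩
      rw [h1]
      exact (E.g_le _ (hpos n s hs')).trans (mul_le_mul_of_nonneg_left (hUX n s hs') E.C_nonneg)
    · rw [hsupp n x hx]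
      exact mul_nonneg E.C_nonneg E.X_pos.le
  set L := E.Y + E.C * E.X * ∫ x in (E.τ 0)..(E.τ N), |E.q x| with hLdef
  have hWL : ∀ n t, |W n t| ≤ L := fun n =>
    E.abs_velocity_le (hO n).traj h0N (hFB n) (hsupp n) (hY n)
  have hLip : ∀ n s t, |U n s - U n t| ≤ L * |s - t| := fun n =>
    lipschitz_of_velocity (hO n).traj (hWL n)
  set V : ℕ → C(ℝ, ℝ) := fun n => ⟨U n, (hO n).traj.continuous⟩ with hV
  obtain ⟨v, φ, hφ, hlim⟩ := exists_subseq_of_lipschitz (u := V) (t₀ := E.τ 0) (B := E.X) hLip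
    fun n => by
      have hm := left_mem_Icc.2 h0N
      exact abs_le.2 ⟨by linarith [hpos n _ hm, E.X_pos, show V n (E.τ 0) = U n (E.τ 0)
        from rfl], hX n⟩
  obtain ⟨y₀, -, ψ, hψ, hy₀⟩ := (isCompact_Icc (a := -E.Y) (b := E.Y)).tendsto_subseq
    (x := fun n => W (φ n) (E.τ 0)) fun n => abs_le.1 (hY (φ n))
  set κ : ℕ → ℕ := fun n => φ (ψ n) with hκ
  have hκt : Tendsto κ atTop atTop := (hφ.comp hψ).tendsto_atTop
  have hlim' : Tendsto (fun n => V (κ n)) atTop (𝓝 v) := hlim.comp hψ.tendsto_atTop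
  have hpt : ∀ t, Tendsto (fun n => U (κ n) t) atTop (𝓝 (v t)) := fun t =>
    ((continuous_eval_const (F := C(ℝ, ℝ)) t).tendsto v).comp hlim'
  classical
  set f : ℝ → ℝ := fun t => if t ∈ Ico (E.τ 0) (E.τ N) then E.g (v t) else 0 with hf
  have hFlim : ∀ t, Tendsto (fun n => F (κ n) t) atTop (𝓝 (f t)) := fun t => by
    by_cases ht : t ∈ Ico (E.τ 0) (E.τ N)
    · simp only [hf, if_pos ht]
      refine Delay.tendsto E.g_cont (fun n => hdel (κ n)) ?_ (fun n => hLip (κ n)) ht (hpt t)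
      simpa [Function.comp_def] using (hδ0.const_mul h₀).comp hκt
    · simp only [hf, if_neg ht, hsupp _ t ht]
      exact tendsto_const_nhds
  obtain ⟨y, hy, hWy⟩ := Traj.limit (fun n => (hO (κ n)).traj) E.q_int (fun n => hFB
    (κ n)) hpt hFlim hy₀
  have hband' : ∀ j : ℕ, 1 ≤ j → j ≤ N →
      InBand E.r E.ρ E.R (c j) (sSup (v '' Icc (E.σ j) (E.τ j))) := fun j h1 h2 =>
    (InBand.isClosed _ _ _ _).mem_of_tendsto
      (((continuous_sSup_image_Icc _ _).tendsto v).comp hlim')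
      (Eventually.of_forall fun n => hband (κ n) j h1 h2)
  have hp : ∀ s ∈ Icc (E.τ 0) (E.τ N), 0 ≤ v s := fun s hs =>
    ge_of_tendsto' (hpt s) fun n => hpos (κ n) s hs
  have hsub : v (E.τ N) - E.T * y (E.τ N) = v (E.τ 0) - E.T * y (E.τ 0) :=
    tendsto_nhds_unique ((hpt (E.τ N)).sub ((hWy (E.τ N)).const_mul E.T))
      (by simpa only [hclose] using (hpt (E.τ 0)).sub ((hWy (E.τ 0)).const_mul E.T))
  have hadd : |(v (E.τ N) + E.T * y (E.τ N)) - (v (E.τ 0) + E.T * y (E.τ 0))| ≤ 0 := by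
    refine le_of_tendsto_of_tendsto' (((hpt (E.τ N)).add ((hWy (E.τ N)).const_mul E.T)).sub
      ((hpt (E.τ 0)).add ((hWy (E.τ 0)).const_mul E.T))).abs ?_ fun n => hclose' (κ n)
    simpa using (hδ0.comp hκt).mul_const E.X
  have hadd' := sub_eq_zero.1 (abs_nonpos_iff.1 hadd)
  have hvN : v (E.τ N) = v (E.τ 0) := by linarith
  have hyN : y (E.τ N) = y (E.τ 0) := mul_left_cancel₀ E.T_pos.ne' (by linarith)
  have hfnn : ∀ t, 0 ≤ f t := fun t => by
    simp only [hf]; split_ifs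
    · exact E.g_nonneg _
    · exact le_rfl
  have hle := hR v v.continuous hband'
  refine ⟨f, v, y, hy, fun s hs => by simp only [hf, if_pos hs], fun s hs => ⟨hp s hs, ?_⟩, hband',
    hvN, hyN⟩
  refine E.le_of_le_on_pos hy hfnn ?_ hle s hs
  rw [← hvN]
  exact hle N hN le_rfl _ (right_mem_Icc.2 (E.σ_lt N).le)

end Setup

end Exact

section PeriodicSolutions

namespace Setup

variable (E : Setup)

/-- Renumbering of the blocks. -/
def shift (p : ℤ) : Setup where
  __ := E
  σ n := E.σ (n + p)
  τ n := E.τ (n + p)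
  σ_per n := by rw [add_right_comm]; exact E.σ_per _
  τ_per n := by rw [add_right_comm]; exact E.τ_per _
  σ_lt n := E.σ_lt _
  τ_lt n := by rw [sub_add_eq_add_sub]; exact E.τ_lt _
  len_pos n := E.len_pos _
  len_neg n := by rw [sub_add_eq_add_sub]; exact E.len_neg _
  d_le n := E.d_le _
  q_nonneg n := E.q_nonneg _
  q_nonpos n := by rw [sub_add_eq_add_sub]; exact E.q_nonpos _
  η_le n := E.η_le _
  core n := E.core _
  γ_big n := by rw [sub_add_eq_add_sub]; exact E.γ_big _

/-- Global solutions with values in `[0, R]`. -/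
structure Sol (u y : ℝ → ℝ) : Prop where
  traj : Traj E.q (fun t => E.g (u t)) u y
  nonneg : ∀ t, 0 ≤ u t
  le : ∀ t, u t ≤ E.R

lemma σ_add_mul (n l : ℤ) : E.σ (n + l * E.m) = E.σ n + l * E.T := by
  induction l using Int.induction_on with
  | zero => simp
  | succ i ih =>
    rw [show n + ((i : ℤ) + 1) * E.m = n + i * E.m + E.m by ring, E.σ_per, ih]
    push_cast; ring
  | pred i ih =>
    have := E.σ_per (n + (-(i : ℤ) - 1) * E.m)
    rw [show n + (-(i : ℤ) - 1) * E.m + E.m = n + -(i : ℤ) * E.m by ring, ih] at this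
    push_cast at this ⊢; linarith

lemma τ_add_mul (n l : ℤ) : E.τ (n + l * E.m) = E.τ n + l * E.T := by
  induction l using Int.induction_on with
  | zero => simp
  | succ i ih =>
    rw [show n + ((i : ℤ) + 1) * E.m = n + i * E.m + E.m by ring, E.τ_per, ih]
    push_cast; ring
  | pred i ih =>
    have := E.τ_per (n + (-(i : ℤ) - 1) * E.m)
    rw [show n + (-(i : ℤ) - 1) * E.m + E.m = n + -(i : ℤ) * E.m by ring, ih] at this
    push_cast at this ⊢; linarith

lemma sSup_image_of_periodic {u : ℝ → ℝ} {P : ℝ} (hu : Function.Periodic u P) (a b : ℝ) (l : ℤ) :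
    sSup (u '' Icc (a + l * P) (b + l * P)) = sSup (u '' Icc a b) := by
  have h : Icc (a + l * P) (b + l * P) = (fun t => t + l * P) '' Icc a b := by simp
  rw [h, image_image]
  simp only [hu.int_mul l _]

theorem exists_periodic_of_ne_zero {k : ℕ} (hk : 1 ≤ k) {c : ℤ → Fin 3}
    (hc : ∀ n, c (n + k * E.m) = c n) (hc0 : c 0 ≠ 0) :
    ∃ u y, E.Sol u y ∧ (∀ t, u (t + k * E.T) = u t) ∧
      ∀ n, InBand E.r E.ρ E.R (c n) (sSup (u '' Icc (E.σ n) (E.τ n))) := by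
  have hN : 1 ≤ k * E.m := Nat.mul_pos hk E.m_pos
  have hk0 : (0 : ℝ) < k := by exact_mod_cast hk
  have hP : 0 < k * E.T := mul_pos hk0 E.T_pos
  obtain ⟨f, u, y, hT, hf, hR, hband, hu, hy⟩ := E.exists_closed_chain hN (fun n => c n) (by
    have := hc 0
    rw [zero_add] at this
    push_cast
    rwa [this])
  have hτN : E.τ (k * E.m : ℕ) = E.τ 0 + k * E.T := by
    have := E.τ_add_mul 0 k
    rw [zero_add] at this
    push_cast at this ⊢
    exact this
  rw [hτN] at hf hR hu hy
  have hqper : Function.Periodic E.q (k * E.T) := by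
    have := Function.Periodic.nat_mul E.q_per k
    exact this
  obtain ⟨v, w, hvw, hper, hvu⟩ := hT.exists_periodic_extension hP hqper hf hu hy
  have hper' : Function.Periodic v (k * E.T) := hper
  have hbd : ∀ t, 0 ≤ v t ∧ v t ≤ E.R := fun t => by
    have h1 := Ico_subset_Icc_self (toIcoMod_mem_Ico hP (E.τ 0) t)
    have h2 : v t = v (toIcoMod hP (E.τ 0) t) := by
      conv_lhs => rw [← toIcoMod_add_toIcoDiv_zsmul hP (E.τ 0) t]
      exact (hper'.zsmul _) _
    rw [h2, hvu _ h1]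
    exact hR _ h1
  refine ⟨v, w, ⟨hvw, fun t => (hbd t).1, fun t => (hbd t).2⟩, hper, fun n => ?_⟩
  -- reduce to a block in the first period
  set M : ℤ := k * E.m with hM
  have hM0 : 0 < M := by
    have : (0 : ℤ) < ((k * E.m : ℕ) : ℤ) := by exact_mod_cast hN
    rwa [Nat.cast_mul] at this
  obtain ⟨j, l, hj1, hjN, hn⟩ : ∃ (j : ℕ) (l : ℤ), 1 ≤ j ∧ j ≤ k * E.m ∧ n = j + l * M := by
    have h1 := Int.emod_nonneg (n - 1) hM0.ne'
    have h2 := Int.emod_lt_of_pos (n - 1) hM0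
    have h3 := Int.emod_add_mul_ediv (n - 1) M
    refine ⟨((n - 1) % M).toNat + 1, (n - 1) / M, by omega, ?_, ?_⟩
    · zify
      rw [Int.toNat_of_nonneg h1, ← hM]
      omega
    · push_cast
      rw [Int.toNat_of_nonneg h1]
      linarith [mul_comm M ((n - 1) / M)]
  have hcn : c n = c j := by
    have : Function.Periodic c M := hc
    rw [hn]
    exact this.int_mul l j
  have hσn : E.σ n = E.σ j + l * (k * E.T) := by
    rw [hn, hM, ← mul_assoc, E.σ_add_mul]; push_cast; ring
  have hτn : E.τ n = E.τ j + l * (k * E.T) := by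
    rw [hn, hM, ← mul_assoc, E.τ_add_mul]; push_cast; ring
  rw [hcn, hσn, hτn, sSup_image_of_periodic hper']
  have himg : v '' Icc (E.σ j) (E.τ j) = u '' Icc (E.σ j) (E.τ j) := by
    refine image_congr fun t ht => hvu t ⟨?_, ?_⟩
    · have h1 := E.τ_lt j
      have h2 : E.τ 0 ≤ E.τ (j - 1) := E.τ_mono (by omega)
      linarith [ht.1]
    · rw [← hτN]
      exact ht.2.trans (E.τ_mono (by exact_mod_cast hjN))
  rw [himg]
  exact hband j hj1 hjN

/-- Every periodic itinerary is realised, in the closed sense, by a periodic solution. -/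
theorem exists_periodic {k : ℕ} (hk : 1 ≤ k) {c : ℤ → Fin 3} (hc : ∀ n, c (n + k * E.m) = c n) :
    ∃ u y, E.Sol u y ∧ (∀ t, u (t + k * E.T) = u t) ∧
      ∀ n, InBand E.r E.ρ E.R (c n) (sSup (u '' Icc (E.σ n) (E.τ n))) := by
  by_cases h : ∃ p, c p ≠ 0
  · obtain ⟨p, hp⟩ := h
    obtain ⟨u, y, hs, hper, hband⟩ := (E.shift p).exists_periodic_of_ne_zero hk
      (c := fun n => c (n + p)) (fun n => by
        have := hc (n + p)
        rw [add_right_comm] at this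
        exact this) (by simpa using hp)
    refine ⟨u, y, ⟨hs.traj, hs.nonneg, hs.le⟩, hper, fun n => ?_⟩
    have := hband (n - p)
    simpa [shift] using this
  · push Not at h
    refine ⟨fun _ => 0, fun _ => 0, ⟨⟨fun t => hasDerivAt_const t 0, ?_, ?_⟩, fun _ => le_rfl,
      fun _ => E.R_pos.le⟩, fun _ => rfl, fun n => ?_⟩
    · simp [E.g_neg 0 le_rfl]
    · simp [E.g_neg 0 le_rfl]
    · rw [h n, (nonempty_Icc.2 (E.σ_lt n).le).image_const, csSup_singleton]
      simp [InBand, E.r_pos.le]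

end Setup

end PeriodicSolutions

section Coding

namespace Setup

namespace Sol

variable {E : Setup} {u y : ℝ → ℝ} (S : E.Sol u y)
include S

lemma orbit : E.Orbit 0 univ (fun t => E.g (u t)) u y where
  traj := S.traj
  f_nonneg _ := E.g_nonneg _
  h_le := by linarith [E.d_pos]
  delay_pos _ _ s hs := ⟨s, right_mem_Icc.2 hs.1, by simp, rfl⟩
  delay_neg _ _ s hs := ⟨s, right_mem_Icc.2 hs.1, by simp, rfl⟩

lemma sSup_ne_level {c : ℝ} (hc : c = E.r ∨ c = E.R) (n : ℤ) :
    sSup (u '' Icc (E.σ n) (E.τ n)) ≠ c := by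
  intro hmax
  obtain ⟨t, ht, hut, hle⟩ := exists_eq_sSup_Icc S.traj.continuous (E.σ_lt n).le
  rw [hmax] at hut hle
  have hvel := S.orbit.velocity_ge (mem_univ (n - 1)) (S.nonneg _) fun s _ => S.le s
  obtain ⟨h1, h2⟩ := S.orbit.level (mem_univ n) hc (by linarith [E.Y₀_le_Y])
    (by linarith [S.le (E.τ (n - 1)), E.R_lt_X]) hle ht hut
  obtain ⟨s, -, hs⟩ := S.orbit.exists_gt_next (mem_univ (n + 1)) hc
    (by rwa [add_sub_cancel_right]) (by rwa [add_sub_cancel_right])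
    (by rw [add_sub_cancel_right]; exact hle _ (right_mem_Icc.2 (E.σ_lt n).le))
  exact absurd (S.le s) (not_le.2 hs)

lemma sSup_ne_rho (n : ℤ) : sSup (u '' Icc (E.σ n) (E.τ n)) ≠ E.ρ := by
  intro hmax
  obtain ⟨t, ht, hut, hle⟩ := exists_eq_sSup_Icc S.traj.continuous (E.σ_lt n).le
  rw [hmax] at hut hle
  exact S.orbit.not_max_rho (mem_univ n) (fun s _ => S.nonneg s) hle ht hut

lemma sSup_lt (n : ℤ) : sSup (u '' Icc (E.σ n) (E.τ n)) < E.R := by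
  obtain ⟨t, -, hut, -⟩ := exists_eq_sSup_Icc S.traj.continuous (E.σ_lt n).le
  exact lt_of_le_of_ne (hut ▸ S.le t) (S.sSup_ne_level (Or.inr rfl) n)

lemma trichotomy (n : ℤ) : sSup (u '' Icc (E.σ n) (E.τ n)) < E.r ∨
    (E.r < sSup (u '' Icc (E.σ n) (E.τ n)) ∧ sSup (u '' Icc (E.σ n) (E.τ n)) < E.ρ) ∨
    (E.ρ < sSup (u '' Icc (E.σ n) (E.τ n)) ∧ sSup (u '' Icc (E.σ n) (E.τ n)) < E.R) := by
  rcases lt_or_gt_of_ne (S.sSup_ne_level (Or.inl rfl) n) with h | h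
  · exact Or.inl h
  rcases lt_or_gt_of_ne (S.sSup_ne_rho n) with h' | h'
  · exact Or.inr (Or.inl ⟨h, h'⟩)
  · exact Or.inr (Or.inr ⟨h', S.sSup_lt n⟩)

lemma abs_velocity_le (t : ℝ) : |y t| ≤ E.R / E.T + E.C * E.R * ∫ x in (0 : ℝ)..E.T, |E.q x| := by
  have hT := E.T_pos
  obtain ⟨s, hs, hys⟩ := exists_hasDerivAt_eq_slope u y (show t < t + E.T by linarith)
    S.traj.continuous.continuousOn fun x _ => S.traj.deriv x
  have h1 : |y s| ≤ E.R / E.T := by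
    rw [hys, add_sub_cancel_left, abs_div, abs_of_pos hT]
    refine div_le_div_of_nonneg_right (abs_le.2 ⟨?_, ?_⟩) hT.le <;>
      linarith [S.nonneg t, S.nonneg (t + E.T), S.le t, S.le (t + E.T)]
  have hB : ∀ x, |E.g (u x)| ≤ E.C * E.R := fun x => by
    rw [abs_of_nonneg (E.g_nonneg _)]
    exact (E.g_le _ (S.nonneg x)).trans (mul_le_mul_of_nonneg_left (S.le x) E.C_nonneg)
  have h2 := S.traj.abs_sub_le E.q_int hs.1.le hB
  have h3 : ∫ x in t..s, |E.q x| ≤ ∫ x in t..(t + E.T), |E.q x| :=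
    intervalIntegral.integral_mono_interval le_rfl hs.1.le hs.2.le
      (ae_of_all _ fun x => abs_nonneg _) (E.q_int _ _).abs
  have hper : Function.Periodic (fun x => |E.q x|) E.T := fun x => by simp only [E.q_per]
  rw [hper.intervalIntegral_add_eq t 0, zero_add] at h3
  have h4 := mul_le_mul_of_nonneg_left h3 (mul_nonneg E.C_nonneg E.R_pos.le)
  have h5 := abs_sub_abs_le_abs_sub (y t) (y s)
  rw [abs_sub_comm] at h5
  linarith

end Sol

variable (E : Setup)

/-- Every itinerary is realised, in the closed sense, by a global solution. -/
theorem exists_sol (c : ℤ → Fin 3) :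
    ∃ u y, E.Sol u y ∧ ∀ n, InBand E.r E.ρ E.R (c n) (sSup (u '' Icc (E.σ n) (E.τ n))) := by
  have hm : (1 : ℤ) ≤ E.m := by exact_mod_cast E.m_pos
  set p : ℕ → ℤ := fun k => ((2 * k + 1 : ℕ) : ℤ) * E.m with hp
  set ck : ℕ → ℤ → Fin 3 := fun k n => c ((n + k * E.m) % p k - k * E.m) with hck
  have hckc : ∀ (k : ℕ) (n : ℤ), |n| ≤ (k : ℤ) → ck k n = c n := fun k n hn => by
    have h1 := abs_le.1 hn
    have h2 : (k : ℤ) ≤ k * E.m := le_mul_of_one_le_right (by positivity) hm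
    have h3 : (n + k * E.m) % p k = n + k * E.m := by
      refine Int.emod_eq_of_lt (by linarith) ?_
      simp only [hp]
      push_cast
      linarith [show (2 * (k : ℤ) + 1) * E.m = k * E.m + k * E.m + E.m by ring]
    simp only [hck, h3, add_sub_cancel_right]
  choose U W hS _ hband using fun k : ℕ => E.exists_periodic (k := 2 * k + 1) (by omega) (c := ck k)
    (fun n => by
      simp only [hck]
      rw [show n + ((2 * k + 1 : ℕ) : ℤ) * E.m + k * E.m = n + k * E.m + p k
        by simp only [hp]; ring,
        Int.add_emod_right])
  set L := E.R / E.T + E.C * E.R * ∫ x in (0 : ℝ)..E.T, |E.q x| with hL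
  set V : ℕ → C(ℝ, ℝ) := fun n => ⟨U n, (hS n).traj.continuous⟩ with hV
  obtain ⟨v, φ, hφ, hlim⟩ := exists_subseq_of_lipschitz (u := V) (t₀ := 0) (B := E.R)
    (fun n => lipschitz_of_velocity (hS n).traj (L := L) (hS n).abs_velocity_le)
    fun n => abs_le.2 ⟨(neg_nonpos.2 E.R_pos.le).trans ((hS n).nonneg 0), (hS n).le 0⟩
  obtain ⟨y₀, -, ψ, hψ, hy₀⟩ := (isCompact_Icc (a := -L) (b := L)).tendsto_subseq
    (x := fun n => W (φ n) 0) fun n => abs_le.1 ((hS (φ n)).abs_velocity_le 0)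
  set κ : ℕ → ℕ := fun n => φ (ψ n) with hκ
  have hκt : Tendsto κ atTop atTop := (hφ.comp hψ).tendsto_atTop
  have hlim' : Tendsto (fun n => V (κ n)) atTop (𝓝 v) := hlim.comp hψ.tendsto_atTop
  have hpt : ∀ t, Tendsto (fun n => U (κ n) t) atTop (𝓝 (v t)) := fun t =>
    ((continuous_eval_const (F := C(ℝ, ℝ)) t).tendsto v).comp hlim'
  obtain ⟨y, hy, -⟩ := Traj.limit (fun n => (hS (κ n)).traj) E.q_int (B := E.C * E.R)
    (fun n x => by
      rw [abs_of_nonneg (E.g_nonneg _)]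
      exact (E.g_le _ ((hS _).nonneg x)).trans
        (mul_le_mul_of_nonneg_left ((hS _).le x) E.C_nonneg))
    hpt (fun t => (E.g_cont.tendsto (v t)).comp (hpt t)) hy₀
  refine ⟨v, y, ⟨hy, fun t => ge_of_tendsto' (hpt t) fun n => (hS _).nonneg t,
    fun t => le_of_tendsto' (hpt t) fun n => (hS _).le t⟩, fun n => ?_⟩
  refine (InBand.isClosed _ _ _ _).mem_of_tendsto
    (((continuous_sSup_image_Icc _ _).tendsto v).comp hlim') ?_
  filter_upwards [hκt.eventually_ge_atTop n.natAbs] with k hk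
  have := hband (κ k) n
  rwa [hckc (κ k) n (by rw [Int.abs_eq_natAbs]; exact_mod_cast hk)] at this

end Setup

end Coding

section Semiconjugacy

lemma continuous_codeSup (σ τ : ℕ → ℝ) (T : ℝ) (i : ℕ) (ℓ : ℤ) :
    Continuous fun z => codeSup σ τ T z i ℓ :=
  isCompact_Icc.continuous_sSup (f := fun (z : C(ℝ, ℝ × ℝ)) t => (z t).1)
    (by simp only [Function.HasUncurry.uncurry, id]; fun_prop)

lemma codeSup_comp_add (σ τ : ℕ → ℝ) (T : ℝ) (z : C(ℝ, ℝ × ℝ)) (hT : Continuous fun t => t + T)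
    (i : ℕ) (ℓ : ℤ) :
    codeSup σ τ T (z.comp ⟨fun t => t + T, hT⟩) i ℓ = codeSup σ τ T z i (ℓ + 1) := by
  have h : Icc (σ i + (ℓ + 1 : ℤ) * T) (τ i + (ℓ + 1 : ℤ) * T) =
      (fun t => t + T) '' Icc (σ i + ℓ * T) (τ i + ℓ * T) := by
    rw [image_add_const_Icc]; push_cast; congr 1 <;> ring
  rw [codeSup, codeSup, h, image_image]
  rfl

namespace Setup

variable (E : Setup)

lemma sol_iff (z : C(ℝ, ℝ × ℝ)) : E.Sol (fun t => (z t).1) (fun t => (z t).2) ↔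
    (∀ t, HasDerivAt (fun s => (z s).1) ((z t).2) t) ∧
    (∀ t₀ t : ℝ, (z t).2 = (z t₀).2 - ∫ s in t₀..t, E.q s * E.g ((z s).1)) ∧
    ∀ t, 0 ≤ (z t).1 ∧ (z t).1 ≤ E.R := by
  refine ⟨fun S => ⟨S.traj.deriv, S.traj.eq, fun t => ⟨S.nonneg t, S.le t⟩⟩, fun ⟨h1, h2, h3⟩ =>
    ⟨⟨h1, fun s t => ?_, h2⟩, fun t => (h3 t).1, fun t => (h3 t).2⟩⟩
  exact (E.q_int s t).mul_continuousOn
    (E.g_cont.comp (continuous_fst.comp z.continuous)).continuousOn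

lemma Sol.comp_add {E : Setup} {u y : ℝ → ℝ} (S : E.Sol u y) :
    E.Sol (fun t => u (t + E.T)) (fun t => y (t + E.T)) where
  traj := {
    deriv t := (S.traj.deriv (t + E.T)).comp_add_const t E.T
    integrable s t := (E.q_int s t).mul_continuousOn (E.g_cont.comp
      (S.traj.continuous.comp (continuous_id.add continuous_const))).continuousOn
    eq s t := by
      rw [S.traj.eq (s + E.T) (t + E.T),
        ← intervalIntegral.integral_comp_add_right (fun x => E.q x * E.g (u x)) E.T]
      simp only [E.q_per] }
  nonneg t := S.nonneg _
  le t := S.le _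

/-- Itinerary indexed by blocks associated with an itinerary indexed by periods. -/
def blockCode (s : ℤ → Fin E.m → Fin 3) (n : ℤ) : Fin 3 :=
  s (n / E.m) ⟨(n % E.m).toNat, by
    have hm : (0 : ℤ) < E.m := by exact_mod_cast E.m_pos
    have := Int.emod_nonneg n hm.ne'
    have := Int.emod_lt_of_pos n hm
    omega⟩

lemma blockCode_apply (s : ℤ → Fin E.m → Fin 3) (ℓ : ℤ) (i : Fin E.m) :
    E.blockCode s (i + ℓ * E.m) = s ℓ i := by
  have hm : (0 : ℤ) < E.m := by exact_mod_cast E.m_pos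
  have hi : ((i : ℕ) : ℤ) < E.m := by exact_mod_cast i.2
  have h1 : ((i : ℕ) + ℓ * E.m : ℤ) / E.m = ℓ := by
    rw [Int.add_mul_ediv_right _ _ hm.ne', Int.ediv_eq_zero_of_lt (by positivity) hi, zero_add]
  have h2 : ((i : ℕ) + ℓ * E.m : ℤ) % E.m = (i : ℕ) := by
    rw [Int.add_mul_emod_self_right, Int.emod_eq_of_lt (by positivity) hi]
  simp only [blockCode, h1, h2, Int.toNat_natCast]

lemma blockCode_periodic {s : ℤ → Fin E.m → Fin 3} {k : ℕ} (hs : ∀ ℓ, s (ℓ + k) = s ℓ) (n : ℤ) :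
    E.blockCode s (n + k * E.m) = E.blockCode s n := by
  have hm : (0 : ℤ) < E.m := by exact_mod_cast E.m_pos
  simp only [blockCode, Int.add_mul_ediv_right _ _ hm.ne', Int.add_mul_emod_self_right, hs]

/-- The coding of the solutions by their maxima on the positivity intervals. -/
theorem semiconjugacy {σ τ : ℕ → ℝ}
    (hσ : ∀ i < E.m, ∀ ℓ : ℤ, E.σ (i + ℓ * E.m) = σ (i + 1) + ℓ * E.T)
    (hτ : ∀ i < E.m, ∀ ℓ : ℤ, E.τ (i + ℓ * E.m) = τ (i + 1) + ℓ * E.T)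
    {Y : Set C(ℝ, ℝ × ℝ)} (hY : ∀ z, z ∈ Y ↔ E.Sol (fun t => (z t).1) (fun t => (z t).2)) :
    (∀ z ∈ Y, ∀ i, 1 ≤ i → i ≤ E.m → ∀ ℓ : ℤ,
      codeSup σ τ E.T z i ℓ < E.r ∨
      (E.r < codeSup σ τ E.T z i ℓ ∧ codeSup σ τ E.T z i ℓ < E.ρ) ∨
      (E.ρ < codeSup σ τ E.T z i ℓ ∧ codeSup σ τ E.T z i ℓ < E.R)) ∧
    ∃ π : Y → (ℤ → Fin E.m → Fin 3),
      (∀ z : Y, ∀ ℓ : ℤ, ∀ i : Fin E.m,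
        (π z ℓ i = 0 ↔ codeSup σ τ E.T z.1 (i.1 + 1) ℓ < E.r) ∧
        (π z ℓ i = 1 ↔ E.r < codeSup σ τ E.T z.1 (i.1 + 1) ℓ ∧
          codeSup σ τ E.T z.1 (i.1 + 1) ℓ < E.ρ) ∧
        (π z ℓ i = 2 ↔ E.ρ < codeSup σ τ E.T z.1 (i.1 + 1) ℓ ∧
          codeSup σ τ E.T z.1 (i.1 + 1) ℓ < E.R)) ∧
      Continuous π ∧
      Function.Surjective π ∧
      (∀ z : Y, ∃ hz : (z.1.comp ⟨fun t => t + E.T, by continuity⟩) ∈ Y,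
        π ⟨z.1.comp ⟨fun t => t + E.T, by continuity⟩, hz⟩ = fun ℓ => π z (ℓ + 1)) ∧
      (∀ k : ℕ, 1 ≤ k → ∀ s : ℤ → Fin E.m → Fin 3, (∀ ℓ, s (ℓ + k) = s ℓ) →
        ∃ z : Y, π z = s ∧ ∀ t : ℝ, (z.1 (t + k * E.T)).1 = (z.1 t).1) := by
  have hrρ := E.r_lt
  have hρR := E.ρ_lt
  have hcode : ∀ (z : C(ℝ, ℝ × ℝ)) (i : ℕ), i < E.m → ∀ ℓ : ℤ, codeSup σ τ E.T z (i + 1) ℓ =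
      sSup ((fun t => (z t).1) '' Icc (E.σ (i + ℓ * E.m)) (E.τ (i + ℓ * E.m))) := fun z i hi ℓ => by
    rw [hσ i hi, hτ i hi, codeSup]
  have htri : ∀ z ∈ Y, ∀ i < E.m, ∀ ℓ : ℤ,
      codeSup σ τ E.T z (i + 1) ℓ < E.r ∨
      (E.r < codeSup σ τ E.T z (i + 1) ℓ ∧ codeSup σ τ E.T z (i + 1) ℓ < E.ρ) ∨
      (E.ρ < codeSup σ τ E.T z (i + 1) ℓ ∧ codeSup σ τ E.T z (i + 1) ℓ < E.R) :=
          fun z hz i hi ℓ => by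
    rw [hcode z i hi ℓ]
    exact ((hY z).1 hz).trichotomy _
  classical
  set π : Y → (ℤ → Fin E.m → Fin 3) := fun z ℓ i =>
    if codeSup σ τ E.T z.1 (i.1 + 1) ℓ < E.r then 0 else
      if codeSup σ τ E.T z.1 (i.1 + 1) ℓ < E.ρ then 1 else 2 with hπdef
  have hπ : ∀ z : Y, ∀ ℓ : ℤ, ∀ i : Fin E.m,
        (π z ℓ i = 0 ↔ codeSup σ τ E.T z.1 (i.1 + 1) ℓ < E.r) ∧
        (π z ℓ i = 1 ↔ E.r < codeSup σ τ E.T z.1 (i.1 + 1) ℓ ∧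
          codeSup σ τ E.T z.1 (i.1 + 1) ℓ < E.ρ) ∧
        (π z ℓ i = 2 ↔ E.ρ < codeSup σ τ E.T z.1 (i.1 + 1) ℓ ∧
          codeSup σ τ E.T z.1 (i.1 + 1) ℓ < E.R) := by
    intro z ℓ i
    simp only [hπdef]
    rcases htri z.1 z.2 i i.2 ℓ with h | ⟨h, h'⟩ | ⟨h, h'⟩
    · simp [h, h.not_gt, (h.trans hrρ).not_gt]
    · simp [h, h', h.not_gt, h'.not_gt]
    · simp [h, h', h.not_gt, (hrρ.trans h).not_gt]
  have hπ_of_band : ∀ (s : ℤ → Fin E.m → Fin 3) (z : Y), (∀ n, InBand E.r E.ρ E.R (E.blockCode s n)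
      (sSup ((fun t => (z.1 t).1) '' Icc (E.σ n) (E.τ n)))) → π z = s := by
    intro s z hb
    funext ℓ i
    have h1 := hb (i + ℓ * E.m)
    rw [← hcode z.1 i i.2 ℓ, E.blockCode_apply] at h1
    obtain ⟨h2, h3, h4⟩ := h1
    have hz := hπ z ℓ i
    have ht := htri z.1 z.2 i i.2 ℓ
    generalize codeSup σ τ E.T z.1 (i.1 + 1) ℓ = x at *
    obtain h | h | h : s ℓ i = 0 ∨ s ℓ i = 1 ∨ s ℓ i = 2 := by
      generalize s ℓ i = c; fin_cases c <;> simp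
    · rw [h, hz.1]
      have := h2 h
      rcases ht with ht | ht | ht
      · exact ht
      · linarith [ht.1]
      · linarith [ht.1]
    · rw [h, hz.2.1]
      have := h3 h
      rcases ht with ht | ht | ht
      · linarith
      · exact ht
      · linarith [ht.1]
    · rw [h, hz.2.2]
      have := h4 h
      rcases ht with ht | ht | ht
      · linarith
      · linarith [ht.2]
      · exact ht
  have hlift : ∀ {u y : ℝ → ℝ} (S : E.Sol u y), ∃ z : Y, ∀ t, z.1 t = (u t, y t) := fun {u y} S =>
    ⟨⟨⟨fun t => (u t, y t), S.traj.continuous.prodMk S.traj.continuous_y⟩, (hY _).2 S⟩,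
      fun _ => rfl⟩
  refine ⟨fun z hz i h1 h2 ℓ => ?_, π, hπ, ?_, fun s => ?_, fun z => ?_, fun k hk s hs => ?_⟩
  · obtain ⟨j, rfl⟩ := Nat.exists_eq_add_of_le' h1
    exact htri z hz j (by omega) ℓ
  · refine continuous_pi fun ℓ => continuous_pi fun i => continuous_discrete_rng.2 fun c => ?_
    have hc : Continuous fun z : Y => codeSup σ τ E.T z.1 (i.1 + 1) ℓ :=
      (continuous_codeSup σ τ E.T (i.1 + 1) ℓ).comp continuous_subtype_val
    obtain rfl | rfl | rfl : c = 0 ∨ c = 1 ∨ c = 2 := by fin_cases c <;> simp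
    · rw [show (fun z : Y => π z ℓ i) ⁻¹' {0} = _ from ext fun z => (hπ z ℓ i).1]
      exact isOpen_lt hc continuous_const
    · rw [show (fun z : Y => π z ℓ i) ⁻¹' {1} = _ from ext fun z => (hπ z ℓ i).2.1]
      exact (isOpen_lt continuous_const hc).inter (isOpen_lt hc continuous_const)
    · rw [show (fun z : Y => π z ℓ i) ⁻¹' {2} = _ from ext fun z => (hπ z ℓ i).2.2]
      exact (isOpen_lt continuous_const hc).inter (isOpen_lt hc continuous_const)
  · obtain ⟨u, y, S, hb⟩ := E.exists_sol (E.blockCode s)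
    obtain ⟨z, hz⟩ := hlift S
    exact ⟨z, hπ_of_band s z (by simpa only [hz] using hb)⟩
  · refine ⟨(hY _).2 ((hY _).1 z.2).comp_add, ?_⟩
    funext ℓ i
    simp only [hπdef, codeSup_comp_add]
  · obtain ⟨u, y, S, hper, hb⟩ := E.exists_periodic hk (E.blockCode_periodic hs)
    obtain ⟨z, hz⟩ := hlift S
    exact ⟨z, hπ_of_band s z (by simpa only [hz] using hb), by simpa only [hz] using hper⟩

end Setup

end Semiconjugacy

section Nonlinearity

variable {g : ℝ → ℝ}

lemma continuous_of_zero_on_neg (hg_cont : ContinuousOn g (Ici 0)) (hg_neg : ∀ s ≤ 0, g s = 0) :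
    Continuous g := by
  have h : g = fun s => g (max s 0) := funext fun s => by
    rcases le_total s 0 with hs | hs
    · rw [max_eq_right hs, hg_neg s hs, hg_neg 0 le_rfl]
    · rw [max_eq_left hs]
  rw [h]
  exact hg_cont.comp_continuous (by fun_prop) fun s => le_max_right s 0

lemma exists_pos_lower_bound (hg : Continuous g) (hg_pos : ∀ s, 0 < s → 0 < g s) {x y : ℝ}
    (hx : 0 < x) (hxy : x ≤ y) : ∃ γ > 0, ∀ s ∈ Icc x y, γ ≤ g s := by
  obtain ⟨s, hs, hmin⟩ := isCompact_Icc.exists_isMinOn (nonempty_Icc.2 hxy) hg.continuousOn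
  exact ⟨g s, hg_pos s (hx.trans_le hs.1), fun t ht => hmin ht⟩

lemma exists_upper_bound (hg : Continuous g) (hg_neg : ∀ s ≤ 0, g s = 0) (K : ℝ) :
    ∃ M ≥ 0, ∀ s ≤ K, g s ≤ M := by
  obtain ⟨M, hM⟩ := (isCompact_Icc (a := 0) (b := K)).bddAbove_image hg.continuousOn
  refine ⟨max M 0, le_max_right _ _, fun s hs => ?_⟩
  rcases le_total s 0 with h | h
  · rw [hg_neg s h]; exact le_max_right _ _
  · exact (hM ⟨s, ⟨h, hs⟩, rfl⟩).trans (le_max_left _ _)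

lemma exists_small_near_zero (hg0 : Tendsto (fun s => g s / s) (𝓝[>] 0) (𝓝 0))
    {η : ℝ} (hη : 0 < η) :
    ∃ δ > 0, ∀ s, 0 < s → s ≤ δ → g s ≤ η * s := by
  obtain ⟨δ, hδ, h⟩ := mem_nhdsGT_iff_exists_Ioc_subset.1 (hg0.eventually (gt_mem_nhds hη))
  exact ⟨δ, hδ, fun s h1 h2 => (div_le_iff₀ h1).1 (h ⟨h1, h2⟩).le⟩

lemma exists_small_at_top (hginf : Tendsto (fun s => g s / s) atTop (𝓝 0)) {η : ℝ} (hη : 0 < η) :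
    ∃ K > 0, ∀ s, K ≤ s → g s ≤ η * s := by
  obtain ⟨K, h⟩ := eventually_atTop.1 (hginf.eventually (gt_mem_nhds hη))
  refine ⟨max K 1, by positivity, fun s hs => ?_⟩
  have h1 : 0 < s := by linarith [le_max_right K 1]
  exact (div_le_iff₀ h1).1 (h s ((le_max_left _ _).trans hs)).le

lemma exists_linear_bound (hg : Continuous g) (hg_neg : ∀ s ≤ 0, g s = 0)
    (hg0 : Tendsto (fun s => g s / s) (𝓝[>] 0) (𝓝 0))
    (hginf : Tendsto (fun s => g s / s) atTop (𝓝 0)) : ∃ C, ∀ s, 0 ≤ s → g s ≤ C * s := by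
  obtain ⟨δ, hδ, h0⟩ := exists_small_near_zero hg0 one_pos
  obtain ⟨K, -, hK⟩ := exists_small_at_top hginf one_pos
  obtain ⟨M, hM0, hM⟩ := exists_upper_bound hg hg_neg K
  refine ⟨1 + M / δ, fun s hs => ?_⟩
  have h1 : 0 ≤ M / δ * s := by positivity
  rw [add_mul]
  rcases hs.eq_or_lt with rfl | hs'
  · simp [hg_neg 0 le_rfl]
  rcases le_total s δ with h | h
  · linarith [h0 s hs' h]
  rcases le_total K s with h' | h'
  · linarith [hK s h']
  · have h2 : M / δ * δ ≤ M / δ * s := mul_le_mul_of_nonneg_left h (by positivity)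
    rw [div_mul_cancel₀ _ hδ.ne'] at h2
    linarith [hM s h']

lemma exists_small_level (hg_neg : ∀ s ≤ 0, g s = 0)
    (hg0 : Tendsto (fun s => g s / s) (𝓝[>] 0) (𝓝 0)) {η ρ : ℝ} (hη : 0 < η) (hρ : 0 < ρ) :
    ∃ r, 0 < r ∧ r < ρ ∧ ∀ s ≤ r, g s ≤ η * r := by
  obtain ⟨δ, hδ, h⟩ := exists_small_near_zero hg0 hη
  refine ⟨min δ (ρ / 2), by positivity, (min_le_right _ _).trans_lt (by linarith), fun s hs => ?_⟩
  rcases le_or_gt s 0 with h0 | h0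
  · rw [hg_neg s h0]; positivity
  · exact (h s h0 (hs.trans (min_le_left _ _))).trans (mul_le_mul_of_nonneg_left hs hη.le)

lemma exists_large_level (hg : Continuous g) (hg_neg : ∀ s ≤ 0, g s = 0)
    (hginf : Tendsto (fun s => g s / s) atTop (𝓝 0)) {η ρ : ℝ} (hη : 0 < η) :
    ∃ R, ρ < R ∧ ∀ s ≤ R, g s ≤ η * R := by
  obtain ⟨K, -, hK⟩ := exists_small_at_top hginf hη
  obtain ⟨M, hM0, hM⟩ := exists_upper_bound hg hg_neg K
  refine ⟨max (M / η) ρ + 1, (le_max_right _ _).trans_lt (by linarith), fun s hs => ?_⟩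
  rcases le_total K s with h | h
  · exact (hK s h).trans (mul_le_mul_of_nonneg_left hs hη.le)
  · have h1 : η * (M / η) ≤ η * (max (M / η) ρ + 1) :=
      mul_le_mul_of_nonneg_left (by linarith [le_max_left (M / η) ρ]) hη.le
    rw [mul_div_cancel₀ _ hη.ne'] at h1
    exact (hM s h).trans h1

end Nonlinearity

section Weight

lemma exists_pos_le_of_finite {m : ℕ} {f : ℕ → ℝ} (hf : ∀ i, 1 ≤ i → i ≤ m → 0 < f i) :
    ∃ c > 0, ∀ i, 1 ≤ i → i ≤ m → c ≤ f i := by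
  induction m with
  | zero => exact ⟨1, one_pos, fun i h1 h2 => by omega⟩
  | succ m ih =>
    obtain ⟨c, hc, h⟩ := ih fun i h1 h2 => hf i h1 (by omega)
    have h0 := hf (m + 1) (by omega) le_rfl
    refine ⟨min c (f (m + 1)), lt_min hc h0, fun i h1 h2 => ?_⟩
    rcases Nat.lt_or_ge m i with h' | h'
    · obtain rfl : i = m + 1 := by omega
      exact min_le_right _ _
    · exact (min_le_left _ _).trans (h i h1 h')

lemma exists_pos_ge_of_finite (m : ℕ) (f : ℕ → ℝ) :
    ∃ c > 0, ∀ i, 1 ≤ i → i ≤ m → f i ≤ c := by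
  refine ⟨1 + ∑ i ∈ Finset.range (m + 1), |f i|, by positivity, fun i _ hi => ?_⟩
  have := Finset.single_le_sum (f := fun i => |f i|) (fun i _ => abs_nonneg (f i))
    (Finset.mem_range.2 (Nat.lt_succ_of_le hi))
  linarith [le_abs_self (f i)]

/-- A positive integral stays large after cutting off short pieces at both ends. -/
lemma exists_margin {a : ℝ → ℝ} (ha : ∀ s t, IntervalIntegrable a volume s t) {x y : ℝ}
    (hxy : x < y) (hpos : 0 < ∫ t in x..y, a t) :
    ∃ D > 0, ∀ d, 0 < d → d ≤ D → x + d ≤ y - d ∧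
      (∫ t in x..y, a t) / 2 ≤ ∫ t in (x + d)..(y - d), a t := by
  have hcont : Continuous fun d : ℝ => ∫ t in (x + d)..(y - d), a t := by
    have h : (fun d : ℝ => ∫ t in (x + d)..(y - d), a t) =
        fun d => (∫ t in x..(y - d), a t) - ∫ t in x..(x + d), a t := funext fun d =>
      (intervalIntegral.integral_interval_sub_left (ha _ _) (ha _ _)).symm
    rw [h]
    have hp := intervalIntegral.continuous_primitive ha x
    exact (hp.comp (by fun_prop)).sub (hp.comp (by fun_prop))
  have hev : ∀ᶠ d in 𝓝 (0 : ℝ), (∫ t in x..y, a t) / 2 < ∫ t in (x + d)..(y - d), a t :=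
    hcont.continuousAt.eventually (lt_mem_nhds (by simpa using half_lt_self hpos))
  obtain ⟨δ, hδ, h⟩ := Metric.eventually_nhds_iff.1 hev
  refine ⟨min (δ / 2) ((y - x) / 2), by have := sub_pos.2 hxy; positivity, fun d h0 hd => ⟨?_, ?_⟩⟩
  · linarith [hd.trans (min_le_right _ _)]
  · refine (h ?_).le
    rw [Real.dist_eq, sub_zero, abs_of_pos h0]
    linarith [hd.trans (min_le_left _ _)]

lemma Function.Periodic.intervalIntegral_translate {f : ℝ → ℝ} {T : ℝ} (hf : Function.Periodic f T)
    (x y : ℝ) (l : ℤ) : ∫ t in (x + l * T)..(y + l * T), f t = ∫ t in x..y, f t := by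
  rw [← intervalIntegral.integral_comp_add_right f]
  simp only [hf.int_mul l _]

lemma Function.Periodic.ae_translate {f : ℝ → ℝ} {T : ℝ} (hf : Function.Periodic f T) {p : ℝ → Prop}
    {x y : ℝ} (h : ∀ᵐ t, t ∈ Icc x y → p (f t)) (l : ℤ) :
    ∀ᵐ t, t ∈ Icc (x + l * T) (y + l * T) → p (f t) := by
  filter_upwards [(measurePreserving_add_right volume (-(l * T))).quasiMeasurePreserving.ae h]
    with t ht hmem
  have h1 := ht ⟨by linarith [hmem.1], by linarith [hmem.2]⟩
  rwa [← sub_eq_add_neg, hf.sub_int_mul_eq l] at h1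

/-- Extension of `s 1, …, s m` to all integers (starting at index `0`) by translation by `T`. -/
noncomputable def translates (s : ℕ → ℝ) (T : ℝ) (m : ℕ) (n : ℤ) : ℝ :=
  s ((n % m).toNat + 1) + (n / m : ℤ) * T

variable {T : ℝ} {m : ℕ}

lemma translates_apply (s : ℕ → ℝ) {i : ℕ} (hi : i < m) (ℓ : ℤ) :
    translates s T m (i + ℓ * m) = s (i + 1) + ℓ * T := by
  have hm : (0 : ℤ) < m := by omega
  have hi' : (i : ℤ) < m := by exact_mod_cast hi
  rw [translates, Int.add_mul_ediv_right _ _ hm.ne', Int.ediv_eq_zero_of_lt (by positivity) hi',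
    zero_add, Int.add_mul_emod_self_right, Int.emod_eq_of_lt (by positivity) hi', Int.toNat_natCast]

lemma exists_eq_add_mul (hm : 1 ≤ m) (n : ℤ) : ∃ i < m, ∃ ℓ : ℤ, n = i + ℓ * m := by
  have hm' : (0 : ℤ) < m := by exact_mod_cast hm
  have h1 := Int.emod_nonneg n hm'.ne'
  have h2 := Int.emod_lt_of_pos n hm'
  refine ⟨(n % m).toNat, by omega, n / m, ?_⟩
  rw [Int.toNat_of_nonneg h1, mul_comm]
  exact (Int.emod_add_mul_ediv n m).symm

lemma translates_add (hm : 1 ≤ m) (s : ℕ → ℝ) (n : ℤ) :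
    translates s T m (n + m) = translates s T m n + T := by
  obtain ⟨i, hi, ℓ, rfl⟩ := exists_eq_add_mul hm n
  rw [show (i : ℤ) + ℓ * m + m = i + (ℓ + 1) * m by ring, translates_apply s hi,
    translates_apply s hi]
  push_cast; ring

lemma exists_translates_pos (hm : 1 ≤ m) (σ τ : ℕ → ℝ) (n : ℤ) :
    ∃ i, 1 ≤ i ∧ i ≤ m ∧ ∃ l : ℤ, translates σ T m n = σ i + l * T ∧
      translates τ T m n = τ i + l * T := by
  obtain ⟨i, hi, ℓ, rfl⟩ := exists_eq_add_mul hm n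
  exact ⟨i + 1, by omega, hi, ℓ, translates_apply σ hi ℓ, translates_apply τ hi ℓ⟩

lemma exists_translates_neg (hm : 1 ≤ m) {σ : ℕ → ℝ} (τ : ℕ → ℝ)
    (hσT : σ (m + 1) - σ 1 = T) (n : ℤ) :
    ∃ i, 1 ≤ i ∧ i ≤ m ∧ ∃ l : ℤ, translates τ T m (n - 1) = τ i + l * T ∧
      translates σ T m n = σ (i + 1) + l * T := by
  obtain ⟨i, hi, ℓ, rfl⟩ := exists_eq_add_mul hm n
  rcases Nat.eq_zero_or_pos i with rfl | hi0
  · refine ⟨m, hm, le_rfl, ℓ - 1, ?_, ?_⟩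
    · obtain ⟨j, rfl⟩ := Nat.exists_eq_add_of_le' hm
      rw [show ((0 : ℕ) : ℤ) + ℓ * (j + 1 : ℕ) - 1 = j + (ℓ - 1) * (j + 1 : ℕ) by push_cast; ring,
        translates_apply τ (by omega)]
    · rw [translates_apply σ hi, zero_add]
      push_cast
      linarith
  · obtain ⟨j, rfl⟩ := Nat.exists_eq_add_of_le' hi0
    refine ⟨j + 1, by omega, hi.le, ℓ, ?_, translates_apply σ hi ℓ⟩
    rw [show ((j + 1 : ℕ) : ℤ) + ℓ * m - 1 = j + ℓ * m by push_cast; ring,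
      translates_apply τ (by omega)]

end Weight

section Construction

lemma monotone_nodes {σ τ : ℕ → ℝ} {m : ℕ} (hστ : ∀ i, 1 ≤ i → i ≤ m → σ i < τ i)
    (hτσ : ∀ i, 1 ≤ i → i ≤ m → τ i < σ (i + 1)) {i j : ℕ} (hi : 1 ≤ i) (hij : i ≤ j)
    (hj : j ≤ m + 1) : σ i ≤ σ j := by
  induction j, hij using Nat.le_induction with
  | base => exact le_rfl
  | succ j hij ih =>
    have h1 := hστ j (by omega) (by omega)
    have h2 := hτσ j (by omega) (by omega)
    linarith [ih (by omega)]

/-- The weight `λ a⁺ - μ a⁻`. -/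
def weight (a : ℝ → ℝ) (lam mu : ℝ) (s : ℝ) : ℝ := lam * max (a s) 0 - mu * max (-a s) 0

lemma weight_periodic {a : ℝ → ℝ} {T : ℝ} (ha : Function.Periodic a T) (lam mu : ℝ) :
    Function.Periodic (weight a lam mu) T := fun t => by
  simp only [weight, ha t]

lemma weight_of_nonneg {a : ℝ → ℝ} {s : ℝ} (h : 0 ≤ a s) (lam mu : ℝ) :
    weight a lam mu s = lam * a s := by
  simp [weight, max_eq_left h, max_eq_right (neg_nonpos.2 h)]

lemma weight_of_nonpos {a : ℝ → ℝ} {s : ℝ} (h : a s ≤ 0) (lam mu : ℝ) :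
    weight a lam mu s = mu * a s := by
  simp [weight, max_eq_right h, max_eq_left (neg_nonneg.2 h)]

lemma weight_integrable {a : ℝ → ℝ} (ha : ∀ s t, IntervalIntegrable a volume s t) (lam mu s t : ℝ) :
    IntervalIntegrable (weight a lam mu) volume s t := by
  have h := intervalIntegrable_iff.1 (ha s t)
  have h1 : IntervalIntegrable (fun x => max (a x) 0) volume s t :=
    intervalIntegrable_iff.2 (Integrable.pos_part h)
  have h2 : IntervalIntegrable (fun x => max (-a x) 0) volume s t :=
    intervalIntegrable_iff.2 (Integrable.neg_part h)
  exact (h1.const_mul lam).sub (h2.const_mul mu)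

lemma integral_weight_of_nonneg {a : ℝ → ℝ} {x y α β : ℝ}
    (h : ∀ᵐ t, t ∈ Icc x y → 0 ≤ a t) (hα : x ≤ α) (hαβ : α ≤ β) (hβ : β ≤ y) (lam mu : ℝ) :
    ∫ t in α..β, weight a lam mu t = lam * ∫ t in α..β, a t := by
  rw [← intervalIntegral.integral_const_mul]
  refine intervalIntegral.integral_congr_ae ?_
  filter_upwards [h] with t ht hmem
  rw [uIoc_of_le hαβ] at hmem
  exact weight_of_nonneg (ht ⟨hα.trans hmem.1.le, hmem.2.trans hβ⟩) lam mu

lemma integral_neg_weight_of_nonpos {a : ℝ → ℝ} {x y : ℝ}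
    (h : ∀ᵐ t, t ∈ Icc x y → a t ≤ 0) (hxy : x ≤ y) (lam mu : ℝ) :
    ∫ t in x..y, -weight a lam mu t = mu * -∫ t in x..y, a t := by
  rw [intervalIntegral.integral_neg, mul_neg, ← intervalIntegral.integral_const_mul]
  refine congrArg _ (intervalIntegral.integral_congr_ae ?_)
  filter_upwards [h] with t ht hmem
  rw [uIoc_of_le hxy] at hmem
  exact weight_of_nonpos (ht ⟨hmem.1.le, hmem.2⟩) lam mu

theorem exists_setup (g a : ℝ → ℝ) (T : ℝ) (m : ℕ) (σ τ : ℕ → ℝ)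
    (hg_cont : ContinuousOn g (Ici 0))
    (hg_pos : ∀ s : ℝ, 0 < s → 0 < g s)
    (hg0 : Tendsto (fun s => g s / s) (𝓝[>] 0) (𝓝 0))
    (hginf : Tendsto (fun s => g s / s) atTop (𝓝 0))
    (hg_neg : ∀ s : ℝ, s ≤ 0 → g s = 0)
    (hT : 0 < T) (hm : 1 ≤ m)
    (hστ : ∀ i, 1 ≤ i → i ≤ m → σ i < τ i)
    (hτσ : ∀ i, 1 ≤ i → i ≤ m → τ i < σ (i + 1))
    (hσT : σ (m + 1) - σ 1 = T)
    (ha_per : ∀ t, a (t + T) = a t)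
    (ha_loc : LocallyIntegrable a)
    (ha_pos : ∀ i, 1 ≤ i → i ≤ m →
      (∀ᵐ t : ℝ ∂volume, t ∈ Icc (σ i) (τ i) → 0 ≤ a t) ∧
        0 < ∫ t in (σ i)..(τ i), a t)
    (ha_neg : ∀ i, 1 ≤ i → i ≤ m →
      (∀ᵐ t : ℝ ∂volume, t ∈ Icc (τ i) (σ (i + 1)) → a t ≤ 0) ∧
        (∫ t in (τ i)..(σ (i + 1)), a t) < 0) {ρ : ℝ} (hρ : 0 < ρ) :
    ∃ lamStar : ℝ, 0 < lamStar ∧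
      ∀ lam : ℝ, lamStar < lam → ∃ r R : ℝ, 0 < r ∧ r < ρ ∧ ρ < R ∧
        ∃ muStar : ℝ, 0 < muStar ∧ ∀ mu : ℝ, muStar < mu →
          ∃ E : Setup, E.g = g ∧ E.q = weight a lam mu ∧ E.σ = translates σ T m ∧
            E.τ = translates τ T m ∧ E.m = m ∧ E.T = T ∧ E.r = r ∧ E.ρ = ρ ∧ E.R = R := by
  have hg := continuous_of_zero_on_neg hg_cont hg_neg
  have hg_nonneg : ∀ s, 0 ≤ g s := fun s => by
    rcases le_or_gt s 0 with h | h
    · exact (hg_neg s h).ge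
    · exact (hg_pos s h).le
  have hii : ∀ s t, IntervalIntegrable a volume s t := fun s t =>
    intervalIntegrable_iff.2 ((ha_loc.integrableOn_isCompact isCompact_uIcc).mono_set
      uIoc_subset_uIcc)
  have hper : Function.Periodic a T := ha_per
  have hlen : ∀ i, 1 ≤ i → i ≤ m → σ 1 ≤ σ i ∧ σ (i + 1) ≤ σ 1 + T := fun i h1 h2 =>
    ⟨monotone_nodes hστ hτσ le_rfl h1 (by omega), by
      linarith [monotone_nodes hστ hτσ (i := i + 1) (j := m + 1) (by omega) (by omega) le_rfl]⟩
  -- constants attached to the weight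
  have hmargin : ∀ i, ∃ D, (1 ≤ i → i ≤ m → 0 < D) ∧ (1 ≤ i → i ≤ m → ∀ d, 0 < d → d ≤ D →
      σ i + d ≤ τ i - d ∧
        (∫ t in (σ i)..(τ i), a t) / 2 ≤ ∫ t in (σ i + d)..(τ i - d), a t) := fun i => by
    by_cases h : 1 ≤ i ∧ i ≤ m
    · obtain ⟨D, h1, h2⟩ := exists_margin hii (hστ i h.1 h.2) (ha_pos i h.1 h.2).2
      exact ⟨D, fun _ _ => h1, fun _ _ => h2⟩
    · exact ⟨0, fun h1 h2 => absurd ⟨h1, h2⟩ h, fun h1 h2 => absurd ⟨h1, h2⟩ h⟩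
  choose D hD hD' using hmargin
  obtain ⟨d, hd, hdD⟩ := exists_pos_le_of_finite hD
  obtain ⟨A', hA', hA'le⟩ := exists_pos_le_of_finite (f := fun i => (∫ t in (σ i)..(τ i), a t) / 2)
    fun i h1 h2 => half_pos (ha_pos i h1 h2).2
  obtain ⟨A, hA, hAle⟩ := exists_pos_ge_of_finite m fun i => ∫ t in (σ i)..(τ i), a t
  obtain ⟨B, hB, hBle⟩ := exists_pos_le_of_finite (f := fun i => -∫ t in (τ i)..(σ (i + 1)), a t)
    fun i h1 h2 => neg_pos.2 (ha_neg i h1 h2).2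
  have hd2 : ∀ i, 1 ≤ i → i ≤ m → d + d ≤ τ i - σ i := fun i h1 h2 => by
    linarith [(hD' i h1 h2 d hd (hdD i h1 h2)).1]
  have hdT : d / 2 ≤ T := by
    linarith [hd2 1 le_rfl hm, (hlen 1 le_rfl hm).2, hτσ 1 le_rfl hm]
  obtain ⟨γ₀, hγ₀, hγ₀le⟩ := exists_pos_lower_bound hg hg_pos (x := ρ * (d / 2) / T) (y := ρ)
    (by positivity) (by rw [div_le_iff₀ hT]; exact mul_le_mul_of_nonneg_left hdT hρ.le)
  obtain ⟨C, hC⟩ := exists_linear_bound hg hg_neg hg0 hginf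
  refine ⟨2 * ρ / d / (γ₀ * A'), by positivity, fun lam hlam => ?_⟩
  have hlam0 : 0 < lam := lt_trans (by positivity) hlam
  set η := 1 / (8 * T) / (lam * A) with hηdef
  have hη : 0 < η := by positivity
  obtain ⟨r, hr, hrρ, hsmall_r⟩ := exists_small_level hg_neg hg0 hη hρ
  obtain ⟨R, hρR, hsmall_R⟩ := exists_large_level (ρ := ρ) hg hg_neg hginf hη
  have hR : 0 < R := hρ.trans hρR
  obtain ⟨γ, hγ, hγle⟩ := exists_pos_lower_bound hg hg_pos (x := r / 4)
    (y := R + T * (R / d + R / (8 * T)) + 1 + ((R + 1) / d + R / (8 * T)) * T) (by positivity) (by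
      have h1 : 0 < T * (R / d + R / (8 * T)) := by positivity
      have h2 : 0 < ((R + 1) / d + R / (8 * T)) * T := by positivity
      linarith)
  set K := (R + 1) / d + R / (8 * T) + (R + T * (R / d + R / (8 * T)) + 1) / T with hK
  have hK0 : 0 < K := by positivity
  refine ⟨r, R, hr, hrρ, hρR, K / (γ * B), by positivity, fun mu hmu => ?_⟩
  have hmu0 : 0 < mu := lt_trans (by positivity) hmu
  have hwper := weight_periodic hper lam mu
  have hq_nonneg : ∀ i, 1 ≤ i → i ≤ m → ∀ᵐ t, t ∈ Icc (σ i) (τ i) → 0 ≤ weight a lam mu t :=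
    fun i h1 h2 => by
      filter_upwards [(ha_pos i h1 h2).1] with t ht hmem
      rw [weight_of_nonneg (ht hmem)]
      exact mul_nonneg hlam0.le (ht hmem)
  have hq_nonpos : ∀ i, 1 ≤ i → i ≤ m →
      ∀ᵐ t, t ∈ Icc (τ i) (σ (i + 1)) → weight a lam mu t ≤ 0 := fun i h1 h2 => by
    filter_upwards [(ha_neg i h1 h2).1] with t ht hmem
    rw [weight_of_nonpos (ht hmem)]
    exact mul_nonpos_of_nonneg_of_nonpos hmu0.le (ht hmem)
  refine ⟨{
    g := g
    q := weight a lam mu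
    σ := translates σ T m
    τ := translates τ T m
    m := m
    T := T
    d := d
    r := r
    ρ := ρ
    R := R
    C := C
    η := η
    γ₀ := γ₀
    γ := γ
    g_cont := hg
    g_nonneg := hg_nonneg
    g_neg := hg_neg
    g_le := hC
    q_int := weight_integrable hii lam mu
    q_per := hwper
    m_pos := hm
    T_pos := hT
    d_pos := hd
    r_pos := hr
    r_lt := hrρ
    ρ_lt := hρR
    η_nonneg := hη.le
    σ_per := translates_add hm σ
    τ_per := translates_add hm τ
    σ_lt := fun n => ?_
    τ_lt := fun n => ?_
    len_pos := fun n => ?_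
    len_neg := fun n => ?_
    d_le := fun n => ?_
    q_nonneg := fun n => ?_
    q_nonpos := fun n => ?_
    small_r := hsmall_r
    small_R := hsmall_R
    η_le := fun n => ?_
    γ₀_le := hγ₀le
    core := fun n => ?_
    γ_le := hγle
    γ_big := fun n => ?_ }, rfl, rfl, rfl, rfl, rfl, rfl, rfl, rfl, rfl⟩
  · obtain ⟨i, h1, h2, l, hσ, hτ⟩ := exists_translates_pos (T := T) hm σ τ n
    linarith [hστ i h1 h2]
  · obtain ⟨i, h1, h2, l, hτ, hσ⟩ := exists_translates_neg hm τ hσT n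
    linarith [hτσ i h1 h2]
  · obtain ⟨i, h1, h2, l, hσ, hτ⟩ := exists_translates_pos (T := T) hm σ τ n
    linarith [hτσ i h1 h2, hlen i h1 h2]
  · obtain ⟨i, h1, h2, l, hτ, hσ⟩ := exists_translates_neg hm τ hσT n
    linarith [hστ i h1 h2, hlen i h1 h2]
  · obtain ⟨i, h1, h2, l, hσ, hτ⟩ := exists_translates_pos (T := T) hm σ τ n
    linarith [hd2 i h1 h2]
  · obtain ⟨i, h1, h2, l, hσ, hτ⟩ := exists_translates_pos (T := T) hm σ τ n
    rw [hσ, hτ]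
    exact hwper.ae_translate (p := fun x => 0 ≤ x) (hq_nonneg i h1 h2) l
  · obtain ⟨i, h1, h2, l, hτ, hσ⟩ := exists_translates_neg hm τ hσT n
    rw [hσ, hτ]
    exact hwper.ae_translate (p := fun x => x ≤ 0) (hq_nonpos i h1 h2) l
  · obtain ⟨i, h1, h2, l, hσ, hτ⟩ := exists_translates_pos (T := T) hm σ τ n
    rw [hσ, hτ, hwper.intervalIntegral_translate,
      integral_weight_of_nonneg (ha_pos i h1 h2).1 le_rfl (hστ i h1 h2).le le_rfl]
    calc η * (lam * ∫ t in (σ i)..(τ i), a t) ≤ η * (lam * A) :=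
          mul_le_mul_of_nonneg_left (mul_le_mul_of_nonneg_left (hAle i h1 h2) hlam0.le) hη.le
      _ = 1 / (8 * T) := div_mul_cancel₀ _ (by positivity)
  · obtain ⟨i, h1, h2, l, hσ, hτ⟩ := exists_translates_pos (T := T) hm σ τ n
    obtain ⟨h3, h4⟩ := hD' i h1 h2 d hd (hdD i h1 h2)
    refine ⟨σ i + d + l * T, τ i - d + l * T, by linarith, by linarith, by linarith, ?_⟩
    rw [hwper.intervalIntegral_translate,
      integral_weight_of_nonneg (ha_pos i h1 h2).1 (by linarith) h3 (by linarith)]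
    rw [div_lt_iff₀ (by positivity)] at hlam
    calc 2 * ρ / d < lam * (γ₀ * A') := hlam
      _ = γ₀ * (lam * A') := by ring
      _ ≤ _ := mul_le_mul_of_nonneg_left (mul_le_mul_of_nonneg_left
          ((hA'le i h1 h2).trans h4) hlam0.le) hγ₀.le
  · obtain ⟨i, h1, h2, l, hτ, hσ⟩ := exists_translates_neg hm τ hσT n
    have hnper : Function.Periodic (fun t => -weight a lam mu t) T := fun t => by
      simp only [hwper t]
    rw [hσ, hτ, hnper.intervalIntegral_translate,
      integral_neg_weight_of_nonpos (ha_neg i h1 h2).1 (hτσ i h1 h2).le]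
    rw [div_lt_iff₀ (by positivity)] at hmu
    calc K ≤ mu * (γ * B) := hmu.le
      _ = γ * (mu * B) := by ring
      _ ≤ _ := mul_le_mul_of_nonneg_left (mul_le_mul_of_nonneg_left (hBle i h1 h2) hmu0.le) hγ.le

end Construction

theorem stmt_17 (g a : ℝ → ℝ) (T : ℝ) (m : ℕ) (σ τ : ℕ → ℝ)
    (hg_cont : ContinuousOn g (Ici 0)) (hg_zero : g 0 = 0)
    (hg_pos : ∀ s : ℝ, 0 < s → 0 < g s)
    (hg0 : Tendsto (fun s => g s / s) (nhdsWithin 0 (Ioi 0)) (nhds 0))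
    (hginf : Tendsto (fun s => g s / s) atTop (nhds 0))
    -- `g` is extended to `ℝ` by `0` on the negative half-line
    (hg_neg : ∀ s : ℝ, s ≤ 0 → g s = 0)
    (hT : 0 < T)
    (hm : 1 ≤ m)
    (hστ : ∀ i, 1 ≤ i → i ≤ m → σ i < τ i)
    (hτσ : ∀ i, 1 ≤ i → i ≤ m → τ i < σ (i + 1))
    (hσT : σ (m + 1) - σ 1 = T)
    (ha_per : ∀ t, a (t + T) = a t)
    -- `T` is the minimal period of `a`
    (ha_min : ∀ T' : ℝ, 0 < T' → (∀ t, a (t + T') = a t) → T ≤ T')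
    (ha_loc : LocallyIntegrable a)
    (ha_pos : ∀ i, 1 ≤ i → i ≤ m →
      (∀ᵐ t : ℝ ∂volume, t ∈ Icc (σ i) (τ i) → 0 ≤ a t) ∧
        0 < ∫ t in (σ i)..(τ i), a t)
    (ha_neg : ∀ i, 1 ≤ i → i ≤ m →
      (∀ᵐ t : ℝ ∂volume, t ∈ Icc (τ i) (σ (i + 1)) → a t ≤ 0) ∧
        (∫ t in (τ i)..(σ (i + 1)), a t) < 0) :
    ∀ ρ : ℝ, 0 < ρ → ∃ lamStar : ℝ, 0 < lamStar ∧
      ∀ lam : ℝ, lamStar < lam → ∃ r R : ℝ, 0 < r ∧ r < ρ ∧ ρ < R ∧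
        ∃ muStar : ℝ, 0 < muStar ∧ ∀ mu : ℝ, muStar < mu →
          ∀ Y : Set C(ℝ, ℝ × ℝ),
            -- `Y` is the set `Y₀` of pairs `(x, x')` with `x` a globally defined solution
            -- of `u'' + (λ a⁺ - μ a⁻) g(u) = 0` satisfying `0 ≤ x ≤ R`
            Y = {z : C(ℝ, ℝ × ℝ) |
              (∀ t, HasDerivAt (fun s => (z s).1) ((z t).2) t) ∧
              (∀ t₀ t : ℝ, (z t).2 = (z t₀).2 -
                ∫ s in t₀..t, (lam * max (a s) 0 - mu * max (-a s) 0) * g ((z s).1)) ∧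
              ∀ t, 0 ≤ (z t).1 ∧ (z t).1 ≤ R} →
            -- (i) trichotomy: exactly one of the three (mutually exclusive) alternatives
            (∀ z ∈ Y, ∀ i, 1 ≤ i → i ≤ m → ∀ ℓ : ℤ,
              codeSup σ τ T z i ℓ < r ∨
              (r < codeSup σ τ T z i ℓ ∧ codeSup σ τ T z i ℓ < ρ) ∨
              (ρ < codeSup σ τ T z i ℓ ∧ codeSup σ τ T z i ℓ < R)) ∧
            ∃ π : Y → (ℤ → Fin m → Fin 3),
              -- π is the coding map determined by the three alternatives
              (∀ z : Y, ∀ ℓ : ℤ, ∀ i : Fin m,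
                (π z ℓ i = 0 ↔ codeSup σ τ T z.1 (i.1 + 1) ℓ < r) ∧
                (π z ℓ i = 1 ↔ r < codeSup σ τ T z.1 (i.1 + 1) ℓ ∧
                  codeSup σ τ T z.1 (i.1 + 1) ℓ < ρ) ∧
                (π z ℓ i = 2 ↔ ρ < codeSup σ τ T z.1 (i.1 + 1) ℓ ∧
                  codeSup σ τ T z.1 (i.1 + 1) ℓ < R)) ∧
              -- (ii) π is continuous and surjective
              Continuous π ∧
              Function.Surjective π ∧
              -- (iii) equivariance: π ∘ ψ = shift ∘ π
              (∀ z : Y, ∃ hz : (z.1.comp ⟨fun t => t + T, by continuity⟩) ∈ Y,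
                π ⟨z.1.comp ⟨fun t => t + T, by continuity⟩, hz⟩ =
                  fun ℓ => π z (ℓ + 1)) ∧
              -- (iv) any k-periodic sequence has a preimage given by a kT-periodic solution
              (∀ k : ℕ, 1 ≤ k → ∀ s : ℤ → Fin m → Fin 3,
                (∀ ℓ, s (ℓ + k) = s ℓ) →
                ∃ z : Y, π z = s ∧ ∀ t : ℝ, (z.1 (t + k * T)).1 = (z.1 t).1) := by
  intro ρ hρ
  obtain ⟨lamStar, hlamStar, H⟩ := exists_setup g a T m σ τ hg_cont hg_pos hg0 hginf hg_neg hT hm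
    hστ hτσ hσT ha_per ha_loc ha_pos ha_neg hρ
  refine ⟨lamStar, hlamStar, fun lam hlam => ?_⟩
  obtain ⟨r, R, hr, hrρ, hρR, muStar, hmuStar, H'⟩ := H lam hlam
  refine ⟨r, R, hr, hrρ, hρR, muStar, hmuStar, fun mu hmu Y hY => ?_⟩
  obtain ⟨E, hg, hq, hσ, hτ, rfl, rfl, rfl, rfl, rfl⟩ := H' mu hmu
  exact E.semiconjugacy (fun i hi ℓ => by rw [hσ]; exact translates_apply σ hi ℓ)
    (fun i hi ℓ => by rw [hτ]; exact translates_apply τ hi ℓ)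
    (fun z => by rw [hY, E.sol_iff, hg, hq]; rfl)
end

section
/- Let m ≥ 1 and let d be an integer-valued function on the set 𝔸 of Cartesian products A₁ × … × A_m with each A_i a subset of {0,1,2}. Assume d satisfies: (additivity) for every 𝒜 ∈ 𝔸, every index i and every decomposition B_i = B'_i ∪ B''_i with B'_i, B''_i ⊆ {0,1,2} disjoint, d(𝒜[i:B_i]) = d(𝒜[i:B'_i]) + d(𝒜[i:B''_i]); (R1) if there exists an index i with A_i = {0,1} and A_j ∈ {{0},{0,1,2}} for all j with A_j ≠ {0,1}, then d(A₁ × … × A_m) = 0; (R2) if A_i ∈ {{0},{0,1,2}} for all i, then d(A₁ × … × A_m) = 1. Then for every A₁ × … × A_m with A_i ∈ {{0},{1},{2},{0,1,2}} for all i, one has d(A₁ × … × A_m) = (−1)^{#ℐ}, where ℐ := { i ∈ {1,…,m} : A_i = {1} }. -/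
/-- The sign of a point of `{0, 1, 2}`: it is `-1` at `1` and `1` elsewhere. -/
def pointSign (x : Fin 3) : ℤ := if x = 1 then -1 else 1

/-- The additive extension of `pointSign` to subsets of `{0, 1, 2}`. -/
def signSum (S : Finset (Fin 3)) : ℤ := ∑ x ∈ S, pointSign x

theorem signSum_union {S T : Finset (Fin 3)} (h : Disjoint S T) :
    signSum (S ∪ T) = signSum S + signSum T :=
  Finset.sum_union h

/-- An additive function on the subsets of `{0, 1, 2}` is determined by its values on the
flag `{0} ⊆ {0, 1} ⊆ {0, 1, 2}`. -/
theorem additive_eq_of_eq_on_flag {f g : Finset (Fin 3) → ℤ}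
    (hf : ∀ S T, Disjoint S T → f (S ∪ T) = f S + f T)
    (hg : ∀ S T, Disjoint S T → g (S ∪ T) = g S + g T)
    (h0 : f {0} = g {0}) (h01 : f {0, 1} = g {0, 1})
    (huniv : f Finset.univ = g Finset.univ) (S : Finset (Fin 3)) : f S = g S := by
  have h1 : f {1} = g {1} := by
    have hu : ({0} ∪ {1} : Finset (Fin 3)) = {0, 1} := by decide
    have hf' := hf {0} {1} (by decide)
    have hg' := hg {0} {1} (by decide)
    rw [hu] at hf' hg'
    linarith
  have h2 : f {2} = g {2} := by
    have hu : ({0, 1} ∪ {2} : Finset (Fin 3)) = Finset.univ := by decide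
    have hf' := hf {0, 1} {2} (by decide)
    have hg' := hg {0, 1} {2} (by decide)
    rw [hu] at hf' hg'
    linarith
  induction S using Finset.induction_on with
  | empty =>
    have hf' := hf ∅ ∅ (Finset.disjoint_empty_left _)
    have hg' := hg ∅ ∅ (Finset.disjoint_empty_left _)
    rw [Finset.empty_union] at hf' hg'
    linarith
  | insert x S hx ih =>
    rw [Finset.insert_eq, hf _ _ (Finset.disjoint_singleton_left.2 hx),
      hg _ _ (Finset.disjoint_singleton_left.2 hx), ih]
    fin_cases x
    · exact congrArg (· + g S) h0
    · exact congrArg (· + g S) h1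
    · exact congrArg (· + g S) h2

theorem prod_signSum_update {ι : Type*} [Fintype ι] [DecidableEq ι]
    (A : ι → Finset (Fin 3)) (i : ι) (S : Finset (Fin 3)) :
    ∏ j, signSum (Function.update A i S j) =
      signSum S * ∏ j ∈ Finset.univ.erase i, signSum (A j) := by
  rw [← Finset.mul_prod_erase _ _ (Finset.mem_univ i), Function.update_self]
  congr 1
  refine Finset.prod_congr rfl fun j hj => ?_
  rw [Function.update_of_ne (Finset.ne_of_mem_erase hj)]

/-- A coordinatewise additive function that agrees with `∏ i, signSum (A i)` on products of
members of the flag `{0} ⊆ {0, 1} ⊆ {0, 1, 2}` agrees with it everywhere. -/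
theorem eq_prod_signSum {ι : Type*} [Fintype ι] [DecidableEq ι]
    {d : (ι → Finset (Fin 3)) → ℤ}
    (hadd : ∀ (A : ι → Finset (Fin 3)) (i : ι) (S T : Finset (Fin 3)), Disjoint S T →
      d (Function.update A i (S ∪ T)) = d (Function.update A i S) + d (Function.update A i T))
    (hflag : ∀ A : ι → Finset (Fin 3), (∀ i, A i = {0} ∨ A i = {0, 1} ∨ A i = Finset.univ) →
      d A = ∏ i, signSum (A i))
    (A : ι → Finset (Fin 3)) : d A = ∏ i, signSum (A i) := by
  suffices h : ∀ (T : Finset ι) (A : ι → Finset (Fin 3)),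
      (∀ i ∉ T, A i = {0} ∨ A i = {0, 1} ∨ A i = Finset.univ) → d A = ∏ i, signSum (A i) from
    h Finset.univ A fun i hi => absurd (Finset.mem_univ i) hi
  intro T
  induction T using Finset.induction_on with
  | empty => exact fun A hA => hflag A fun i => hA i (Finset.notMem_empty i)
  | insert i T _ ih =>
    intro A hA
    have hupdate : ∀ S : Finset (Fin 3), S = {0} ∨ S = {0, 1} ∨ S = Finset.univ →
        d (Function.update A i S) = ∏ j, signSum (Function.update A i S j) := by
      refine fun S hS => ih _ fun j hj => ?_
      rcases eq_or_ne j i with rfl | hji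
      · rwa [Function.update_self]
      · rw [Function.update_of_ne hji]
        exact hA j (by simp [hji, hj])
    have key := additive_eq_of_eq_on_flag (f := fun S => d (Function.update A i S))
      (g := fun S => ∏ j, signSum (Function.update A i S j)) (hadd A i)
      (fun S T hST => by simp only [prod_signSum_update, signSum_union hST, add_mul])
      (hupdate _ (by simp)) (hupdate _ (by simp)) (hupdate _ (by simp)) (A i)
    simpa only [Function.update_eq_self] using key

theorem stmt_19 (m : ℕ) (hm : 1 ≤ m)
    (d : (Fin m → Finset (Fin 3)) → ℤ)
    -- additivity: if `B_i = B'_i ∪ B''_i` with `B'_i, B''_i` disjoint, then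
    -- `d(𝒜[i:B_i]) = d(𝒜[i:B'_i]) + d(𝒜[i:B''_i])`
    (hadd : ∀ (A : Fin m → Finset (Fin 3)) (i : Fin m) (B' B'' : Finset (Fin 3)),
      Disjoint B' B'' →
      d (Function.update A i (B' ∪ B'')) =
        d (Function.update A i B') + d (Function.update A i B''))
    -- rule (R1)
    (hR1 : ∀ A : Fin m → Finset (Fin 3),
      (∃ i, A i = ({0, 1} : Finset (Fin 3))) →
      (∀ j, A j ≠ ({0, 1} : Finset (Fin 3)) →
        A j = ({0} : Finset (Fin 3)) ∨ A j = (Finset.univ : Finset (Fin 3))) →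
      d A = 0)
    -- rule (R2)
    (hR2 : ∀ A : Fin m → Finset (Fin 3),
      (∀ i, A i = ({0} : Finset (Fin 3)) ∨ A i = (Finset.univ : Finset (Fin 3))) →
      d A = 1) :
    ∀ A : Fin m → Finset (Fin 3),
      (∀ i, A i = ({0} : Finset (Fin 3)) ∨ A i = ({1} : Finset (Fin 3)) ∨
        A i = ({2} : Finset (Fin 3)) ∨ A i = (Finset.univ : Finset (Fin 3))) →
      d A = (-1) ^ (Finset.univ.filter
        (fun i => A i = ({1} : Finset (Fin 3)))).card := by
  intro A hA
  rw [eq_prod_signSum hadd ?_ A, ← Finset.prod_const, Finset.prod_filter]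
  · refine Finset.prod_congr rfl fun i _ => ?_
    rcases hA i with h | h | h | h <;> rw [h] <;> decide
  · intro A hA
    by_cases h : ∃ i, A i = {0, 1}
    · rw [hR1 A h fun j hj => (hA j).imp_right fun h' => h'.resolve_left hj]
      obtain ⟨i, hi⟩ := h
      refine (Finset.prod_eq_zero (Finset.mem_univ i) ?_).symm
      rw [hi]
      decide
    · have hA' : ∀ i, A i = {0} ∨ A i = Finset.univ := fun i =>
        (hA i).imp_right fun h' => h'.resolve_left fun hi => h ⟨i, hi⟩
      rw [hR2 A hA']
      refine (Finset.prod_eq_one fun i _ => ?_).symm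
      rcases hA' i with h' | h' <;> rw [h'] <;> decide
end
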